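/- arXiv:1312.4244 — 4 statements merged into one kernel-verified Lean document; each statement's English description precedes it below -/
import Mathlib

section
/- Define L̃ₙ(t) = (n γₙ)^{−1/2} Σ_{j=1}^{n} Σ_{k=2}^{N_j(γₙ t)+1} (1 − μ ξ_{j,k}). Then for every fixed t ≥ 0, L̃ₙ(t) converges in distribution, as n → ∞, to a centered Gaussian random variable with variance μ c_S² t (interpreted as the point mass at 0 when c_S² t = 0). -/
open MeasureTheory ProbabilityTheory Set Filter

set_option linter.unusedSectionVars false

structure CSetup {Ω : Type*} [MeasurableSpace Ω] (P : Measure Ω) (μ s2 c2 e1 : ℝ)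
    (x : ℕ × ℕ → Ω → ℝ) : Prop where
  hμ : 0 < μ
  meas : ∀ p, Measurable (x p)
  nonneg : ∀ p ω, 0 ≤ x p ω
  indep : iIndepFun x P
  int0 : ∀ j, Integrable (x (j, 0)) P
  mean0 : ∀ j, ∫ ω, x (j, 0) ω ∂P = e1
  intsq : ∀ j i, Integrable (fun ω => x (j, i + 1) ω ^ 2) P
  meansq : ∀ j i, ∫ ω, x (j, i + 1) ω ^ 2 ∂P = s2
  Xmean : ∀ j i, ∫ ω, (1 - μ * x (j, i + 1) ω) ∂P = 0
  Xsq : ∀ j i, ∫ ω, (1 - μ * x (j, i + 1) ω) ^ 2 ∂P = c2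
  hs2 : 0 ≤ s2
  hc2 : 0 ≤ c2
  he1 : 0 ≤ e1

lemma det_M (x : ℕ → ℝ) (hx : ∀ i, 0 ≤ x i) (T : ℝ) (K : ℕ) :
    ∃ M ≤ K, ∀ i < K, (∑ l ∈ Finset.range (i + 1), x l ≤ T ↔ i < M) := by
  induction K with
  | zero => exact ⟨0, le_rfl, by simp⟩
  | succ K ih =>
    obtain ⟨M, hM, h⟩ := ih
    by_cases hK : M = K ∧ ∑ l ∈ Finset.range (K + 1), x l ≤ T
    · refine ⟨K + 1, le_rfl, fun i hi => ?_⟩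
      rcases Nat.lt_succ_iff_lt_or_eq.1 hi with h1 | h1
      · rw [h i h1]; omega
      · subst h1; simp [hK.2]
    · refine ⟨M, by omega, fun i hi => ?_⟩
      rcases Nat.lt_succ_iff_lt_or_eq.1 hi with h1 | h1
      · exact h i h1
      · subst h1
        refine ⟨fun h2 => ?_, fun h2 => by omega⟩
        by_contra h3
        have hMi : M < i := lt_of_le_of_ne hM (fun h4 => hK ⟨h4, h2⟩)
        have h5 := (h M hMi).not.2 (lt_irrefl _)
        apply h5
        refine le_trans ?_ h2
        exact Finset.sum_le_sum_of_subset_of_nonneg (Finset.range_mono (by omega))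
          (fun i _ _ => hx i)

lemma sum_trunc (f : ℕ → ℝ) {M K : ℕ} (h : M ≤ K) :
    ∑ i ∈ Finset.range K, (if i < M then (1:ℝ) else 0) * f i = ∑ i ∈ Finset.range M, f i := by
  rw [← Finset.sum_subset (Finset.range_mono h)
    (f := fun i => (if i < M then (1:ℝ) else 0) * f i)]
  · exact Finset.sum_congr rfl fun i hi => by simp [Finset.mem_range.1 hi]
  · intro i _ hi
    simp at hi
    simp [hi]

lemma sum_dist (m : ℕ) {M K : ℕ} (h : M ≤ K) (hm : m ≤ K) :
    ∑ i ∈ Finset.range K, ((if i < M then (1:ℝ) else 0) - (if i < m then (1:ℝ) else 0)) ^ 2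
      = |(M:ℝ) - m| := by
  wlog hmM : m ≤ M generalizing m M
  · rw [abs_sub_comm, ← this M hm h (by omega)]
    exact Finset.sum_congr rfl fun i _ => by ring
  have h1 := sum_trunc (fun _ => 1) h
  have h2 := sum_trunc (fun _ => 1) hm
  simp only [mul_one, Finset.sum_const, Finset.card_range, nsmul_eq_mul] at h1 h2
  rw [abs_of_nonneg (by rw [sub_nonneg]; exact_mod_cast hmM), ← h1, ← h2,
    ← Finset.sum_sub_distrib]
  refine Finset.sum_congr rfl fun i _ => ?_
  split_ifs <;> first | omega | norm_num

lemma det_bound (x : ℕ → ℝ) (hx : ∀ i, 0 ≤ x i) (T : ℝ) (hT : 0 ≤ T) (K : ℕ) (μ ε : ℝ)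
    (hμ : 0 < μ) (hε : 0 < ε) (d : ℕ → ℝ)
    (hd : ∀ i, d i = if ∑ l ∈ Finset.range (i + 1), x l ≤ T then 1 else 0) :
    ∑ i ∈ Finset.range K, d i ≤ μ * T + |∑ i ∈ Finset.range K, d i * (1 - μ * x (i + 1))| +
      μ * (1 / (2 * ε) + ε / 2 * ∑ i ∈ Finset.range K, d i * x (i + 1) ^ 2) ∧
    (μ * T ≤ K → μ * T - ∑ i ∈ Finset.range K, d i ≤
      |∑ i ∈ Finset.range K, d i * (1 - μ * x (i + 1))| + μ * x 0) := by
  obtain ⟨M, hMK, hM⟩ := det_M x hx T K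
  have key : ∀ f : ℕ → ℝ, ∑ i ∈ Finset.range K, d i * f i = ∑ i ∈ Finset.range M, f i := by
    intro f
    rw [← sum_trunc f hMK]
    refine Finset.sum_congr rfl fun i hi => ?_
    rw [hd]; simp only [hM i (Finset.mem_range.1 hi)]
  have k1 : ∑ i ∈ Finset.range K, d i = M := by simpa using key (fun _ => 1)
  rw [key, key, k1]
  have hS : ∑ i ∈ Finset.range M, (1 - μ * x (i + 1)) =
      M - μ * ∑ i ∈ Finset.range M, x (i + 1) := by
    rw [Finset.sum_sub_distrib, ← Finset.mul_sum]; simp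
  have habs := neg_abs_le (∑ i ∈ Finset.range M, (1 - μ * x (i + 1)))
  have habs' := le_abs_self (∑ i ∈ Finset.range M, (1 - μ * x (i + 1)))
  set Y := |∑ i ∈ Finset.range M, (1 - μ * x (i + 1))| with hY
  rw [hS] at habs habs'
  constructor
  · have hQ : 0 ≤ ∑ i ∈ Finset.range M, x (i + 1) ^ 2 := Finset.sum_nonneg fun i _ => sq_nonneg _
    have : ∑ i ∈ Finset.range M, x (i + 1) ≤
        T + (1 / (2 * ε) + ε / 2 * ∑ i ∈ Finset.range M, x (i + 1) ^ 2) := by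
      rcases M with _ | M
      · simp; positivity
      · have h1 := (hM M (by omega)).2 (by omega)
        rw [Finset.sum_range_succ'] at h1
        have h2 : x (M + 1) ^ 2 ≤ ∑ i ∈ Finset.range (M + 1), x (i + 1) ^ 2 :=
          Finset.single_le_sum (f := fun i => x (i + 1) ^ 2) (fun i _ => sq_nonneg _) (by simp)
        have h3 : x (M + 1) ≤ 1 / (2 * ε) + ε / 2 * x (M + 1) ^ 2 := by
          have : 0 ≤ (ε * x (M + 1) - 1) ^ 2 / (2 * ε) := by positivity
          have e : (ε * x (M + 1) - 1) ^ 2 / (2 * ε) =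
            1 / (2 * ε) + ε / 2 * x (M + 1) ^ 2 - x (M + 1) := by field_simp; ring
          linarith
        have h4 : ε / 2 * x (M + 1) ^ 2 ≤
          ε / 2 * ∑ i ∈ Finset.range (M + 1), x (i + 1) ^ 2 := by gcongr
        rw [Finset.sum_range_succ]
        have := hx 0
        linarith
    have := mul_le_mul_of_nonneg_left this hμ.le
    linarith
  · intro hK
    rcases hMK.lt_or_eq with h | h
    · have h1 := (hM M h).not.2 (lt_irrefl _)
      rw [Finset.sum_range_succ'] at h1
      have := mul_le_mul_of_nonneg_left (not_le.1 h1).le hμ.le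
      linarith
    · subst h
      have := mul_nonneg hμ.le (hx 0)
      have : 0 ≤ Y := abs_nonneg _
      linarith

lemma det_N (x : ℕ → ℝ) (hx : ∀ i, 0 ≤ x i) (T : ℝ) (hT : 0 ≤ T) (K : ℕ)
    (hK : T < ∑ l ∈ Finset.range K, x l) (f : ℕ → ℝ) :
    ∑ k ∈ Finset.Icc 2 (sSup {k : ℕ | ∑ l ∈ Finset.range k, x l ≤ T} + 1), f k =
    ∑ i ∈ Finset.range K,
      (if ∑ l ∈ Finset.range (i + 1), x l ≤ T then (1:ℝ) else 0) * f (i + 2) := by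
  obtain ⟨M, hMK, hM⟩ := det_M x hx T K
  have hset : {k : ℕ | ∑ l ∈ Finset.range k, x l ≤ T} = Set.Iic M := by
    ext k
    simp only [Set.mem_ofPred_eq, Set.mem_Iic]
    rcases le_or_gt k K with h | h
    · rcases k with _ | k
      · simpa
      · rw [hM k h]; omega
    · refine ⟨fun h2 => ?_, fun h2 => by omega⟩
      exfalso
      have := Finset.sum_le_sum_of_subset_of_nonneg (Finset.range_mono h.le)
          (f := x) (fun i _ _ => hx i)
      linarith
  rw [hset, csSup_Iic]
  have : ∀ i ∈ Finset.range K,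
      (if ∑ l ∈ Finset.range (i + 1), x l ≤ T then (1:ℝ) else 0) * f (i + 2) =
      (if i < M then (1:ℝ) else 0) * f (i + 2) := by
    intro i hi
    simp only [hM i (Finset.mem_range.1 hi)]
  rw [Finset.sum_congr rfl this, sum_trunc _ hMK]
  rw [← Finset.Ico_add_one_right_eq_Icc, Finset.sum_Ico_eq_sum_range]
  refine Finset.sum_congr (by congr 1) fun i _ => by rw [add_comm]

namespace CSetup
variable {Ω : Type*} [MeasurableSpace Ω] {P : Measure Ω} [IsProbabilityMeasure P]
  {μ s2 c2 e1 : ℝ} {x : ℕ × ℕ → Ω → ℝ}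

/-- sigma-algebra generated by a set of coordinates -/
@[reducible] def sig (x : ℕ × ℕ → Ω → ℝ) (A : Set (ℕ × ℕ)) : MeasurableSpace Ω :=
  ⨆ q ∈ A, MeasurableSpace.comap (x q) inferInstance

lemma sig_meas (A : Set (ℕ × ℕ)) {q : ℕ × ℕ} (hq : q ∈ A) : Measurable[sig x A] (x q) := by
  have : MeasurableSpace.comap (x q) inferInstance ≤ sig x A :=
    le_iSup₂_of_le (f := fun q (_ : q ∈ A) => MeasurableSpace.comap (x q) inferInstance) q hq le_rfl
  exact (comap_measurable (x q)).mono this le_rfl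

lemma sig_mono {A B : Set (ℕ × ℕ)} (h : A ⊆ B) : sig x A ≤ sig x B :=
  biSup_mono h

lemma sig_indep (h : CSetup P μ s2 c2 e1 x) (p : ℕ × ℕ) (W : Ω → ℝ)
    (hW : Measurable[sig x {q | q ≠ p}] W) : IndepFun W (x p) P := by
  have := indep_iSup_of_disjoint (m := fun q => MeasurableSpace.comap (x q) inferInstance)
    (fun q => (h.meas q).comap_le) h.indep (S := {q | q ≠ p}) (T := {p}) (by simp)
  rw [IndepFun_iff_Indep]
  refine indep_of_indep_of_le_left (indep_of_indep_of_le_right this ?_) hW.comap_le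
  simp

lemma sig_le (h : CSetup P μ s2 c2 e1 x) (A : Set (ℕ × ℕ)) : sig x A ≤ ‹MeasurableSpace Ω› :=
  iSup₂_le fun q _ => (h.meas q).comap_le

lemma X_memLp (h : CSetup P μ s2 c2 e1 x) (j i : ℕ) :
    MemLp (fun ω => 1 - μ * x (j, i + 1) ω) 2 P := by
  have : MemLp (x (j, i + 1)) 2 P :=
    (memLp_two_iff_integrable_sq (h.meas _).aestronglyMeasurable).2 (h.intsq j i)
  exact (memLp_const 1).sub (this.const_mul μ)

/-- past of coordinate `(j, i+1)` -/
def past (p : ℕ × ℕ) : Set (ℕ × ℕ) := {q | q.1 = p.1 ∧ q.2 ≤ p.2}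

lemma cross (h : CSetup P μ s2 c2 e1 x) (a : ℕ × ℕ → Ω → ℝ)
    (ha : ∀ p, Measurable[sig x (past p)] (a p)) (p q : ℕ × ℕ) (hpq : p ≠ q)
    (hle : p.1 = q.1 → p.2 ≤ q.2) :
    ∫ ω, (a p ω * (1 - μ * x (p.1, p.2 + 1) ω)) * (a q ω * (1 - μ * x (q.1, q.2 + 1) ω)) ∂P
      = 0 := by
  have hW : Measurable[sig x {r | r ≠ (q.1, q.2 + 1)}]
      (fun ω => (a p ω * (1 - μ * x (p.1, p.2 + 1) ω)) * a q ω) := by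
    have m1 : Measurable[sig x {r | r ≠ (q.1, q.2 + 1)}] (a p) :=
      (ha p).mono (sig_mono (by
        rintro ⟨r1, r2⟩ ⟨h1, h2⟩ h3
        simp only [Prod.mk.injEq] at h1 h2 h3
        have := hle (by omega)
        omega)) le_rfl
    have m2 : Measurable[sig x {r | r ≠ (q.1, q.2 + 1)}] (a q) :=
      (ha q).mono (sig_mono (by
        rintro ⟨r1, r2⟩ ⟨h1, h2⟩ h3
        simp only [Prod.mk.injEq] at h1 h2 h3
        omega)) le_rfl
    have m3 : Measurable[sig x {r | r ≠ (q.1, q.2 + 1)}] (x (p.1, p.2 + 1)) :=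
      sig_meas _ (by
        intro h3
        simp only [Prod.mk.injEq] at h3
        exact hpq (Prod.ext h3.1 (by omega)))
    exact (m1.mul ((measurable_const).sub (m3.const_mul μ))).mul m2
  have hI := (h.sig_indep _ _ hW).comp (φ := id) (ψ := fun y => 1 - μ * y) measurable_id
    (by fun_prop)
  have := hI.integral_mul_eq_mul_integral
    ((hW.mono (h.sig_le _) le_rfl).aestronglyMeasurable)
    (by have := h.meas (q.1, q.2 + 1); exact (by fun_prop : Measurable _).aestronglyMeasurable)
  have h0 := h.Xmean q.1 q.2
  simp only [Function.comp_def] at this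
  rw [h0, mul_zero] at this
  rw [← this]
  refine integral_congr_ae (ae_of_all _ fun ω => ?_)
  simp [mul_assoc]

lemma indep_fun (h : CSetup P μ s2 c2 e1 x) (a : Ω → ℝ) (p : ℕ × ℕ)
    (ha : Measurable[sig x (past p)] a) (g : ℝ → ℝ) (hg : Measurable g) :
    ∫ ω, a ω * g (x (p.1, p.2 + 1) ω) ∂P = (∫ ω, a ω ∂P) * ∫ ω, g (x (p.1, p.2 + 1) ω) ∂P := by
  have m2 : Measurable[sig x {r | r ≠ (p.1, p.2 + 1)}] a :=
      ha.mono (sig_mono (by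
        rintro ⟨r1, r2⟩ ⟨h1, h2⟩ h3
        simp only [Prod.mk.injEq] at h1 h2 h3
        omega)) le_rfl
  have hI := (h.sig_indep _ _ m2).comp (φ := id) (ψ := g) measurable_id hg
  exact hI.integral_mul_eq_mul_integral
    ((m2.mono (h.sig_le _) le_rfl).aestronglyMeasurable)
    (hg.comp (h.meas _)).aestronglyMeasurable

lemma aX_memLp (h : CSetup P μ s2 c2 e1 x) (a : ℕ × ℕ → Ω → ℝ)
    (ha : ∀ p, Measurable[sig x (past p)] (a p)) (hb : ∀ p ω, |a p ω| ≤ 1) (p : ℕ × ℕ) :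
    MemLp (fun ω => a p ω * (1 - μ * x (p.1, p.2 + 1) ω)) 2 P := by
  refine (h.X_memLp p.1 p.2).mono ?_ (ae_of_all _ fun ω => ?_)
  · have := h.meas (p.1, p.2 + 1)
    have := (ha p).mono (h.sig_le _) le_rfl
    exact (by fun_prop : Measurable _).aestronglyMeasurable
  · rw [norm_mul]
    exact mul_le_of_le_one_left (norm_nonneg _) (hb p ω)

lemma L2 (h : CSetup P μ s2 c2 e1 x) (a : ℕ × ℕ → Ω → ℝ)
    (ha : ∀ p, Measurable[sig x (past p)] (a p)) (hb : ∀ p ω, |a p ω| ≤ 1)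
    (A : Finset (ℕ × ℕ)) :
    ∫ ω, (∑ p ∈ A, a p ω * (1 - μ * x (p.1, p.2 + 1) ω)) ^ 2 ∂P =
      c2 * ∑ p ∈ A, ∫ ω, a p ω ^ 2 ∂P := by
  have hint : ∀ p q, Integrable (fun ω => (a p ω * (1 - μ * x (p.1, p.2 + 1) ω)) *
      (a q ω * (1 - μ * x (q.1, q.2 + 1) ω))) P := fun p q =>
    (h.aX_memLp a ha hb p).integrable_mul (h.aX_memLp a ha hb q)
  simp_rw [sq (∑ p ∈ A, _), Finset.sum_mul_sum]
  rw [integral_finsetSum _ (fun p _ => integrable_finsetSum _ fun q _ => hint p q),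
    Finset.mul_sum]
  refine Finset.sum_congr rfl fun p hp => ?_
  rw [integral_finsetSum _ (fun q _ => hint p q), Finset.sum_eq_single_of_mem p hp]
  · have := h.indep_fun (fun ω => a p ω ^ 2) p ((ha p).pow_const 2) (fun y => (1 - μ * y) ^ 2)
      (by fun_prop)
    rw [h.Xsq] at this
    rw [mul_comm, ← this]
    exact integral_congr_ae (ae_of_all _ fun ω => by simp only; ring)
  · intro q _ hqp
    by_cases hc : p.1 = q.1 → p.2 ≤ q.2
    · exact h.cross a ha p q hqp.symm hc
    · rw [← h.cross a ha q p hqp (by omega)]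
      exact integral_congr_ae (ae_of_all _ fun ω => by simp only; ring)


/-- indicator that the `i+1`-st partial sum is at most `T` -/
noncomputable def dd (x : ℕ × ℕ → Ω → ℝ) (T : ℝ) (p : ℕ × ℕ) (ω : Ω) : ℝ :=
  if ∑ l ∈ Finset.range (p.2 + 1), x (p.1, l) ω ≤ T then 1 else 0

lemma dd_sig (T : ℝ) (p : ℕ × ℕ) : Measurable[sig x (past p)] (dd x T p) := by
  have : Measurable[sig x (past p)] (fun ω => ∑ l ∈ Finset.range (p.2 + 1), x (p.1, l) ω) := by
    refine Finset.measurable_fun_sum _ fun l hl => sig_meas _ ?_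
    simp only [Finset.mem_range] at hl
    exact ⟨rfl, by simp only; omega⟩
  exact Measurable.ite (measurableSet_le this measurable_const) measurable_const measurable_const

lemma dd_sq (T : ℝ) (p : ℕ × ℕ) (ω : Ω) : dd x T p ω ^ 2 = dd x T p ω := by
  unfold dd; split_ifs <;> norm_num

lemma dd_nonneg (T : ℝ) (p : ℕ × ℕ) (ω : Ω) : 0 ≤ dd x T p ω := by
  unfold dd; split_ifs <;> norm_num

lemma dd_le (T : ℝ) (p : ℕ × ℕ) (ω : Ω) : dd x T p ω ≤ 1 := by
  unfold dd; split_ifs <;> norm_num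

lemma dd_meas (h : CSetup P μ s2 c2 e1 x) (T : ℝ) (p : ℕ × ℕ) : Measurable (dd x T p) :=
  (dd_sig T p).mono (h.sig_le _) le_rfl

lemma dd_int (h : CSetup P μ s2 c2 e1 x) (T : ℝ) (p : ℕ × ℕ) : Integrable (dd x T p) P :=
  Integrable.of_bound (h.dd_meas T p).aestronglyMeasurable 1 (ae_of_all _ fun ω => by
    rw [Real.norm_eq_abs, abs_le]; have := dd_nonneg (x := x) T p ω
    have := dd_le (x := x) T p ω; constructor <;> linarith)

lemma dd_abs (T : ℝ) (p : ℕ × ℕ) (ω : Ω) : |dd x T p ω| ≤ 1 := by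
  unfold dd; split_ifs <;> norm_num

lemma Y_memLp (h : CSetup P μ s2 c2 e1 x) (T : ℝ) (j K : ℕ) :
    MemLp (fun ω => ∑ i ∈ Finset.range K, dd x T (j, i) ω * (1 - μ * x (j, i + 1) ω)) 2 P :=
  memLp_finsetSum _ fun i _ => h.aX_memLp (dd x T) (dd_sig T) (dd_abs T) (j, i)

lemma Y_sq (h : CSetup P μ s2 c2 e1 x) (T : ℝ) (j K : ℕ) :
    ∫ ω, (∑ i ∈ Finset.range K, dd x T (j, i) ω * (1 - μ * x (j, i + 1) ω)) ^ 2 ∂P =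
      c2 * ∫ ω, ∑ i ∈ Finset.range K, dd x T (j, i) ω ∂P := by
  have := h.L2 (dd x T) (dd_sig T) (dd_abs T) ({j} ×ˢ Finset.range K)
  simp only [Finset.sum_product, Finset.sum_singleton, dd_sq] at this
  rw [this, integral_finsetSum _ fun i _ => h.dd_int T _]

lemma Q_int (h : CSetup P μ s2 c2 e1 x) (T : ℝ) (p : ℕ × ℕ) :
    Integrable (fun ω => dd x T p ω * x (p.1, p.2 + 1) ω ^ 2) P := by
  refine (h.intsq p.1 p.2).mono ?_ (ae_of_all _ fun ω => ?_)
  · have := h.meas (p.1, p.2 + 1)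
    have := h.dd_meas T p
    exact (by fun_prop : Measurable _).aestronglyMeasurable
  · rw [norm_mul]
    exact mul_le_of_le_one_left (norm_nonneg _) (dd_abs T p ω)

lemma Q_mean (h : CSetup P μ s2 c2 e1 x) (T : ℝ) (j K : ℕ) :
    ∫ ω, ∑ i ∈ Finset.range K, dd x T (j, i) ω * x (j, i + 1) ω ^ 2 ∂P =
      s2 * ∫ ω, ∑ i ∈ Finset.range K, dd x T (j, i) ω ∂P := by
  rw [integral_finsetSum _ fun i _ => h.Q_int T (j, i), integral_finsetSum _ fun i _ => h.dd_int T _,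
    Finset.mul_sum]
  refine Finset.sum_congr rfl fun i _ => ?_
  have := h.indep_fun (dd x T (j, i)) (j, i) (dd_sig T _) (fun y => y ^ 2) (by fun_prop)
  rw [this, h.meansq, mul_comm]

lemma abs_le_eps (y ε : ℝ) (hε : 0 < ε) : |y| ≤ 1 / (2 * ε) + ε / 2 * y ^ 2 := by
  have : 0 ≤ (ε * |y| - 1) ^ 2 / (2 * ε) := by positivity
  have e : (ε * |y| - 1) ^ 2 / (2 * ε) =
    1 / (2 * ε) + ε / 2 * |y| ^ 2 - |y| := by field_simp; ring
  rw [sq_abs] at e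
  linarith

lemma EM_eps (h : CSetup P μ s2 c2 e1 x) (T : ℝ) (hT : 0 ≤ T) (j K : ℕ) (ε : ℝ) (hε : 0 < ε) :
    ∫ ω, ∑ i ∈ Finset.range K, dd x T (j, i) ω ∂P ≤ μ * T + (1 + μ) / (2 * ε) +
      ε / 2 * (c2 + μ * s2) * ∫ ω, ∑ i ∈ Finset.range K, dd x T (j, i) ω ∂P ∧
    (μ * T ≤ K → ∫ ω, |∑ i ∈ Finset.range K, dd x T (j, i) ω - μ * T| ∂P ≤
      μ * e1 + (1 + μ) / (2 * ε) +
      ε / 2 * (c2 + μ * s2) * ∫ ω, ∑ i ∈ Finset.range K, dd x T (j, i) ω ∂P) := by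
  have hμ := h.hμ
  set M : Ω → ℝ := fun ω => ∑ i ∈ Finset.range K, dd x T (j, i) ω with hM
  set Y : Ω → ℝ := fun ω => ∑ i ∈ Finset.range K, dd x T (j, i) ω * (1 - μ * x (j, i + 1) ω)
    with hY
  set Q : Ω → ℝ := fun ω => ∑ i ∈ Finset.range K, dd x T (j, i) ω * x (j, i + 1) ω ^ 2 with hQ
  have iM : Integrable M P := integrable_finsetSum _ fun i _ => h.dd_int T _
  have iY : Integrable (fun ω => Y ω ^ 2) P := (h.Y_memLp T j K).integrable_sq
  have iQ : Integrable Q P := integrable_finsetSum _ fun i _ => h.Q_int T (j, i)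
  have mY : ∫ ω, Y ω ^ 2 ∂P = c2 * ∫ ω, M ω ∂P := h.Y_sq T j K
  have mQ : ∫ ω, Q ω ∂P = s2 * ∫ ω, M ω ∂P := h.Q_mean T j K
  have det := fun ω => det_bound (fun i => x (j, i) ω) (fun i => h.nonneg _ ω) T hT K μ ε hμ hε
    (fun i => dd x T (j, i) ω) (fun i => rfl)
  set R : Ω → ℝ := fun ω => (1 + μ) / (2 * ε) + ε / 2 * Y ω ^ 2 + μ * ε / 2 * Q ω with hR
  have iR : Integrable R P :=
    ((integrable_const _).add (iY.const_mul _)).add (iQ.const_mul _)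
  have mR : ∫ ω, R ω ∂P = (1 + μ) / (2 * ε) + ε / 2 * (c2 + μ * s2) * ∫ ω, M ω ∂P := by
    have i1 : Integrable (fun ω => (1 + μ) / (2 * ε) + ε / 2 * Y ω ^ 2) P :=
      (integrable_const _).add (iY.const_mul _)
    simp only [hR]
    rw [integral_add i1 (iQ.const_mul _), integral_add (integrable_const _) (iY.const_mul _), integral_const_mul, integral_const_mul,
      mY, mQ]
    simp; ring
  have b1 : ∀ ω, M ω ≤ μ * T + R ω := by
    intro ω
    have h1 := (det ω).1
    have h2 := abs_le_eps (Y ω) ε hε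
    have e : (1 + μ) / (2 * ε) = 1 / (2 * ε) + μ * (1 / (2 * ε)) := by ring
    simp only [hR, e]
    simp only [hM, hY, hQ] at h1 h2 ⊢
    linarith
  constructor
  · have := integral_mono iM ((integrable_const (μ * T)).add iR) b1
    rw [integral_add' (integrable_const _) iR, mR] at this
    simp at this
    linarith
  · intro hK
    have b2 : ∀ ω, |M ω - μ * T| ≤ μ * x (j, 0) ω + R ω := by
      intro ω
      have h1 := (det ω).2 hK
      have h2 := abs_le_eps (Y ω) ε hε
      have h3 := b1 ω
      have h4 := mul_nonneg hμ.le (h.nonneg (j, 0) ω)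
      have h5 : 0 ≤ μ * ε / 2 * Q ω := mul_nonneg (by positivity)
        (Finset.sum_nonneg fun i _ => mul_nonneg (dd_nonneg _ _ _) (sq_nonneg _))
      have h6 : 0 ≤ μ * (1 / (2 * ε)) := by positivity
      have e : (1 + μ) / (2 * ε) = 1 / (2 * ε) + μ * (1 / (2 * ε)) := by ring
      rw [abs_le]
      simp only [hR, e] at h3 ⊢
      simp only [hM, hY, hQ] at h1 h2 h3 h5 ⊢
      constructor <;> linarith
    have := integral_mono (iM.sub (integrable_const (μ * T))).abs
      (((h.int0 j).const_mul μ).add iR) b2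
    rw [integral_add' ((h.int0 j).const_mul μ) iR, mR, integral_const_mul, h.mean0] at this
    simp only [Pi.sub_apply] at this
    linarith

lemma EM_bound (h : CSetup P μ s2 c2 e1 x) : ∃ C : ℝ, 0 ≤ C ∧ ∀ T : ℝ, 0 ≤ T → ∀ j K : ℕ,
    ∫ ω, ∑ i ∈ Finset.range K, dd x T (j, i) ω ∂P ≤ C * (1 + T) ∧
    (μ * T ≤ K → ∫ ω, |∑ i ∈ Finset.range K, dd x T (j, i) ω - μ * T| ∂P ≤ C * √(1 + T)) := by
  have hμ := h.hμ
  set c := c2 + μ * s2 with hc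
  have hc0 : 0 ≤ c := add_nonneg h.hc2 (mul_nonneg hμ.le h.hs2)
  set A := 2 * μ + (1 + μ) * (c + 1) with hA
  have hA0 : 0 ≤ A := by positivity
  have he1 := h.he1
  have hAb : ∀ T : ℝ, 0 ≤ T → ∀ j K : ℕ,
      ∫ ω, ∑ i ∈ Finset.range K, dd x T (j, i) ω ∂P ≤ A * (1 + T) := by
    intro T hT j K
    have h1 := (h.EM_eps T hT j K (1 / (c + 1)) (by positivity)).1
    have hm : 0 ≤ ∫ ω, ∑ i ∈ Finset.range K, dd x T (j, i) ω ∂P :=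
      integral_nonneg fun ω => Finset.sum_nonneg fun i _ => dd_nonneg _ _ _
    set m := ∫ ω, ∑ i ∈ Finset.range K, dd x T (j, i) ω ∂P
    have h2 : 1 / (c + 1) / 2 * c * m ≤ m / 2 := by
      have : 1 / (c + 1) * c ≤ 1 := by
        rw [div_mul_eq_mul_div, div_le_one (by positivity)]; linarith
      nlinarith
    have h3 : (1 + μ) / (2 * (1 / (c + 1))) = (1 + μ) * (c + 1) / 2 := by field_simp
    rw [h3] at h1
    have h4 : 0 ≤ (1 + μ) * (c + 1) * T := by positivity
    rw [hA]
    nlinarith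
  refine ⟨A + (μ * e1 + (1 + μ) / 2 + c * A / 2), by positivity, fun T hT j K => ⟨?_, ?_⟩⟩
  · refine (hAb T hT j K).trans ?_
    have : 0 ≤ μ * e1 + (1 + μ) / 2 + c * A / 2 := by positivity
    gcongr
    linarith
  · intro hK
    set r := √(1 + T) with hr
    have hr1 : 1 ≤ r := by rw [hr]; exact Real.one_le_sqrt.2 (by linarith)
    have hrr : r ^ 2 = 1 + T := Real.sq_sqrt (by linarith)
    have hrp : 0 < r := by linarith
    have h1 := (h.EM_eps T hT j K (1 / r) (by positivity)).2 hK
    have h2 := hAb T hT j K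
    have h3 : (1 + μ) / (2 * (1 / r)) = (1 + μ) / 2 * r := by field_simp
    have h4 : 1 / r / 2 * c * ∫ ω, ∑ i ∈ Finset.range K, dd x T (j, i) ω ∂P ≤
        1 / r / 2 * c * (A * (1 + T)) := by gcongr
    have h5 : 1 / r / 2 * c * (A * (1 + T)) = c * A / 2 * r := by
      rw [← hrr]; field_simp
    have h6 : μ * e1 ≤ μ * e1 * r := le_mul_of_one_le_right (by positivity) hr1
    rw [h3] at h1
    have h7 : 0 ≤ A * r := by positivity
    refine h1.trans ?_
    linarith

lemma prob_bound (h : CSetup P μ s2 c2 e1 x) (T : ℝ) (j K : ℕ) (hK : 0 < K) (B : ℝ)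
    (hB : ∫ ω, ∑ i ∈ Finset.range K, dd x T (j, i) ω ∂P ≤ B) :
    P.real {ω | ∑ l ∈ Finset.range K, x (j, l) ω ≤ T} ≤ B / K := by
  have iM : Integrable (fun ω => ∑ i ∈ Finset.range K, dd x T (j, i) ω) P :=
    integrable_finsetSum _ fun i _ => h.dd_int T _
  have h1 := mul_meas_ge_le_integral_of_nonneg
    (ae_of_all P fun ω => Finset.sum_nonneg fun i _ => dd_nonneg (x := x) T (j, i) ω) iM K
  rw [le_div_iff₀ (by exact_mod_cast hK), mul_comm]
  refine le_trans ?_ (h1.trans hB)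
  refine mul_le_mul_of_nonneg_left (measureReal_mono ?_) (by positivity)
  intro ω hω
  simp only [Set.mem_ofPred_eq] at hω ⊢
  have : ∀ i ∈ Finset.range K, dd x T (j, i) ω = 1 := by
    intro i hi
    refine if_pos (le_trans ?_ hω)
    exact Finset.sum_le_sum_of_subset_of_nonneg
      (Finset.range_mono (by simp at hi; simp only; omega)) (fun l _ _ => h.nonneg _ _)
  rw [Finset.sum_congr rfl this]; simp

/-- L2 distance between the stopped sums and the deterministic sums -/
lemma D_bound (h : CSetup P μ s2 c2 e1 x) (T : ℝ) (hT : 0 ≤ T) (n K : ℕ) (B : ℝ)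
    (hK : μ * T ≤ K)
    (hB : ∀ j, ∫ ω, |∑ i ∈ Finset.range K, dd x T (j, i) ω - μ * T| ∂P ≤ B) :
    MemLp (fun ω => ∑ j ∈ Finset.range n, ∑ i ∈ Finset.range K,
      dd x T (j, i) ω * (1 - μ * x (j, i + 1) ω) -
      ∑ j ∈ Finset.range n, ∑ i ∈ Finset.range ⌊μ * T⌋₊, (1 - μ * x (j, i + 1) ω)) 2 P ∧
    ∫ ω, (∑ j ∈ Finset.range n, ∑ i ∈ Finset.range K,
      dd x T (j, i) ω * (1 - μ * x (j, i + 1) ω) -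
      ∑ j ∈ Finset.range n, ∑ i ∈ Finset.range ⌊μ * T⌋₊, (1 - μ * x (j, i + 1) ω)) ^ 2 ∂P
      ≤ c2 * (n * (B + 1)) := by
  set m := ⌊μ * T⌋₊ with hm
  have hμ := h.hμ
  have hmK : m ≤ K := by
    have := Nat.floor_le (by positivity : 0 ≤ μ * T)
    exact_mod_cast this.trans hK
  set a : ℕ × ℕ → Ω → ℝ := fun p ω => dd x T p ω - (if p.2 < m then (1:ℝ) else 0) with ha
  have ham : ∀ p, Measurable[sig x (past p)] (a p) := fun p =>
    (dd_sig T p).sub measurable_const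
  have hab : ∀ p ω, |a p ω| ≤ 1 := by
    intro p ω
    simp only [ha, dd]; split_ifs <;> norm_num
  have hrw : ∀ ω, (∑ j ∈ Finset.range n, ∑ i ∈ Finset.range K,
      dd x T (j, i) ω * (1 - μ * x (j, i + 1) ω) -
      ∑ j ∈ Finset.range n, ∑ i ∈ Finset.range m, (1 - μ * x (j, i + 1) ω)) =
      ∑ p ∈ Finset.range n ×ˢ Finset.range K, a p ω * (1 - μ * x (p.1, p.2 + 1) ω) := by
    intro ω
    rw [Finset.sum_product, ← Finset.sum_sub_distrib]
    refine Finset.sum_congr rfl fun j _ => ?_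
    rw [← sum_trunc (fun i => 1 - μ * x (j, i + 1) ω) hmK, ← Finset.sum_sub_distrib]
    exact Finset.sum_congr rfl fun i _ => by simp only [ha]; ring
  simp_rw [hrw]
  refine ⟨memLp_finsetSum _ fun p _ => h.aX_memLp a ham hab p, ?_⟩
  rw [h.L2 a ham hab]
  refine mul_le_mul_of_nonneg_left ?_ h.hc2
  rw [Finset.sum_product]
  have hia : ∀ p, Integrable (fun ω => a p ω ^ 2) P := fun p =>
    Integrable.of_bound (((ham p).mono (h.sig_le _) le_rfl).pow_const 2).aestronglyMeasurable 1
      (ae_of_all _ fun ω => by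
        rw [norm_pow, Real.norm_eq_abs]; exact pow_le_one₀ (abs_nonneg _) (hab p ω))
  have : ∀ j ∈ Finset.range n, ∑ i ∈ Finset.range K, ∫ ω, a (j, i) ω ^ 2 ∂P ≤ B + 1 := by
    intro j _
    rw [← integral_finsetSum _ fun i _ => hia _]
    have iM : Integrable (fun ω => |∑ i ∈ Finset.range K, dd x T (j, i) ω - μ * T|) P :=
      ((integrable_finsetSum _ fun i _ => h.dd_int T (j, i)).sub (integrable_const (μ * T))).abs
    have hle : ∀ ω, ∑ i ∈ Finset.range K, a (j, i) ω ^ 2 ≤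
        |∑ i ∈ Finset.range K, dd x T (j, i) ω - μ * T| + 1 := by
      intro ω
      obtain ⟨M, hMK, hM⟩ := det_M (fun i => x (j, i) ω) (fun i => h.nonneg _ ω) T K
      have hd : ∀ i ∈ Finset.range K, dd x T (j, i) ω = if i < M then (1:ℝ) else 0 := by
        intro i hi
        simp only [dd, hM i (Finset.mem_range.1 hi)]
      have e1 : ∑ i ∈ Finset.range K, dd x T (j, i) ω = M := by
        rw [Finset.sum_congr rfl hd]
        simpa using sum_trunc (fun _ => 1) hMK
      have e2 : ∑ i ∈ Finset.range K, a (j, i) ω ^ 2 = |(M:ℝ) - m| := by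
        rw [← sum_dist m hMK hmK]
        exact Finset.sum_congr rfl fun i hi => by simp only [ha, hd i hi]
      rw [e1, e2]
      have f1 := Nat.floor_le (by positivity : 0 ≤ μ * T)
      have f2 := Nat.lt_floor_add_one (μ * T)
      rw [← hm] at f1 f2
      have : |μ * T - m| ≤ 1 := by rw [abs_le]; constructor <;> linarith
      linarith [abs_sub_le (M:ℝ) (μ * T) m]
    refine (integral_mono (integrable_finsetSum _ fun i _ => hia _)
      (iM.add (integrable_const 1)) hle).trans ?_
    rw [integral_add' iM (integrable_const 1)]
    simpa using hB j
  refine (Finset.sum_le_sum this).trans ?_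
  simp [mul_add]

end CSetup

lemma norm_pow_sub_pow_le' (z w : ℂ) (hz : ‖z‖ ≤ 1) (hw : ‖w‖ ≤ 1) (n : ℕ) :
    ‖z ^ n - w ^ n‖ ≤ n * ‖z - w‖ := by
  induction n with
  | zero => simp
  | succ n ih =>
    have e : z ^ (n + 1) - w ^ (n + 1) = z * (z ^ n - w ^ n) + (z - w) * w ^ n := by ring
    rw [e]
    refine (norm_add_le _ _).trans ?_
    rw [norm_mul, norm_mul, norm_pow]
    have h1 : ‖z‖ * ‖z ^ n - w ^ n‖ ≤ 1 * (n * ‖z - w‖) := by gcongr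
    have h2 : ‖z - w‖ * ‖w‖ ^ n ≤ ‖z - w‖ * 1 := by
      gcongr; exact pow_le_one₀ (norm_nonneg _) hw
    push_cast
    linarith

lemma charFun_taylor (ρ : Measure ℝ) [IsProbabilityMeasure ρ] (c : ℝ)
    (h2 : Integrable (fun y => y ^ 2) ρ) (h0 : ∫ y, y ∂ρ = 0) (hc : ∫ y, y ^ 2 ∂ρ = c) :
    (fun t : ℝ => charFun ρ t - (1 - c * t ^ 2 / 2)) =o[nhds 0] fun t : ℝ => t ^ 2 := by
  have hL : MemLp id 2 ρ := (memLp_two_iff_integrable_sq (by fun_prop)).2 h2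
  have e : ∀ t : ℝ, (1 - c * t ^ 2 / 2 : ℂ) = taylorWithinEval (charFun ρ) 2 univ 0 t := by
    intro t
    have := taylorWithinEval_charFun_two_zero (P := ρ) (X := id) aemeasurable_id
      (by simpa using hL) t
    rw [Measure.map_id] at this
    rw [this]
    simp only [id, Pi.pow_apply, h0, hc]
    simp
  simp_rw [e]
  convert! taylor_isLittleO_univ ?_
  · simp
  · exact contDiff_charFun hL

lemma tendsto_charFun_pow (φ : ℝ → ℂ) (hφ : ∀ t, ‖φ t‖ ≤ 1) (c : ℝ) (hc : 0 ≤ c)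
    (ht : (fun t : ℝ => φ t - (1 - c * t ^ 2 / 2)) =o[nhds 0] fun t : ℝ => t ^ 2)
    (r : ℕ → ℝ) (hr : Tendsto r atTop (nhds 0)) (N : ℕ → ℕ) (l : ℝ)
    (hN : Tendsto (fun n => N n * r n ^ 2) atTop (nhds l)) (u : ℝ) :
    Tendsto (fun n => φ (r n * u) ^ N n) atTop (nhds (Complex.exp (-(c * l) * u ^ 2 / 2))) := by
  have hexp : (fun t : ℝ => Complex.exp (-(c * t ^ 2 / 2)) - (1 - c * t ^ 2 / 2))
      =o[nhds 0] fun t : ℝ => t ^ 2 := by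
    have h1 := hasDerivAt_iff_isLittleO_nhds_zero.1 (Complex.hasDerivAt_exp 0)
    have h2 : Tendsto (fun t : ℝ => (-(c * t ^ 2 / 2) : ℂ)) (nhds 0) (nhds 0) := by
      have : Continuous (fun t : ℝ => (-(c * t ^ 2 / 2) : ℂ)) := by fun_prop
      simpa using this.tendsto 0
    have h3 := h1.comp_tendsto h2
    have h4 : (fun t : ℝ => (-(c * t ^ 2 / 2) : ℂ)) =O[nhds 0] fun t : ℝ => t ^ 2 := by
      refine Asymptotics.IsBigO.of_bound (c / 2) (Eventually.of_forall fun t => ?_)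
      simp [abs_of_nonneg hc]
      apply le_of_eq; ring
    refine (h3.trans_isBigO h4).congr_left fun t => ?_
    simp
    ring
  have hψ : (fun t : ℝ => φ t - Complex.exp (-(c * t ^ 2 / 2))) =o[nhds 0] fun t : ℝ => t ^ 2 := by
    refine (ht.sub hexp).congr_left fun t => by ring
  have hru : Tendsto (fun n => r n * u) atTop (nhds 0) := by simpa using hr.mul_const u
  have h5 := hψ.comp_tendsto hru
  have h6 : Tendsto (fun n => (N n : ℝ) * ‖φ (r n * u) - Complex.exp (-(c * (r n * u : ℝ) ^ 2 / 2))‖)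
      atTop (nhds 0) := by
    have h7 := (Asymptotics.isBigO_refl (fun n => (N n : ℝ)) atTop).mul_isLittleO h5.norm_left
    have h8 : (fun n => (N n : ℝ) * ((fun t : ℝ => t ^ 2) ∘ fun n => r n * u) n) =O[atTop]
        fun _ => (1:ℝ) := by
      have : Tendsto (fun n => (N n * r n ^ 2) * u ^ 2) atTop (nhds (l * u ^ 2)) :=
        hN.mul_const _
      refine (this.isBigO_one ℝ).congr_left fun n => by simp; ring
    exact (Asymptotics.isLittleO_one_iff ℝ).1 (h7.trans_isBigO h8)
  have h9 : Tendsto (fun n => Complex.exp (-(c * (r n * u : ℝ) ^ 2 / 2)) ^ N n) atTop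
      (nhds (Complex.exp (-(c * l) * u ^ 2 / 2))) := by
    have : Tendsto (fun n => (-(c * (N n * r n ^ 2)) * u ^ 2 / 2 : ℝ)) atTop
        (nhds (-(c * l) * u ^ 2 / 2)) := ((hN.const_mul c).neg.mul_const _).div_const _
    have := (Complex.continuous_exp.tendsto _).comp
      ((Complex.continuous_ofReal.tendsto _).comp this)
    push_cast at this
    refine this.congr fun n => ?_
    simp only [Function.comp]
    rw [← Complex.exp_nat_mul]
    push_cast
    congr 1
    ring
  have h10 : Tendsto (fun n => φ (r n * u) ^ N n -
      Complex.exp (-(c * (r n * u : ℝ) ^ 2 / 2)) ^ N n) atTop (nhds 0) := by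
    refine squeeze_zero_norm (fun n => ?_) h6
    refine norm_pow_sub_pow_le' _ _ (hφ _) ?_ _
    rw [Complex.norm_exp]
    norm_cast
    apply Real.exp_le_one_iff.2
    have : 0 ≤ c * (r n * u) ^ 2 / 2 := by positivity
    linarith
  simpa using h10.add h9

lemma nue_integrable (μ : ℝ) (hμ : 0 < μ) (ν : Measure ℝ) [IsProbabilityMeasure ν]
    (hsupp : ν (Set.Iio 0) = 0) (hsq : Integrable (fun x => x ^ 2) ν)
    (F : ℝ → ℝ) (hF : ∀ t, F t = (ν (Set.Iic t)).toReal)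
    (νe : Measure ℝ)
    (hνe : νe = MeasureTheory.volume.withDensity fun t =>
      ENNReal.ofReal (Set.indicator (Set.Ici 0) (fun u => μ * (1 - F u)) t)) :
    Integrable (fun x => x) νe := by
  have hFm : Measurable F := by
    have : Monotone F := fun a b hab => by
      rw [hF, hF]
      exact ENNReal.toReal_mono (measure_ne_top _ _) (measure_mono (Set.Iic_subset_Iic.2 hab))
    exact this.measurable
  have hdm : Measurable (fun t => ENNReal.ofReal
      (Set.indicator (Set.Ici 0) (fun u => μ * (1 - F u)) t)) := by
    apply Measurable.ennreal_ofReal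
    exact Measurable.indicator (by fun_prop) measurableSet_Ici
  have hnn : 0 ≤ᵐ[ν] (fun x : ℝ => x) := by
    rw [Filter.EventuallyLE, ae_iff]
    convert hsupp using 2
    ext y; simp
  have hlc := lintegral_rpow_eq_lintegral_meas_lt_mul ν hnn aemeasurable_id' (p := 2) two_pos
  have hfin : ∫⁻ ω, ENNReal.ofReal (ω ^ (2:ℝ)) ∂ν < ⊤ := by
    have := hsq.lintegral_lt_top
    simpa using this
  rw [hlc] at hfin
  refine ⟨by fun_prop, ?_⟩
  rw [HasFiniteIntegral, hνe, lintegral_withDensity_eq_lintegral_mul _ hdm (by fun_prop)]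
  have hb : ∫⁻ a, ((fun t => ENNReal.ofReal
      (Set.indicator (Set.Ici 0) (fun u => μ * (1 - F u)) t)) * fun a : ℝ => ‖a‖ₑ) a ≤
      ∫⁻ a in Set.Ioi 0, ENNReal.ofReal μ * (ν {y | a < y} * ENNReal.ofReal (a ^ ((2:ℝ) - 1))) := by
    rw [← lintegral_indicator measurableSet_Ioi]
    refine lintegral_mono fun a => ?_
    simp only [Pi.mul_apply]
    by_cases ha : 0 < a
    · rw [Set.indicator_of_mem (show a ∈ Set.Ici 0 from ha.le),
        Set.indicator_of_mem (show a ∈ Set.Ioi 0 from ha)]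
      have e : 1 - F a = (ν {y | a < y}).toReal := by
        rw [hF]
        have := prob_compl_eq_one_sub (μ := ν) (measurableSet_Iic (a := a))
        rw [Set.compl_Iic] at this
        change _ = (ν (Set.Ioi a)).toReal
        rw [this, ENNReal.toReal_sub_of_le prob_le_one (by simp)]
        simp
      rw [e, ENNReal.ofReal_mul hμ.le, ENNReal.ofReal_toReal (measure_ne_top _ _),
        show (2:ℝ) - 1 = 1 by norm_num, Real.rpow_one, Real.enorm_of_nonneg ha.le, mul_assoc]
    · rcases eq_or_lt_of_le (not_lt.1 ha) with h | h
      · simp [h]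
      · rw [Set.indicator_of_notMem (by simpa using h)]; simp
  refine hb.trans_lt ?_
  rw [lintegral_const_mul' _ _ ENNReal.ofReal_ne_top]
  refine ENNReal.mul_lt_top ENNReal.ofReal_lt_top ?_
  by_contra hcon
  rw [not_lt, top_le_iff] at hcon
  rw [hcon, ENNReal.mul_top (by simp)] at hfin
  exact lt_irrefl _ hfin

namespace CSetup
variable {Ω : Type*} [MeasurableSpace Ω] {P : Measure Ω} [IsProbabilityMeasure P]
  {μ s2 c2 e1 : ℝ} {x : ℕ × ℕ → Ω → ℝ}

lemma ae_exceed (h : CSetup P μ s2 c2 e1 x) (T : ℝ) (hT : 0 ≤ T) (j : ℕ) :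
    ∀ᵐ ω ∂P, ∃ K, T < ∑ l ∈ Finset.range K, x (j, l) ω := by
  obtain ⟨C, hC, hb⟩ := h.EM_bound
  rw [ae_iff]
  have hle : ∀ K : ℕ, P.real {ω | ¬ ∃ K, T < ∑ l ∈ Finset.range K, x (j, l) ω} ≤
      C * (1 + T) / ((K : ℝ) + 1) := by
    intro K
    have := h.prob_bound T j (K + 1) (by omega) _ (hb T hT j (K + 1)).1
    push_cast at this
    refine le_trans (measureReal_mono ?_) this
    intro ω hω
    simp only [Set.mem_ofPred_eq, not_exists, not_lt] at hω ⊢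
    exact hω _
  have hlim : Tendsto (fun K : ℕ => C * (1 + T) / ((K : ℝ) + 1)) atTop (nhds 0) :=
    tendsto_const_nhds.div_atTop (tendsto_natCast_atTop_atTop.atTop_add tendsto_const_nhds)
  have h0 := ge_of_tendsto' hlim hle
  have := le_antisymm h0 measureReal_nonneg
  rwa [measureReal_eq_zero_iff] at this

lemma G_aemeas (h : CSetup P μ s2 c2 e1 x) (T : ℝ) (hT : 0 ≤ T) (j : ℕ) :
    AEMeasurable (fun ω => ∑ k ∈ Finset.Icc 2
      (sSup {k : ℕ | ∑ l ∈ Finset.range k, x (j, l) ω ≤ T} + 1), (1 - μ * x (j, k - 1) ω)) P := by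
  refine aemeasurable_of_tendsto_metrizable_ae atTop
    (f := fun K ω => ∑ i ∈ Finset.range K, dd x T (j, i) ω * (1 - μ * x (j, i + 1) ω))
    (fun K => (h.Y_memLp T j K).1.aemeasurable) ?_
  filter_upwards [h.ae_exceed T hT j] with ω ⟨K, hK⟩
  refine tendsto_const_nhds.congr' ?_
  filter_upwards [eventually_ge_atTop K] with K' hK'
  refine det_N (fun i => x (j, i) ω) (fun i => h.nonneg _ _) T hT K' ?_
    (fun k => 1 - μ * x (j, k - 1) ω)
  refine hK.trans_le ?_
  exact Finset.sum_le_sum_of_subset_of_nonneg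
      (Finset.range_mono hK') (fun l _ _ => h.nonneg _ _)

lemma sqrt_lim (C t : ℝ) (γ : ℕ → ℝ) (hγpos : ∀ n, 0 < γ n) (hγ : Tendsto γ atTop atTop) :
    Tendsto (fun n => (C * √(1 + γ n * t) + 1) / γ n) atTop (nhds 0) := by
  have hi : Tendsto (fun n => (γ n)⁻¹) atTop (nhds 0) := tendsto_inv_atTop_zero.comp hγ
  have h1 : Tendsto (fun n => √((γ n)⁻¹ ^ 2 + t * (γ n)⁻¹)) atTop (nhds 0) := by
    have := ((hi.pow 2).add (hi.const_mul t)).sqrt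
    simpa using this
  have h2 := (h1.const_mul C).add hi
  simp only [mul_zero, add_zero] at h2
  refine h2.congr fun n => ?_
  have hp := hγpos n
  have : (γ n)⁻¹ ^ 2 + t * (γ n)⁻¹ = (1 + γ n * t) / γ n ^ 2 := by field_simp
  rw [this, Real.sqrt_div' _ (by positivity), Real.sqrt_sq hp.le]
  ring

lemma floor_lim (μ t : ℝ) (hμ : 0 < μ) (ht : 0 ≤ t) (γ : ℕ → ℝ) (hγpos : ∀ n, 0 < γ n)
    (hγ : Tendsto γ atTop atTop) :
    Tendsto (fun n => (⌊μ * (γ n * t)⌋₊ : ℝ) / γ n) atTop (nhds (μ * t)) := by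
  have h := (tendsto_nat_floor_mul_div_atTop (R := ℝ) (a := μ * t) (by positivity)).comp hγ
  refine h.congr fun n => ?_
  simp only [Function.comp]
  congr 3
  ring

lemma main (h : CSetup P μ s2 c2 e1 x) (ρ : Measure ℝ) [IsProbabilityMeasure ρ]
    (hlaw : ∀ j i, P.map (fun ω => 1 - μ * x (j, i + 1) ω) = ρ)
    (γ : ℕ → ℝ) (hγpos : ∀ n, 0 < γ n) (hγ : Tendsto γ atTop atTop) (t : ℝ) (ht : 0 ≤ t)
    (L : ℕ → Ω → ℝ)
    (hL : ∀ n ω, L n ω = (√((n : ℝ) * γ n))⁻¹ * ∑ j ∈ Finset.range n, ∑ k ∈ Finset.Icc 2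
      (sSup {k : ℕ | ∑ l ∈ Finset.range k, x (j, l) ω ≤ γ n * t} + 1), (1 - μ * x (j, k - 1) ω)) :
    TendstoInDistribution L atTop id (fun _ => P) (gaussianReal 0 (Real.toNNReal (μ * c2 * t))) := by
  have hμ := h.hμ
  have hc2 := h.hc2
  have hXm : ∀ j i, Measurable (fun ω => 1 - μ * x (j, i + 1) ω) := fun j i => by
    have := h.meas (j, i + 1); fun_prop
  set r : ℕ → ℝ := fun n => (√((n : ℝ) * γ n))⁻¹ with hr
  have hr2 : ∀ n, r n ^ 2 = ((n : ℝ) * γ n)⁻¹ := fun n => by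
    rw [hr]; simp only [inv_pow]
    rw [Real.sq_sqrt (mul_nonneg (Nat.cast_nonneg _) (hγpos n).le)]
  have hng : Tendsto (fun n : ℕ => (n : ℝ) * γ n) atTop atTop :=
    tendsto_natCast_atTop_atTop.atTop_mul_atTop₀ hγ
  have hr0 : Tendsto r atTop (nhds 0) :=
    tendsto_inv_atTop_zero.comp (Real.tendsto_sqrt_atTop.comp hng)
  set L' : ℕ → Ω → ℝ := fun n ω => r n * ∑ p ∈ Finset.range n ×ˢ
    Finset.range ⌊μ * (γ n * t)⌋₊, (1 - μ * x (p.1, p.2 + 1) ω) with hL'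
  have hL'm : ∀ n, Measurable (L' n) := fun n =>
    (Finset.measurable_fun_sum _ fun p _ => hXm p.1 p.2).const_mul _
  have hclt : TendstoInDistribution L' atTop id (fun _ => P)
      (gaussianReal 0 (Real.toNNReal (μ * c2 * t))) := by
    refine ⟨fun n => (hL'm n).aemeasurable, by fun_prop, ?_⟩
    refine ProbabilityMeasure.tendsto_iff_tendsto_charFun.2 fun u => ?_
    have hind : iIndepFun (fun (p : ℕ × ℕ) ω => 1 - μ * x (p.1, p.2 + 1) ω) P := by
      have h1 := h.indep.precomp (g := fun p : ℕ × ℕ => (p.1, p.2 + 1))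
        (fun p q hpq => by
          simp only [Prod.mk.injEq] at hpq
          exact Prod.ext hpq.1 (by omega))
      exact h1.comp (fun _ y => 1 - μ * y) (fun _ => by fun_prop)
    have hcf : ∀ n, charFun (P.map (L' n)) u =
        charFun ρ (r n * u) ^ (n * ⌊μ * (γ n * t)⌋₊) := by
      intro n
      rw [hL']
      simp only
      rw [charFun_map_mul_comp (Finset.measurable_fun_sum _ fun p _ => hXm p.1 p.2).aemeasurable,
        (hind.restrict _).charFun_map_fun_finsetSum_eq_prod (fun p _ => (hXm p.1 p.2).aemeasurable)]
      simp [hlaw]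
    have hi2 : Integrable (fun y => y ^ 2) ρ := by
      rw [← hlaw 0 0, integrable_map_measure (by fun_prop) (hXm 0 0).aemeasurable]
      exact (h.X_memLp 0 0).integrable_sq
    have hi0 : ∫ y, y ∂ρ = 0 := by
      rw [← hlaw 0 0, integral_map (hXm 0 0).aemeasurable (by fun_prop), h.Xmean]
    have hic : ∫ y, y ^ 2 ∂ρ = c2 := by
      rw [← hlaw 0 0, integral_map (hXm 0 0).aemeasurable (by fun_prop), h.Xsq]
    have hN : Tendsto (fun n : ℕ => ((n * ⌊μ * (γ n * t)⌋₊ : ℕ) : ℝ) * r n ^ 2) atTop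
        (nhds (μ * t)) := by
      refine (floor_lim μ t hμ ht γ hγpos hγ).congr' ?_
      filter_upwards [eventually_gt_atTop 0] with n hn
      rw [hr2]
      have := hγpos n
      have : (0:ℝ) < n := by exact_mod_cast hn
      push_cast
      field_simp
    have := tendsto_charFun_pow (charFun ρ) (fun t => norm_charFun_le_one t) c2 hc2
      (charFun_taylor ρ c2 hi2 hi0 hic) r hr0 _ _ hN u
    simp only [ProbabilityMeasure.coe_mk, Measure.map_id, hcf, charFun_gaussianReal]
    convert this using 3
    rw [Real.coe_toNNReal _ (by positivity)]
    push_cast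
    ring
  obtain ⟨C, hC, hb⟩ := h.EM_bound
  have hTn : ∀ n, 0 ≤ γ n * t := fun n => mul_nonneg (hγpos n).le ht
  refine tendstoInDistribution_of_tendstoInMeasure_sub L id hclt ?_ ?_
  · rw [tendstoInMeasure_iff_measureReal_norm]
    intro ε hε
    have hlim : Tendsto (fun n : ℕ => 1 / ((n : ℝ) + 1) +
        c2 * ((C * √(1 + γ n * t) + 1) / γ n) / ε ^ 2) atTop (nhds 0) := by
      have h1 := tendsto_one_div_add_atTop_nhds_zero_nat (𝕜 := ℝ)
      have h2 := ((sqrt_lim C t γ hγpos hγ).const_mul c2).div_const (ε ^ 2)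
      simpa using h1.add h2
    refine squeeze_zero (fun n => measureReal_nonneg) (fun n => ?_) hlim
    set T := γ n * t with hTdef
    have hT : 0 ≤ T := hTn n
    obtain ⟨K, hK0, hK1, hK2⟩ : ∃ K : ℕ, 0 < K ∧ μ * T ≤ K ∧
        (n : ℝ) * (C * (1 + T) / K) ≤ 1 / ((n : ℝ) + 1) := by
      obtain ⟨K, hK⟩ := exists_nat_ge (1 + μ * T + n * (n + 1) * (C * (1 + T)))
      have a1 : 0 ≤ μ * T := by positivity
      have a2 : 0 ≤ n * (n + 1) * (C * (1 + T)) := by positivity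
      have a3 : (0:ℝ) < K := by linarith
      refine ⟨K, by exact_mod_cast a3, by linarith, ?_⟩
      rw [mul_div_assoc', div_le_div_iff₀ a3 (by positivity)]
      nlinarith
    obtain ⟨hDm, hD⟩ := h.D_bound T hT n K (C * √(1 + T)) hK1 (fun j => (hb T hT j K).2 hK1)
    set D : Ω → ℝ := fun ω => ∑ j ∈ Finset.range n, ∑ i ∈ Finset.range K,
      dd x T (j, i) ω * (1 - μ * x (j, i + 1) ω) -
      ∑ j ∈ Finset.range n, ∑ i ∈ Finset.range ⌊μ * T⌋₊, (1 - μ * x (j, i + 1) ω) with hDdef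
    have hsub : {ω | ε ≤ ‖(L - L') n ω - (0 : ℕ → Ω → ℝ) n ω‖} ⊆
        (⋃ j ∈ Finset.range n, {ω | ∑ l ∈ Finset.range K, x (j, l) ω ≤ T}) ∪
        {ω | ε ^ 2 ≤ (r n) ^ 2 * D ω ^ 2} := by
      intro ω hω
      by_cases hex : ∃ j ∈ Finset.range n, ∑ l ∈ Finset.range K, x (j, l) ω ≤ T
      · left
        obtain ⟨j, hj, hjT⟩ := hex
        exact Set.mem_biUnion hj hjT
      · right
        push Not at hex
        have hLe : L n ω - L' n ω = r n * D ω := by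
          rw [hL, hL', hDdef]
          simp only
          rw [Finset.sum_product, ← mul_sub]
          congr 2
          refine Finset.sum_congr rfl fun j hj => ?_
          exact det_N (fun i => x (j, i) ω) (fun i => h.nonneg _ _) T hT K (hex j hj)
            (fun k => 1 - μ * x (j, k - 1) ω)
        have hω' : ε ≤ |r n * D ω| := by
          rw [← hLe]; simpa using hω
        change ε ^ 2 ≤ _
        rw [← mul_pow, ← sq_abs (r n * D ω)]
        gcongr
    refine (measureReal_mono hsub).trans ((measureReal_union_le _ _).trans (add_le_add ?_ ?_))
    · refine (measureReal_biUnion_finset_le _ _).trans ?_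
      refine (Finset.sum_le_sum fun j _ => h.prob_bound T j K hK0 _ (hb T hT j K).1).trans ?_
      simpa using hK2
    · have hm := mul_meas_ge_le_integral_of_nonneg (μ := P) (f := fun ω => r n ^ 2 * D ω ^ 2)
        (ae_of_all _ fun ω => by positivity) (hDm.integrable_sq.const_mul _) (ε ^ 2)
      rw [integral_const_mul] at hm
      rw [le_div_iff₀ (by positivity), mul_comm]
      refine hm.trans ((mul_le_mul_of_nonneg_left hD (sq_nonneg _)).trans ?_)
      rw [hr2]
      have hg := hγpos n
      rcases Nat.eq_zero_or_pos n with h0 | h0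
      · subst h0
        simp only [Nat.cast_zero, zero_mul, mul_zero]
        positivity
      · have : (0:ℝ) < n := by exact_mod_cast h0
        apply le_of_eq
        field_simp
  · intro n
    have : L n = fun ω => r n * ∑ j ∈ Finset.range n, ∑ k ∈ Finset.Icc 2
      (sSup {k : ℕ | ∑ l ∈ Finset.range k, x (j, l) ω ≤ γ n * t} + 1),
      (1 - μ * x (j, k - 1) ω) := funext fun ω => hL n ω
    rw [this]
    exact (Finset.aemeasurable_fun_sum _ fun j _ => h.G_aemeas _ (hTn n) j).const_mul _

end CSetup

/-- Central limit theorem for the compensated service-time sums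
`L̃ₙ(t) = (n γₙ)^{-1/2} Σ_{j<n} Σ_{k=2}^{N_j(γₙ t)+1} (1 - μ ξ_{j,k})`:
for each fixed `t ≥ 0`, `L̃ₙ(t)` converges in distribution to a centered Gaussian
random variable with variance `μ c_S² t`. Convergence in distribution is expressed
by convergence of integrals of bounded continuous test functions. -/
theorem clt_compensated_service_sums
    {Ω : Type*} [MeasurableSpace Ω] (P : Measure Ω) [IsProbabilityMeasure P]
    (μ : ℝ) (hμ : 0 < μ)
    (ν : Measure ℝ) [IsProbabilityMeasure ν] (hsupp : ν (Set.Iio 0) = 0)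
    (hmean : ∫ x, x ∂ν = 1 / μ) (hsq : Integrable (fun x => x ^ 2) ν)
    -- the squared coefficient of variation of `ν`: `c_S² = σ²/m² = μ² ∫ x² dν - 1`
    (cS2 : ℝ) (hcS2 : cS2 = μ ^ 2 * (∫ x, x ^ 2 ∂ν) - 1)
    (F : ℝ → ℝ) (hF : ∀ t, F t = (ν (Set.Iic t)).toReal)
    (νe : Measure ℝ)
    (hνe : νe = MeasureTheory.volume.withDensity fun t =>
      ENNReal.ofReal (Set.indicator (Set.Ici 0) (fun u => μ * (1 - F u)) t))
    (ξ : ℕ → ℕ → Ω → ℝ)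
    (hmeas : ∀ j k, Measurable (ξ j k))
    (hnonneg : ∀ j k ω, 0 ≤ ξ j k ω)
    (hindep : iIndepFun (m := fun _ : ℕ × ℕ => (inferInstance : MeasurableSpace ℝ))
      (fun p : ℕ × ℕ => ξ p.1 (p.2 + 1)) P)
    (hdist1 : ∀ j, Measure.map (ξ j 1) P = νe)
    (hdist : ∀ j k, 2 ≤ k → Measure.map (ξ j k) P = ν)
    (S : ℕ → ℕ → Ω → ℝ)
    (hS : ∀ j k ω, S j k ω = ∑ i ∈ Finset.range k, ξ j (i + 1) ω)
    (N : ℕ → ℝ → Ω → ℕ)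
    (hN : ∀ j t ω, N j t ω = sSup {k : ℕ | S j k ω ≤ t})
    (γ : ℕ → ℝ) (hγpos : ∀ n, 0 < γ n) (hγ : Tendsto γ atTop atTop)
    -- the diffusion-scaled compensated sums
    (L : ℕ → ℝ → Ω → ℝ)
    (hL : ∀ n t ω, L n t ω = (Real.sqrt ((n : ℝ) * γ n))⁻¹ *
      ∑ j ∈ Finset.range n, ∑ k ∈ Finset.Icc 2 (N j (γ n * t) ω + 1),
        (1 - μ * ξ j k ω)) :
    ∀ t : ℝ, 0 ≤ t → ∀ g : BoundedContinuousFunction ℝ ℝ,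
      Tendsto (fun n : ℕ => ∫ ω, g (L n t ω) ∂P) atTop
        (nhds (∫ x, g x ∂(gaussianReal 0 (Real.toNNReal (μ * cS2 * t))))) := by
  intro t ht g
  have hmapm : ∀ j k, AEMeasurable (ξ j k) P := fun j k => (hmeas j k).aemeasurable
  have hidm : Integrable (fun y : ℝ => y) ν := by
    have : MemLp (fun y : ℝ => y) 2 ν := (memLp_two_iff_integrable_sq (by fun_prop)).2 hsq
    exact this.integrable (by norm_num)
  have hX1 : ∫ y, (1 - μ * y) ∂ν = 0 := by
    rw [integral_sub (integrable_const _) (hidm.const_mul μ), integral_const_mul, hmean]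
    simp [hμ.ne']
  have hX2 : ∫ y, (1 - μ * y) ^ 2 ∂ν = cS2 := by
    have e : ∀ y : ℝ, (1 - μ * y) ^ 2 = (1 - 2 * μ * y) + μ ^ 2 * y ^ 2 := fun y => by ring
    simp_rw [e]
    have i1 : Integrable (fun y : ℝ => 1 - 2 * μ * y) ν :=
      (integrable_const _).sub (hidm.const_mul _)
    rw [integral_add i1 (hsq.const_mul _),
      integral_sub (integrable_const _) (hidm.const_mul _), integral_const_mul,
      integral_const_mul, hmean, hcS2]
    simp
    field_simp
    ring
  have hIe := nue_integrable μ hμ ν hsupp hsq F hF νe hνe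
  have hmap : ∀ (j i : ℕ) (f : ℝ → ℝ), Measurable f →
      ∫ ω, f (ξ j (i + 1 + 1) ω) ∂P = ∫ y, f y ∂ν := fun j i f hf => by
    rw [← hdist j (i + 1 + 1) (by omega), integral_map (hmapm _ _) hf.aestronglyMeasurable]
  have hset : CSetup P μ (∫ y, y ^ 2 ∂ν) cS2 (∫ ω, ξ 0 1 ω ∂P)
      (fun p : ℕ × ℕ => ξ p.1 (p.2 + 1)) := by
    refine ⟨hμ, fun p => hmeas _ _, fun p ω => hnonneg _ _ _, hindep, fun j => ?_, fun j => ?_,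
      fun j i => ?_, fun j i => ?_, fun j i => ?_, fun j i => ?_, ?_, ?_, ?_⟩
    · rw [← hdist1 j] at hIe
      exact (integrable_map_measure (by fun_prop) (hmapm _ _)).1 hIe
    · have : ∀ j, ∫ ω, ξ j 1 ω ∂P = ∫ y, y ∂νe := fun j => by
        rw [← hdist1 j, integral_map (hmapm _ _) (by fun_prop)]
      simp only [zero_add]
      rw [this, this]
    · have h1 := hsq
      rw [← hdist j (i + 1 + 1) (by omega)] at h1
      exact (integrable_map_measure (by fun_prop) (hmapm _ _)).1 h1
    · exact hmap j i (fun y => y ^ 2) (by fun_prop)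
    · rw [← hX1]; exact hmap j i (fun y => 1 - μ * y) (by fun_prop)
    · rw [← hX2]; exact hmap j i (fun y => (1 - μ * y) ^ 2) (by fun_prop)
    · exact integral_nonneg fun y => sq_nonneg y
    · rw [← hX2]; exact integral_nonneg fun y => sq_nonneg _
    · exact integral_nonneg fun ω => hnonneg _ _ _
  haveI : IsProbabilityMeasure (ν.map (fun y => 1 - μ * y)) :=
    Measure.isProbabilityMeasure_map (by fun_prop)
  have hfin := hset.main (ν.map (fun y => 1 - μ * y)) (fun j i => by
      rw [← hdist j (i + 1 + 1) (by omega), Measure.map_map (by fun_prop) (hmeas _ _)]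
      rfl) γ hγpos hγ t ht (fun n => L n t) (fun n ω => by
      rw [hL]
      congr 1
      refine Finset.sum_congr rfl fun j _ => ?_
      rw [hN]
      simp_rw [hS]
      refine Finset.sum_congr rfl fun k hk => ?_
      have : k - 1 + 1 = k := by
        have := (Finset.mem_Icc.1 hk).1
        omega
      simp only [this])
  have h1 := ProbabilityMeasure.tendsto_iff_forall_integral_tendsto.1 hfin.tendsto g
  simp only [ProbabilityMeasure.coe_mk, Measure.map_id] at h1
  refine h1.congr fun n => ?_
  exact integral_map (hfin.forall_aemeasurable n) g.continuous.aestronglyMeasurable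
end

section
/- Assume in addition that (C1) limsup_{t↓0} t^{−1}(F(t) − F(0)) < ∞ and (C2) ∫₀^∞ t³ dF(t) < ∞. Define B̃ₙ(t) = (n γₙ)^{−1/2} (Bₙ(γₙ t) − n μ γₙ t). Then for every ℓ ∈ ℕ, all times 0 ≤ t₁ < t₂ < ⋯ < t_ℓ, and all real coefficients a₁, …, a_ℓ, the random variable Σ_{i=1}^{ℓ} aᵢ B̃ₙ(tᵢ) converges in distribution, as n → ∞, to a centered Gaussian random variable with variance μ c_S² Σ_{i=1}^{ℓ} Σ_{j=1}^{ℓ} aᵢ aⱼ min(tᵢ, tⱼ) (interpreted as the point mass at 0 when this variance is 0). In other words, the finite-dimensional distributions of B̃ₙ converge to those of a driftless Brownian motion with variance parameter μ c_S² started at 0. -/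
open MeasureTheory ProbabilityTheory Set Filter
set_option linter.unusedSectionVars false
set_option linter.unusedVariables false


namespace RenewalFDD

open Asymptotics in
lemma taylor_gen (ρ : Measure ℝ) [IsProbabilityMeasure ρ] (h : MemLp id 2 ρ)
    (h0 : ∫ x, x ∂ρ = 0) :
    (fun t : ℝ => charFun ρ t - (1 - ((∫ x, x ^ 2 ∂ρ : ℝ) : ℂ) * t ^ 2 / 2)) =o[nhds 0] fun t : ℝ => t ^ 2 := by
  have key : ∀ t : ℝ, taylorWithinEval (charFun ρ) 2 univ 0 t = 1 - ((∫ x, x ^ 2 ∂ρ : ℝ) : ℂ) * t ^ 2 / 2 := by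
    intro t
    have := taylorWithinEval_charFun_two_zero (P := ρ) (X := id) aemeasurable_id
      (by simpa using h) t
    simp only [Measure.map_id] at this
    rw [this]
    simp [h0]
  simp_rw [← key]
  convert! taylor_isLittleO_univ ?_
  · simp
  exact contDiff_charFun h

lemma norm_prod_sub_prod_le {ι : Type*} (s : Finset ι) (f g : ι → ℂ)
    (hf : ∀ i, ‖f i‖ ≤ 1) (hg : ∀ i, ‖g i‖ ≤ 1) :
    ‖∏ i ∈ s, f i - ∏ i ∈ s, g i‖ ≤ ∑ i ∈ s, ‖f i - g i‖ := by
  classical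
  induction s using Finset.induction_on with
  | empty => simp
  | insert a s ha ih =>
    rw [Finset.prod_insert ha, Finset.prod_insert ha, Finset.sum_insert ha]
    have : f a * ∏ i ∈ s, f i - g a * ∏ i ∈ s, g i
      = (f a - g a) * ∏ i ∈ s, f i + g a * (∏ i ∈ s, f i - ∏ i ∈ s, g i) := by ring
    rw [this]
    refine (norm_add_le _ _).trans ?_
    rw [norm_mul, norm_mul]
    have h1 : ‖∏ i ∈ s, f i‖ ≤ 1 := by
      rw [norm_prod]; exact Finset.prod_le_one (fun _ _ => norm_nonneg _) (fun i _ => hf i)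
    have h2 := norm_nonneg (f a - g a)
    have h3 := norm_nonneg (∏ i ∈ s, f i - ∏ i ∈ s, g i)
    nlinarith [hg a, norm_nonneg (g a)]

/-- Weighted central limit theorem, on the level of characteristic functions. -/
lemma weighted_clt {Ω ι : Type*} [MeasurableSpace Ω] (P : Measure Ω) [IsProbabilityMeasure P]
    (ρ : Measure ℝ) [IsProbabilityMeasure ρ] (h : MemLp id 2 ρ) (h0 : ∫ x, x ∂ρ = 0)
    (v : ℝ) (hv : ∫ x, x ^ 2 ∂ρ = v)
    (ζ : ι → Ω → ℝ) (hm : ∀ i, Measurable (ζ i)) (hind : iIndepFun ζ P)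
    (hlaw : ∀ i, P.map (ζ i) = ρ)
    (s : ℕ → Finset ι) (c : ℕ → ι → ℝ) (b : ℕ → ℝ) (hb : Tendsto b atTop (nhds 0))
    (hcb : ∀ n i, |c n i| ≤ b n) (V : ℝ)
    (hV : Tendsto (fun n => ∑ i ∈ s n, c n i ^ 2) atTop (nhds V)) (r : ℝ) :
    Tendsto (fun n => charFun (P.map fun ω => ∑ i ∈ s n, c n i * ζ i ω) r) atTop
      (nhds (charFun (gaussianReal 0 (Real.toNNReal (v * V))) r)) := by
  have hv0 : 0 ≤ v := by rw [← hv]; exact integral_nonneg fun x => sq_nonneg x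
  have hV0 : 0 ≤ V := ge_of_tendsto' hV fun n => Finset.sum_nonneg fun i _ => sq_nonneg _
  set ψ : ℝ → ℂ := fun t => charFun (gaussianReal 0 v.toNNReal) t with hψ
  have hψe : ∀ t, ψ t = Complex.exp (-(v * t ^ 2 / 2)) := by
    intro t
    simp [hψ, charFun_gaussianReal, Real.coe_toNNReal _ hv0]
  have e1 : ∀ n, charFun (P.map fun ω => ∑ i ∈ s n, c n i * ζ i ω) r
      = ∏ i ∈ s n, charFun ρ (c n i * r) := by
    intro n
    have hi : iIndepFun (fun i ω => c n i * ζ i ω) P :=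
      hind.comp (fun i x => c n i * x) (fun i => by fun_prop)
    rw [(hi.restrict _).charFun_map_fun_finsetSum_eq_prod (fun i _ => ((hm i).const_mul _).aemeasurable),
      Finset.prod_apply]
    refine Finset.prod_congr rfl fun i _ => ?_
    rw [charFun_map_mul_comp (hm i).aemeasurable, hlaw]
  have e2 : ∀ n, ∏ i ∈ s n, ψ (c n i * r)
      = Complex.exp (((-(v * (∑ i ∈ s n, c n i ^ 2) * r ^ 2 / 2) : ℝ)) : ℂ) := by
    intro n
    simp_rw [hψe]
    rw [← Complex.exp_sum]
    congr 1
    push_cast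
    rw [Finset.mul_sum, Finset.sum_mul, Finset.sum_div, ← Finset.sum_neg_distrib]
    exact Finset.sum_congr rfl fun i _ => by ring
  have l2 : Tendsto (fun n => ∏ i ∈ s n, ψ (c n i * r)) atTop
      (nhds (charFun (gaussianReal 0 (Real.toNNReal (v * V))) r)) := by
    simp_rw [e2]
    have : charFun (gaussianReal 0 (Real.toNNReal (v * V))) r
      = Complex.exp (((-(v * V * r ^ 2 / 2) : ℝ)) : ℂ) := by
      simp [charFun_gaussianReal, Real.coe_toNNReal _ (mul_nonneg hv0 hV0)]
    rw [this]
    refine ((Complex.continuous_exp.comp Complex.continuous_ofReal).tendsto _).comp ?_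
    exact ((((hV.const_mul v).mul_const _).div_const _).neg)
  have hlo : (fun t : ℝ => charFun ρ t - ψ t) =o[nhds 0] fun t : ℝ => t ^ 2 := by
    have h1 := taylor_gen ρ h h0
    have h2 := taylor_gen (gaussianReal 0 v.toNNReal) (memLp_id_gaussianReal 2) (by simp)
    have hvar : ∫ x, x ^ 2 ∂(gaussianReal 0 v.toNNReal) = v := by
      have := variance_id_gaussianReal (μ := 0) (v := v.toNNReal)
      rw [variance_eq_integral aemeasurable_id] at this
      simpa [Real.coe_toNNReal _ hv0] using this
    rw [hv] at h1
    rw [hvar] at h2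
    refine (h1.sub h2).congr_left fun t => ?_
    simp only [hψ]; ring
  have l1 : Tendsto (fun n => ∏ i ∈ s n, charFun ρ (c n i * r) - ∏ i ∈ s n, ψ (c n i * r)) atTop
      (nhds 0) := by
    rw [Metric.tendsto_atTop]
    intro ε hε
    set K := (V + 1) * (r ^ 2 + 1) with hK
    have hKp : 0 < K := by positivity
    have hb1 := hlo.bound (show 0 < ε / (2 * K) by positivity)
    rw [Metric.eventually_nhds_iff] at hb1
    obtain ⟨δ, hδ, hball⟩ := hb1
    have hbr : Tendsto (fun n => b n * |r|) atTop (nhds 0) := by simpa using hb.mul_const |r|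
    have hb2 : ∀ᶠ n in atTop, b n * |r| < δ := hbr.eventually_lt_const hδ
    have hv2 : ∀ᶠ n in atTop, ∑ i ∈ s n, c n i ^ 2 < V + 1 := hV.eventually_lt_const (by linarith)
    obtain ⟨n0, hn0⟩ := (hb2.and hv2).exists_forall_of_atTop
    refine ⟨n0, fun n hn => ?_⟩
    obtain ⟨hn1, hn2⟩ := hn0 n hn
    rw [dist_zero_right]
    refine (norm_prod_sub_prod_le _ _ _ (fun i => norm_charFun_le_one _) (fun i => norm_charFun_le_one _)).trans_lt ?_
    calc _ ≤ ∑ i ∈ s n, ε / (2 * K) * (c n i ^ 2 * r ^ 2) := by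
          refine Finset.sum_le_sum fun i _ => ?_
          have : dist (c n i * r) 0 < δ := by
            rw [dist_zero_right, Real.norm_eq_abs, abs_mul]
            exact (mul_le_mul_of_nonneg_right (hcb n i) (abs_nonneg r)).trans_lt hn1
          have := hball this
          rw [Real.norm_of_nonneg (sq_nonneg _), mul_pow] at this
          exact this
      _ = ε / (2 * K) * ((∑ i ∈ s n, c n i ^ 2) * r ^ 2) := by
          rw [← Finset.mul_sum, ← Finset.sum_mul]
      _ ≤ ε / (2 * K) * K := by
          refine mul_le_mul_of_nonneg_left ?_ (by positivity)
          exact mul_le_mul hn2.le (by linarith) (by positivity) (by positivity)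
      _ < ε := by field_simp; linarith
  simp_rw [e1]
  simpa using l1.add l2

end RenewalFDD

namespace RenewalFDD

structure GoodLaw (μ : ℝ) (ν νe : Measure ℝ) : Prop where
  pos : 0 < μ
  supp : ν (Set.Iio 0) = 0
  mean : ∫ x, x ∂ν = 1 / μ
  sq : Integrable (fun x => x ^ 2) ν
  le : ∀ s, νe (Set.Iic s) = ENNReal.ofReal μ * ∫⁻ y, ENNReal.ofReal (min y s) ∂ν
  m2 : ∫⁻ y, ENNReal.ofReal (y ^ 2) ∂νe ≠ ⊤

lemma goodLaw_of (μ : ℝ) (hμ : 0 < μ)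
    (ν : Measure ℝ) [IsProbabilityMeasure ν] (hsupp : ν (Set.Iio 0) = 0)
    (hmean : ∫ x, x ∂ν = 1 / μ) (hsq : Integrable (fun x => x ^ 2) ν)
    (F : ℝ → ℝ) (hF : ∀ t, F t = (ν (Set.Iic t)).toReal)
    (hC2 : Integrable (fun x => x ^ 3) ν)
    (νe : Measure ℝ)
    (hνe : νe = MeasureTheory.volume.withDensity fun t =>
      ENNReal.ofReal (Set.indicator (Set.Ici 0) (fun u => μ * (1 - F u)) t)) :
    GoodLaw μ ν νe := by
  have hdens : ∀ t, ENNReal.ofReal (Set.indicator (Set.Ici 0) (fun u => μ * (1 - F u)) t)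
      = Set.indicator (Set.Ici 0) (fun u => ENNReal.ofReal μ * ν (Set.Ioi u)) t := by
    intro t
    by_cases ht : t ∈ Set.Ici (0:ℝ)
    · rw [Set.indicator_of_mem ht, Set.indicator_of_mem ht, ENNReal.ofReal_mul hμ.le, hF]
      congr 1
      have : ν (Set.Ioi t) = 1 - ν (Set.Iic t) := by
        rw [← Set.compl_Iic, prob_compl_eq_one_sub measurableSet_Iic]
      rw [this, ENNReal.ofReal_sub _ ENNReal.toReal_nonneg, ENNReal.ofReal_one,
        ENNReal.ofReal_toReal (measure_ne_top _ _)]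
    · rw [Set.indicator_of_notMem ht, Set.indicator_of_notMem ht, ENNReal.ofReal_zero]
  simp_rw [hdens] at hνe
  have hmI : Measurable fun u => ν (Set.Ioi u) :=
    Antitone.measurable fun a b hab => measure_mono (Set.Ioi_subset_Ioi hab)
  have hmd : Measurable (Set.indicator (Set.Ici 0) (fun u => ENNReal.ofReal μ * ν (Set.Ioi u))) :=
    (hmI.const_mul _).indicator measurableSet_Ici
  have hae : ∀ᵐ y ∂ν, 0 ≤ y := by
    rw [ae_iff]; simpa [Set.Iio] using hsupp
  refine ⟨hμ, hsupp, hmean, hsq, fun s => ?_, ?_⟩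
  · rw [hνe, withDensity_apply _ measurableSet_Iic]
    by_cases hs : 0 ≤ s
    · rw [lintegral_eq_lintegral_meas_lt ν (f := fun y => min y s)
        (by filter_upwards [hae] with y hy using le_min hy hs) (by fun_prop)]
      have h1 : ∀ t : ℝ, ν {a | t < min a s} = Set.indicator (Set.Iio s) (fun u => ν (Set.Ioi u)) t := by
        intro t
        by_cases hts : t < s
        · simp [hts, Set.Ioi]
        · simp [hts]
      simp_rw [h1]
      rw [← lintegral_const_mul _ (hmI.indicator measurableSet_Iio), ← lintegral_indicator measurableSet_Iic,
        ← lintegral_indicator measurableSet_Ioi]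
      refine lintegral_congr_ae ?_
      have n1 : ∀ᵐ u : ℝ, u ≠ 0 := by simp [ae_iff]
      have n2 : ∀ᵐ u : ℝ, u ≠ s := by simp [ae_iff]
      filter_upwards [n1, n2] with u h1 h2
      simp only [Set.indicator, Set.mem_Iic, Set.mem_Ici, Set.mem_Ioi, Set.mem_Iio]
      rcases lt_or_gt_of_ne h1 with h | h <;> rcases lt_or_gt_of_ne h2 with h' | h' <;>
        simp [h, h', h.le, h'.le, h.not_ge, h'.not_ge, h'.not_gt, h.not_gt]
    · have h1 : ∀ y, ENNReal.ofReal (min y s) = 0 := fun y =>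
        ENNReal.ofReal_of_nonpos ((min_le_right _ _).trans (not_le.1 hs).le)
      simp only [h1, lintegral_zero, mul_zero]
      rw [setLIntegral_eq_zero_iff measurableSet_Iic hmd]
      refine ae_of_all _ fun u hu => ?_
      rw [Set.indicator_of_notMem]
      intro h; exact hs (le_trans h hu)
  · rw [hνe, lintegral_withDensity_eq_lintegral_mul _ hmd (by fun_prop)]
    have h3 : ∫⁻ y, ENNReal.ofReal (y ^ (3:ℝ)) ∂ν ≠ ⊤ := by
      have := hC2.lintegral_lt_top.ne
      have e : ∀ y : ℝ, y ^ (3:ℝ) = y ^ 3 := fun y => by exact_mod_cast Real.rpow_natCast y 3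
      simp_rw [e]
      exact this
    rw [lintegral_rpow_eq_lintegral_meas_lt_mul ν hae aemeasurable_id (by norm_num)] at h3
    have h4 : ∫⁻ (t : ℝ) in Set.Ioi 0, ν {a | t < a} * ENNReal.ofReal (t ^ ((3:ℝ) - 1)) ≠ ⊤ := by
      intro htop
      apply h3
      rw [htop]
      exact ENNReal.mul_top (by simp)
    have h5 : ENNReal.ofReal μ * ∫⁻ (t : ℝ) in Set.Ioi 0, ν {a | t < a} * ENNReal.ofReal (t ^ ((3:ℝ) - 1)) ≠ ⊤ :=
      ENNReal.mul_ne_top ENNReal.ofReal_ne_top h4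
    convert h5 using 1
    rw [← lintegral_const_mul _ (by exact hmI.mul (by fun_prop)), ← lintegral_indicator measurableSet_Ioi]
    refine lintegral_congr_ae ?_
    have n1 : ∀ᵐ u : ℝ, u ≠ 0 := by simp [ae_iff]
    filter_upwards [n1] with u h1
    have : (3:ℝ) - 1 = (2:ℕ) := by norm_num
    rw [this]
    simp only [Set.indicator, Set.mem_Ici, Set.mem_Ioi, Pi.mul_apply, Real.rpow_natCast]
    rcases lt_or_gt_of_ne h1 with h | h
    · simp [h.not_ge, h.not_gt]
    · simp [h, h.le, Set.Ioi, mul_assoc]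

end RenewalFDD


namespace RenewalFDD

structure Chain {Ω : Type*} [MeasurableSpace Ω] (P : Measure Ω) (ν νe : Measure ℝ)
    (x : ℕ → Ω → ℝ) : Prop where
  meas : ∀ k, Measurable (x k)
  nonneg : ∀ k ω, 0 ≤ x k ω
  indep : iIndepFun x P
  law0 : P.map (x 0) = νe
  law : ∀ k, P.map (x (k + 1)) = ν

/-- partial sums -/
def SS {Ω : Type*} (x : ℕ → Ω → ℝ) (k : ℕ) (ω : Ω) : ℝ := ∑ i ∈ Finset.range k, x i ω

/-- partial sums without the first variable -/
def TT {Ω : Type*} (x : ℕ → Ω → ℝ) (k : ℕ) (ω : Ω) : ℝ := ∑ i ∈ Finset.range k, x (i + 1) ω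

/-- counting variable -/
noncomputable def NN {Ω : Type*} (x : ℕ → Ω → ℝ) (t : ℝ) (ω : Ω) : ℕ := sSup {k : ℕ | SS x k ω ≤ t}

/-- centered sum -/
def WW {Ω : Type*} (μ : ℝ) (x : ℕ → Ω → ℝ) (k : ℕ) (ω : Ω) : ℝ :=
  ∑ i ∈ Finset.range k, (1 - μ * x (i + 1) ω)

lemma SS_succ' {Ω : Type*} (x : ℕ → Ω → ℝ) (k : ℕ) (ω : Ω) :
    SS x (k + 1) ω = x 0 ω + TT x k ω := by
  simp [SS, TT, Finset.sum_range_succ', add_comm]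

lemma WW_eq {Ω : Type*} (μ : ℝ) (x : ℕ → Ω → ℝ) (k : ℕ) (ω : Ω) :
    WW μ x k ω = k - μ * TT x k ω := by
  simp [WW, TT, Finset.mul_sum]

lemma lintegral_indep {Ω : Type*} [MeasurableSpace Ω] (P : Measure Ω) [IsProbabilityMeasure P]
    {A B : Ω → ℝ} (hA : Measurable A) (hB : Measurable B) (h : IndepFun A B P)
    (f : ℝ × ℝ → ENNReal) (hf : Measurable f) :
    ∫⁻ ω, f (A ω, B ω) ∂P = ∫⁻ a, ∫⁻ b, f (a, b) ∂(P.map B) ∂(P.map A) := by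
  have : IsProbabilityMeasure (P.map B) := Measure.isProbabilityMeasure_map hB.aemeasurable
  have : IsProbabilityMeasure (P.map A) := Measure.isProbabilityMeasure_map hA.aemeasurable
  rw [← lintegral_map (μ := P) (g := fun ω => (A ω, B ω)) hf (hA.prodMk hB),
    h.map_prod_eq_prod_map_map hA.aemeasurable hB.aemeasurable, lintegral_prod _ hf.aemeasurable]

section
variable {Ω : Type*} [MeasurableSpace Ω] {P : Measure Ω} [IsProbabilityMeasure P]
  {μ : ℝ} {ν νe : Measure ℝ} {x : ℕ → Ω → ℝ}

lemma Chain.prob (h : Chain P ν νe x) : IsProbabilityMeasure ν := by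
  rw [← h.law 0]; exact Measure.isProbabilityMeasure_map (h.meas _).aemeasurable

lemma Chain.measSS (h : Chain P ν νe x) (k : ℕ) : Measurable (SS x k) := by
  have := h.meas
  unfold SS; fun_prop

lemma Chain.measTT (h : Chain P ν νe x) (k : ℕ) : Measurable (TT x k) := by
  have := h.meas
  unfold TT; fun_prop

lemma Chain.measWW (h : Chain P ν νe x) (k : ℕ) : Measurable (WW μ x k) := by
  have := h.meas
  unfold WW; fun_prop

lemma Chain.TT_nonneg (h : Chain P ν νe x) (k : ℕ) (ω : Ω) : 0 ≤ TT x k ω :=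
  Finset.sum_nonneg fun i _ => h.nonneg _ _

lemma Chain.indepTT (h : Chain P ν νe x) (k : ℕ) (m : ℕ) (hm : m = 0 ∨ k < m) :
    IndepFun (TT x k) (x m) P := by
  have e : TT x k = ∑ j ∈ (Finset.range k).image (· + 1), x j := by
    ext ω
    rw [Finset.sum_apply, Finset.sum_image (by intro a _ b _ hab; simpa using hab)]
    rfl
  rw [e]
  refine h.indep.indepFun_finsetSum_of_notMem h.meas ?_
  simp only [Finset.mem_image, Finset.mem_range, not_exists]
  omega

lemma Chain.step (h : Chain P ν νe x) (g : GoodLaw μ ν νe) (t : ℝ) (k : ℕ) :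
    P {ω | SS x (k + 1) ω ≤ t}
      = ENNReal.ofReal μ * ∫⁻ ω, ENNReal.ofReal (min (x (k + 1) ω) (t - TT x k ω)) ∂P := by
  have hν := h.prob
  have h1 : P {ω | SS x (k + 1) ω ≤ t} = ∫⁻ ω, ({p : ℝ × ℝ | p.2 + p.1 ≤ t}.indicator 1) (TT x k ω, x 0 ω) ∂P := by
    rw [← lintegral_indicator_one (measurableSet_le (h.measSS _) measurable_const)]
    refine lintegral_congr fun ω => ?_
    simp [Set.indicator, SS_succ']
  have h1m : Measurable (({p : ℝ × ℝ | p.2 + p.1 ≤ t}).indicator (1 : ℝ × ℝ → ENNReal)) :=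
    measurable_one.indicator (measurableSet_le (by fun_prop) (by fun_prop))
  rw [h1, lintegral_indep P (h.measTT k) (h.meas 0) (h.indepTT k 0 (Or.inl rfl)) _ h1m]
  rw [lintegral_indep P (h.measTT k) (h.meas (k+1)) (h.indepTT k (k+1) (Or.inr (by omega)))
    (fun p => ENNReal.ofReal (min p.2 (t - p.1))) (by fun_prop), h.law0, h.law]
  rw [← lintegral_const_mul]
  · refine lintegral_congr fun a => ?_
    dsimp only
    rw [← g.le, ← lintegral_indicator_one measurableSet_Iic]
    refine lintegral_congr fun b => ?_
    simp [Set.indicator, le_sub_iff_add_le]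
  · exact Measurable.lintegral_prod_right' (f := fun p : ℝ × ℝ => ENNReal.ofReal (min p.2 (t - p.1))) (by fun_prop)

lemma Chain.partialSum (h : Chain P ν νe x) (g : GoodLaw μ ν νe) (t : ℝ) (ht : 0 ≤ t) (K : ℕ) :
    ∑ k ∈ Finset.range K, P {ω | SS x (k + 1) ω ≤ t}
      = ENNReal.ofReal μ * ∫⁻ ω, ENNReal.ofReal (min (TT x K ω) t) ∂P := by
  have hTm := h.measTT
  have hxm := h.meas
  induction K with
  | zero => simp [TT, ht]
  | succ K ih =>
    rw [Finset.sum_range_succ, ih, h.step g, ← mul_add, ← lintegral_add_left (by fun_prop)]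
    congr 1
    refine lintegral_congr fun ω => ?_
    have h1 := h.TT_nonneg K ω
    have h2 := h.nonneg (K + 1) ω
    have h3 : TT x (K + 1) ω = TT x K ω + x (K + 1) ω := by simp [TT, Finset.sum_range_succ]
    rw [h3]
    rcases le_total t (TT x K ω) with hc | hc
    · rw [ENNReal.ofReal_of_nonpos (p := min (x (K + 1) ω) _) ((min_le_right _ _).trans (by linarith)), add_zero,
        min_eq_right hc, min_eq_right (by linarith)]
    · rw [← ENNReal.ofReal_add (le_min h1 ht) (le_min h2 (by linarith)), min_eq_left hc,
        ← min_add_add_left]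
      congr 2
      ring

lemma Chain.intx (h : Chain P ν νe x) (g : GoodLaw μ ν νe) (k : ℕ) : MemLp (x (k + 1)) 2 P := by
  rw [memLp_two_iff_integrable_sq (h.meas _).aestronglyMeasurable]
  have := g.sq
  rw [← h.law k, integrable_map_measure (by fun_prop) (h.meas _).aemeasurable] at this
  exact this

lemma Chain.meanx (h : Chain P ν νe x) (g : GoodLaw μ ν νe) (k : ℕ) : ∫ ω, x (k + 1) ω ∂P = 1 / μ := by
  rw [← g.mean, ← h.law k, integral_map (h.meas _).aemeasurable (by fun_prop)]

lemma Chain.tendsto (h : Chain P ν νe x) (g : GoodLaw μ ν νe) :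
    ∀ᵐ ω ∂P, Tendsto (fun k => TT x k ω) atTop atTop := by
  have := strong_law_ae_real (μ := P) (fun k => x (k + 1)) ((h.intx g 0).integrable (by norm_num))
    (fun i j hij => h.indep.indepFun (by simpa using hij))
    (fun i => ⟨(h.meas _).aemeasurable, (h.meas _).aemeasurable, by rw [h.law, h.law]⟩)
  filter_upwards [this] with ω hω
  rw [h.meanx g] at hω
  have h2 := hω.pos_mul_atTop (by have := g.pos; positivity) (tendsto_natCast_atTop_atTop (R := ℝ))
  refine h2.congr' ?_
  filter_upwards [eventually_gt_atTop 0] with n hn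
  have : (n:ℝ) ≠ 0 := by positivity
  simp [TT]
  field_simp

lemma Chain.tsum (h : Chain P ν νe x) (g : GoodLaw μ ν νe) (t : ℝ) (ht : 0 ≤ t) :
    ∑' k, P {ω | SS x (k + 1) ω ≤ t} = ENNReal.ofReal (μ * t) := by
  have hTm := h.measTT
  have l1 := (ENNReal.summable (f := fun k => P {ω | SS x (k + 1) ω ≤ t})).hasSum.tendsto_sum_nat
  simp_rw [h.partialSum g t ht] at l1
  refine tendsto_nhds_unique l1 ?_
  rw [ENNReal.ofReal_mul g.pos.le]
  refine ENNReal.Tendsto.const_mul ?_ (Or.inr ENNReal.ofReal_ne_top)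
  have : ENNReal.ofReal t = ∫⁻ ω, ENNReal.ofReal t ∂P := by simp
  rw [this]
  refine tendsto_lintegral_of_dominated_convergence (fun _ => ENNReal.ofReal t) (fun n => by fun_prop)
    (fun n => ae_of_all _ fun ω => ENNReal.ofReal_le_ofReal (min_le_right _ _)) (by simp) ?_
  filter_upwards [h.tendsto g] with ω hω
  refine tendsto_const_nhds.congr' ?_
  filter_upwards [hω.eventually_ge_atTop t] with n hn
  rw [min_eq_right hn]

/-- On the good event, `k < N t ↔ S (k+1) ≤ t`. -/
lemma lt_NN (hx : ∀ k ω, 0 ≤ x k ω) (ω : Ω) (hω : Tendsto (fun k => TT x k ω) atTop atTop) (t : ℝ) (ht : 0 ≤ t)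
    (k : ℕ) : k ≤ NN x t ω ↔ SS x k ω ≤ t := by
  have hmono : Monotone (fun k => SS x k ω) := by
    refine monotone_nat_of_le_succ fun n => ?_
    simp only [SS, Finset.sum_range_succ]
    linarith [hx n ω]
  have hbdd : BddAbove {k : ℕ | SS x k ω ≤ t} := by
    obtain ⟨m, hm⟩ := (hω.eventually_gt_atTop t).exists
    refine ⟨m + 1, fun k hk => ?_⟩
    by_contra! hlt
    have h1 := hmono hlt.le
    simp only [SS_succ'] at h1
    have : SS x k ω ≤ t := hk
    linarith [hx 0 ω]
  have hne : {k : ℕ | SS x k ω ≤ t}.Nonempty := ⟨0, by simpa [SS] using ht⟩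
  constructor
  · intro hk
    exact (hmono hk).trans (Nat.sSup_mem hne hbdd)
  · intro hk
    exact le_csSup hbdd hk

lemma NN_fun_meas (t : ℝ) : Measurable (fun y : ℕ → ℝ => sSup {k : ℕ | ∑ i ∈ Finset.range k, y i ≤ t}) := by
  have : (fun y : ℕ → ℝ => sSup {k : ℕ | ∑ i ∈ Finset.range k, y i ≤ t})
      = fun y => ⨆ k : ℕ, if ∑ i ∈ Finset.range k, y i ≤ t then k else 0 := by
    ext y
    set s := {k : ℕ | ∑ i ∈ Finset.range k, y i ≤ t}
    set f : ℕ → ℕ := fun k => if ∑ i ∈ Finset.range k, y i ≤ t then k else 0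
    by_cases hb : BddAbove s
    · have hb' : BddAbove (Set.range f) := by
        obtain ⟨m, hm⟩ := hb
        refine ⟨m, ?_⟩
        rintro _ ⟨k, rfl⟩
        simp only [f]
        split_ifs with hk
        · exact hm hk
        · exact Nat.zero_le _
      apply le_antisymm
      · rcases s.eq_empty_or_nonempty with he | hne
        · simp [he]
        · refine csSup_le hne fun k hk => ?_
          have : f k = k := if_pos hk
          calc k = f k := this.symm
            _ ≤ _ := le_ciSup hb' k
      · refine ciSup_le fun k => ?_
        change f k ≤ _
        simp only [f]
        split_ifs with hk
        · exact le_csSup hb hk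
        · exact Nat.zero_le _
    · have hb' : ¬ BddAbove (Set.range f) := by
        rintro ⟨m, hm⟩
        refine hb ⟨m, fun k hk => ?_⟩
        have : f k = k := if_pos hk
        rw [← this]
        exact hm ⟨k, rfl⟩
      rw [csSup_of_not_bddAbove hb, iSup, csSup_of_not_bddAbove hb']
  rw [this]
  refine Measurable.iSup fun k => ?_
  exact Measurable.ite (measurableSet_le (by fun_prop) measurable_const) measurable_const measurable_const

lemma Chain.measNN (h : Chain P ν νe x) (t : ℝ) : Measurable (NN x t) :=
  (NN_fun_meas t).comp (g := fun y : ℕ → ℝ => sSup {k : ℕ | ∑ i ∈ Finset.range k, y i ≤ t})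
    (f := fun ω i => x i ω) (measurable_pi_lambda _ fun i => h.meas i)

end
end RenewalFDD

namespace RenewalFDD
section
variable {Ω : Type*} [MeasurableSpace Ω] {P : Measure Ω} [IsProbabilityMeasure P]
  {μ : ℝ} {ν νe : Measure ℝ} {x : ℕ → Ω → ℝ}

/-- indicator of `S (k+1) ≤ t` -/
noncomputable def II (x : ℕ → Ω → ℝ) (t : ℝ) (k : ℕ) (ω : Ω) : ℝ :=
  {ω | SS x (k + 1) ω ≤ t}.indicator (fun _ => (1:ℝ)) ω

lemma II_eq (hx : ∀ k ω, 0 ≤ x k ω) (ω : Ω) (hω : Tendsto (fun k => TT x k ω) atTop atTop) (t : ℝ) (ht : 0 ≤ t)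
    (k : ℕ) : II x t k ω = if k < NN x t ω then 1 else 0 := by
  have := lt_NN hx ω hω t ht (k + 1)
  simp only [II, Set.indicator, Set.mem_ofPred_eq, ← this, Nat.succ_le_iff]

lemma Chain.lintegralNN (h : Chain P ν νe x) (g : GoodLaw μ ν νe) (t : ℝ) (ht : 0 ≤ t) :
    ∫⁻ ω, ENNReal.ofReal (NN x t ω) ∂P = ENNReal.ofReal (μ * t) := by
  rw [← h.tsum g t ht]
  have e : ∀ k, P {ω | SS x (k + 1) ω ≤ t} = ∫⁻ ω, {ω | SS x (k + 1) ω ≤ t}.indicator 1 ω ∂P := fun k =>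
    (lintegral_indicator_one (measurableSet_le (h.measSS _) measurable_const)).symm
  simp_rw [e]
  rw [← lintegral_tsum fun k => (measurable_one.indicator
    (measurableSet_le (h.measSS _) measurable_const)).aemeasurable]
  refine lintegral_congr_ae ?_
  filter_upwards [h.tendsto g] with ω hω
  have e2 : ∀ k, {ω | SS x (k + 1) ω ≤ t}.indicator (1 : Ω → ENNReal) ω
      = if k < NN x t ω then 1 else 0 := by
    intro k
    have := lt_NN h.nonneg ω hω t ht (k + 1)
    simp only [Set.indicator, Set.mem_ofPred_eq, ← this, Nat.succ_le_iff, Pi.one_apply]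
  simp_rw [e2]
  rw [tsum_eq_sum (s := Finset.range (NN x t ω))]
  · rw [Finset.sum_congr rfl (g := fun _ => (1 : ENNReal))]
    · simp
    · intro k hk; simp [Finset.mem_range.1 hk]
  · intro k hk
    simp only [Finset.mem_range] at hk
    simp [hk]

lemma Chain.measNNr (h : Chain P ν νe x) (t : ℝ) : Measurable (fun ω => (NN x t ω : ℝ)) :=
  measurable_from_top.comp (h.measNN t)

lemma Chain.intNN (h : Chain P ν νe x) (g : GoodLaw μ ν νe) (t : ℝ) (ht : 0 ≤ t) :
    Integrable (fun ω => (NN x t ω : ℝ)) P ∧ ∫ ω, (NN x t ω : ℝ) ∂P = μ * t := by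
  have h1 := h.lintegralNN g t ht
  constructor
  · refine ⟨(h.measNNr t).aestronglyMeasurable, ?_⟩
    rw [hasFiniteIntegral_iff_ofReal (ae_of_all _ fun ω => Nat.cast_nonneg _), h1]
    exact ENNReal.ofReal_lt_top
  · rw [integral_eq_lintegral_of_nonneg_ae (ae_of_all _ fun ω => Nat.cast_nonneg _)
      (h.measNNr t).aestronglyMeasurable, h1, ENNReal.toReal_ofReal (mul_nonneg g.pos.le ht)]

lemma int_of_lintegral_sq {f : Ω → ℝ} (hf : Measurable f) (hn : ∀ ω, 0 ≤ f ω) {c : ℝ} (hc : 0 ≤ c)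
    (h : ∫⁻ ω, ENNReal.ofReal (f ω) ∂P ≤ ENNReal.ofReal c) : Integrable f P ∧ ∫ ω, f ω ∂P ≤ c := by
  constructor
  · refine ⟨hf.aestronglyMeasurable, ?_⟩
    rw [hasFiniteIntegral_iff_ofReal (ae_of_all _ hn)]
    exact h.trans_lt ENNReal.ofReal_lt_top
  · rw [integral_eq_lintegral_of_nonneg_ae (ae_of_all _ hn) hf.aestronglyMeasurable]
    exact ENNReal.toReal_le_of_le_ofReal hc h

/-- the natural filtration -/
noncomputable def FF (h : Chain P ν νe x) : Filtration ℕ ‹MeasurableSpace Ω› :=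
  Filtration.natural x fun i => (h.meas i).stronglyMeasurable

lemma FF_meas (h : Chain P ν νe x) {i k : ℕ} (hik : i ≤ k) : Measurable[FF h k] (x i) :=
  ((Filtration.stronglyAdapted_natural fun i => (h.meas i).stronglyMeasurable) i).measurable.mono
    ((FF h).mono hik) le_rfl

lemma FF_indep (h : Chain P ν νe x) {f : Ω → ℝ} {k : ℕ} (hf : Measurable[FF h k] f) {φ : ℝ → ℝ}
    (hφ : Measurable φ) : IndepFun f (fun ω => φ (x (k + 1) ω)) P := by
  have h1 := (h.indep.indep_comap_natural_of_lt (fun i => (h.meas i).stronglyMeasurable) (Nat.lt_succ_self k)).symm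
  have h2 : IndepFun f (x (k + 1)) P := indep_of_indep_of_le_left h1 hf.comap_le
  exact h2.comp measurable_id hφ

/-- difference of predictable indicators -/
noncomputable def EE (x : ℕ → Ω → ℝ) (t : ℝ) (K : ℕ) (k : ℕ) (ω : Ω) : ℝ :=
  II x t k ω - if k < K then 1 else 0

noncomputable def AA (μ : ℝ) (x : ℕ → Ω → ℝ) (t : ℝ) (K M : ℕ) (ω : Ω) : ℝ :=
  ∑ i ∈ Finset.range M, EE x t K i ω * (1 - μ * x (i + 1) ω)

lemma EE_meas (h : Chain P ν νe x) (t : ℝ) (K k : ℕ) {m : ℕ} (hm : k ≤ m) : Measurable[FF h m] (EE x t K k) := by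
  have hS : Measurable[FF h m] (SS x (k + 1)) := by
    unfold SS
    refine Finset.measurable_fun_sum _ fun i hi => FF_meas h ?_
    have := Finset.mem_range.1 hi
    omega
  unfold EE
  refine Measurable.sub ?_ measurable_const
  unfold II
  exact Measurable.indicator measurable_const (measurableSet_le hS measurable_const)

lemma EE_bd (t : ℝ) (K k : ℕ) (ω : Ω) : |EE x t K k ω| ≤ 1 := by
  unfold EE II Set.indicator
  split_ifs <;> simp

lemma AA_meas (h : Chain P ν νe x) (t : ℝ) (K M : ℕ) : Measurable[FF h M] (AA μ x t K M) := by
  unfold AA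
  refine Finset.measurable_fun_sum _ fun i hi => ?_
  have := Finset.mem_range.1 hi
  have h1 := FF_meas h (show i + 1 ≤ M by omega)
  exact (EE_meas h t K i (by omega)).mul (measurable_const.sub (measurable_const.mul h1))

lemma Chain.zeta_L2 (h : Chain P ν νe x) (g : GoodLaw μ ν νe) (k : ℕ) :
    MemLp (fun ω => 1 - μ * x (k + 1) ω) 2 P :=
  (memLp_const 1).sub ((h.intx g k).const_mul μ)

lemma Chain.zeta_mean (h : Chain P ν νe x) (g : GoodLaw μ ν νe) (k : ℕ) :
    ∫ ω, (1 - μ * x (k + 1) ω) ∂P = 0 := by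
  rw [integral_sub (by simp) (((h.intx g k).integrable (by norm_num)).const_mul μ), integral_const_mul,
    h.meanx g]
  have := g.pos.ne'
  simp [this]

lemma Chain.zeta_var (h : Chain P ν νe x) (g : GoodLaw μ ν νe) (k : ℕ) :
    ∫ ω, (1 - μ * x (k + 1) ω) ^ 2 ∂P = μ ^ 2 * (∫ y, y ^ 2 ∂ν) - 1 := by
  have h1 := (h.intx g k).integrable (by norm_num)
  have h2 := (h.intx g k).integrable_sq
  have e : ∫ y, y ^ 2 ∂ν = ∫ ω, x (k + 1) ω ^ 2 ∂P := by
    rw [← h.law k, integral_map (h.meas _).aemeasurable (by fun_prop)]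
  have e2 : ∀ ω, (1 - μ * x (k + 1) ω) ^ 2 = 1 - (2 * μ) * x (k + 1) ω + μ ^ 2 * x (k + 1) ω ^ 2 := by
    intro ω; ring
  simp_rw [e2]
  have h3 : Integrable (fun ω => 1 - (2 * μ) * x (k + 1) ω) P := (integrable_const _).sub (h1.const_mul _)
  rw [integral_add h3 (h2.const_mul _),
    integral_sub (integrable_const _) (h1.const_mul _), integral_const_mul, integral_const_mul,
    h.meanx g, e]
  have := g.pos.ne'
  simp
  field_simp
  ring

lemma EE_L2 (h : Chain P ν νe x) (g : GoodLaw μ ν νe) (t : ℝ) (K k : ℕ) :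
    MemLp (fun ω => EE x t K k ω * (1 - μ * x (k + 1) ω)) 2 P := by
  refine (h.zeta_L2 g k).mono ?_ (ae_of_all _ fun ω => ?_)
  · have h1 := ((EE_meas h t K k le_rfl).mono ((FF h).le k) le_rfl)
    have := h.meas
    exact (h1.mul (by fun_prop)).aestronglyMeasurable
  · rw [norm_mul]
    exact mul_le_of_le_one_left (norm_nonneg _) (EE_bd t K k ω)

lemma AA_L2 (h : Chain P ν νe x) (g : GoodLaw μ ν νe) (t : ℝ) (K M : ℕ) : MemLp (AA μ x t K M) 2 P := by
  unfold AA
  exact memLp_finsetSum _ fun i _ => EE_L2 h g t K i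

lemma AA_sq (h : Chain P ν νe x) (g : GoodLaw μ ν νe) (t : ℝ) (K M : ℕ) :
    ∫ ω, AA μ x t K M ω ^ 2 ∂P
      = (μ ^ 2 * (∫ y, y ^ 2 ∂ν) - 1) * ∑ i ∈ Finset.range M, ∫ ω, EE x t K i ω ^ 2 ∂P := by
  induction M with
  | zero => simp [AA]
  | succ M ih =>
    rw [Finset.sum_range_succ, mul_add, ← ih]
    have e : ∀ ω, AA μ x t K (M + 1) ω ^ 2 = AA μ x t K M ω ^ 2
        + 2 * ((AA μ x t K M ω * EE x t K M ω) * (1 - μ * x (M + 1) ω))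
        + EE x t K M ω ^ 2 * (1 - μ * x (M + 1) ω) ^ 2 := by
      intro ω
      simp only [AA, Finset.sum_range_succ]
      ring
    simp_rw [e]
    have m1 := EE_meas h t K M le_rfl
    have m2 := AA_meas (μ := μ) h t K M
    have m1' := m1.mono ((FF h).le M) le_rfl
    have m2' := m2.mono ((FF h).le M) le_rfl
    have mx := h.meas
    have i1 : IndepFun (fun ω => AA μ x t K M ω * EE x t K M ω) (fun ω => 1 - μ * x (M + 1) ω) P :=
      FF_indep h (m2.mul m1) (φ := fun y => 1 - μ * y) (by fun_prop)
    have i2 : IndepFun (fun ω => EE x t K M ω ^ 2) (fun ω => (1 - μ * x (M + 1) ω) ^ 2) P :=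
      FF_indep h (m1.pow_const 2) (φ := fun y => (1 - μ * y) ^ 2) (by fun_prop)
    have e1 := i1.integral_fun_mul_eq_mul_integral (m2'.mul m1').aestronglyMeasurable
      (by fun_prop)
    have e2 := i2.integral_fun_mul_eq_mul_integral (m1'.pow_const 2).aestronglyMeasurable
      (by fun_prop)
    rw [h.zeta_mean g, mul_zero] at e1
    rw [h.zeta_var g] at e2
    have j1 : Integrable (fun ω => (AA μ x t K M ω * EE x t K M ω) * (1 - μ * x (M + 1) ω)) P := by
      have := (AA_L2 h g t K M).integrable_mul (EE_L2 h g t K M)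
      refine this.congr (ae_of_all _ fun ω => ?_)
      simp only [Pi.mul_apply]; ring
    have j2 : Integrable (fun ω => EE x t K M ω ^ 2 * (1 - μ * x (M + 1) ω) ^ 2) P := by
      refine (EE_L2 h g t K M).integrable_sq.congr (ae_of_all _ fun ω => ?_)
      ring
    have j3 : Integrable (fun ω => AA μ x t K M ω ^ 2
        + 2 * ((AA μ x t K M ω * EE x t K M ω) * (1 - μ * x (M + 1) ω))) P :=
      (AA_L2 h g t K M).integrable_sq.add (j1.const_mul 2)
    rw [integral_add j3 j2,
      integral_add (AA_L2 h g t K M).integrable_sq (j1.const_mul 2), integral_const_mul, e1, e2]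
    ring

lemma sum_ind_le (a b M : ℕ) :
    ∑ i ∈ Finset.range M, ((if i < a then (1:ℝ) else 0) - if i < b then 1 else 0) ^ 2 ≤ |(a:ℝ) - b| := by
  wlog hab : a ≤ b generalizing a b
  · have := this b a (by omega)
    rw [abs_sub_comm]
    refine le_trans (le_of_eq ?_) this
    exact Finset.sum_congr rfl fun i _ => by ring
  have e : ∀ i, ((if i < a then (1:ℝ) else 0) - if i < b then 1 else 0) ^ 2 = if i ∈ Finset.Ico a b then 1 else 0 := by
    intro i
    simp only [Finset.mem_Ico]
    by_cases h1 : i < a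
    · simp [h1, h1.trans_le hab, h1.not_ge]
    · simp only [h1, not_lt.1 h1, true_and, if_false]
      split_ifs <;> norm_num
  simp_rw [e]
  rw [Finset.sum_ite_mem]
  have hab' : (a:ℝ) ≤ b := by exact_mod_cast hab
  rw [abs_sub_comm, abs_of_nonneg (by linarith)]
  simp only [Finset.sum_const, nsmul_eq_mul, mul_one]
  have : (Finset.range M ∩ Finset.Ico a b).card ≤ b - a := by
    rw [← Nat.card_Ico]; exact Finset.card_le_card Finset.inter_subset_right
  have h2 : ((Finset.range M ∩ Finset.Ico a b).card : ℝ) ≤ ((b - a : ℕ) : ℝ) := by exact_mod_cast this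
  rwa [Nat.cast_sub hab] at h2

lemma WW_NN_meas (h : Chain P ν νe x) (t : ℝ) : Measurable (fun ω => WW μ x (NN x t ω) ω) := by
  have hW : Measurable (fun p : Ω × ℕ => WW μ x p.2 p.1) :=
    measurable_from_prod_countable_left fun k => h.measWW k
  exact hW.comp (measurable_id.prodMk (h.measNN t))

lemma WW_diff (h : Chain P ν νe x) (g : GoodLaw μ ν νe) (t : ℝ) (ht : 0 ≤ t) (K : ℕ) :
    Integrable (fun ω => (WW μ x (NN x t ω) ω - WW μ x K ω) ^ 2) P ∧
    ∫ ω, (WW μ x (NN x t ω) ω - WW μ x K ω) ^ 2 ∂P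
      ≤ (μ ^ 2 * (∫ y, y ^ 2 ∂ν) - 1) * ∫ ω, |(NN x t ω : ℝ) - K| ∂P := by
  have hv : 0 ≤ μ ^ 2 * (∫ y, y ^ 2 ∂ν) - 1 := by
    rw [← h.zeta_var g 0]; exact integral_nonneg fun ω => sq_nonneg _
  have hNi := (h.intNN g t ht).1
  refine int_of_lintegral_sq (((WW_NN_meas h t).sub (h.measWW K)).pow_const 2) (fun ω => sq_nonneg _)
    (mul_nonneg hv (integral_nonneg fun ω => abs_nonneg _)) ?_
  have hbd : ∀ M, ∫⁻ ω, ENNReal.ofReal (AA μ x t K M ω ^ 2) ∂P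
      ≤ ENNReal.ofReal ((μ ^ 2 * (∫ y, y ^ 2 ∂ν) - 1) * ∫ ω, |(NN x t ω : ℝ) - K| ∂P) := by
    intro M
    rw [← ofReal_integral_eq_lintegral_ofReal (AA_L2 h g t K M).integrable_sq (ae_of_all _ fun ω => sq_nonneg _),
      AA_sq h g]
    refine ENNReal.ofReal_le_ofReal (mul_le_mul_of_nonneg_left ?_ hv)
    have hEi : ∀ i ∈ Finset.range M, Integrable (fun ω => EE x t K i ω ^ 2) P := by
      intro i _
      refine Integrable.of_bound (C := 1) (((EE_meas h t K i le_rfl).mono ((FF h).le i) le_rfl).pow_const 2).aestronglyMeasurable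
        (ae_of_all _ fun ω => ?_)
      rw [norm_pow]
      exact pow_le_one₀ (norm_nonneg _) (EE_bd t K i ω)
    rw [← integral_finsetSum _ hEi]
    refine integral_mono_ae (integrable_finsetSum _ hEi) (hNi.sub (integrable_const _)).abs ?_
    filter_upwards [h.tendsto g] with ω hω
    simp only [EE, II_eq h.nonneg ω hω t ht]
    exact sum_ind_le _ _ _
  calc ∫⁻ ω, ENNReal.ofReal ((WW μ x (NN x t ω) ω - WW μ x K ω) ^ 2) ∂P
      ≤ ∫⁻ ω, liminf (fun M => ENNReal.ofReal (AA μ x t K M ω ^ 2)) atTop ∂P := by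
        refine lintegral_mono_ae ?_
        filter_upwards [h.tendsto g] with ω hω
        have : Tendsto (fun M => ENNReal.ofReal (AA μ x t K M ω ^ 2)) atTop
            (nhds (ENNReal.ofReal ((WW μ x (NN x t ω) ω - WW μ x K ω) ^ 2))) := by
          refine tendsto_const_nhds.congr' ?_
          filter_upwards [eventually_ge_atTop (max (NN x t ω) K)] with M hM
          congr 2
          have key : ∀ a, a ≤ M → WW μ x a ω = ∑ i ∈ Finset.range M, (if i < a then (1:ℝ) else 0) * (1 - μ * x (i + 1) ω) := by
            intro a ha
            simp_rw [ite_mul, one_mul, zero_mul]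
            rw [← Finset.sum_filter]
            unfold WW
            congr 1
            ext i
            simp only [Finset.mem_range, Finset.mem_filter]
            omega
          rw [key _ (le_of_max_le_left hM), key _ (le_of_max_le_right hM), ← Finset.sum_sub_distrib]
          unfold AA
          refine Finset.sum_congr rfl fun i _ => ?_
          simp only [EE, II_eq h.nonneg ω hω t ht]
          ring
        exact this.liminf_eq.ge
    _ ≤ liminf (fun M => ∫⁻ ω, ENNReal.ofReal (AA μ x t K M ω ^ 2) ∂P) atTop :=
        lintegral_liminf_le fun M => (((AA_meas h t K M).mono ((FF h).le M) le_rfl).pow_const 2).ennreal_ofReal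
    _ ≤ _ := by
        refine (liminf_le_liminf (Eventually.of_forall hbd)).trans ?_
        simp

end
end RenewalFDD

namespace RenewalFDD
section
variable {Ω : Type*} [MeasurableSpace Ω] {P : Measure Ω} [IsProbabilityMeasure P]
  {μ : ℝ} {ν νe : Measure ℝ} {x : ℕ → Ω → ℝ}

lemma tail_small (g : GoodLaw μ ν νe) {ε : ENNReal} (hε : 0 < ε) :
    ∃ L : ℕ, ∫⁻ y, (Set.Ioi (L:ℝ)).indicator (fun y => ENNReal.ofReal (y ^ 2)) y ∂ν ≤ ε := by
  have : Tendsto (fun L : ℕ => ∫⁻ y, (Set.Ioi (L:ℝ)).indicator (fun y => ENNReal.ofReal (y ^ 2)) y ∂ν) atTop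
      (nhds (∫⁻ y, 0 ∂ν)) := by
    refine tendsto_lintegral_of_dominated_convergence (fun y => ENNReal.ofReal (y ^ 2))
      (fun n => Measurable.indicator (by fun_prop) measurableSet_Ioi)
      (fun n => ae_of_all _ fun y => Set.indicator_le_self _ _ _) g.sq.lintegral_lt_top.ne
      (ae_of_all _ fun y => ?_)
    refine tendsto_const_nhds.congr' ?_
    filter_upwards [eventually_ge_atTop ⌈y⌉₊] with n hn
    rw [Set.indicator_of_notMem]
    simp only [Set.mem_Ioi, not_lt]
    exact (Nat.le_ceil y).trans (by exact_mod_cast hn)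
  rw [lintegral_zero] at this
  exact (this.eventually_le_const hε).exists

lemma xN_meas (h : Chain P ν νe x) (t : ℝ) : Measurable (fun ω => x (NN x t ω) ω) := by
  have hW : Measurable (fun p : Ω × ℕ => x p.2 p.1) :=
    measurable_from_prod_countable_left fun k => h.meas k
  exact hW.comp (measurable_id.prodMk (h.measNN t))

lemma overshoot (g : GoodLaw μ ν νe) {ε : ℝ} (hε : 0 < ε) :
    ∃ C : ℝ, 0 ≤ C ∧ ∀ x : ℕ → Ω → ℝ, Chain P ν νe x → ∀ t, 0 ≤ t →
      Integrable (fun ω => x (NN x t ω) ω ^ 2 + x 0 ω ^ 2) P ∧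
      ∫ ω, (x (NN x t ω) ω ^ 2 + x 0 ω ^ 2) ∂P ≤ ε * t + C := by
  obtain ⟨L, hL⟩ := tail_small g (ε := ENNReal.ofReal (ε / μ)) (by have := g.pos; simp; positivity)
  set m := (∫⁻ y, ENNReal.ofReal (y ^ 2) ∂νe).toReal with hm
  have hm0 : 0 ≤ m := ENNReal.toReal_nonneg
  refine ⟨2 * m + (L:ℝ) ^ 2, by positivity, fun x h t ht => ?_⟩
  have hx := h.meas
  refine int_of_lintegral_sq (((xN_meas h t).pow_const 2).add ((h.meas 0).pow_const 2)) (fun ω => add_nonneg (sq_nonneg _) (sq_nonneg _))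
    (by positivity) ?_
  have hx0 : ∫⁻ ω, ENNReal.ofReal (x 0 ω ^ 2) ∂P = ENNReal.ofReal m := by
    rw [hm, ENNReal.ofReal_toReal g.m2, ← h.law0, lintegral_map (by fun_prop) (h.meas 0)]
  set φ : ℝ → ENNReal := (Set.Ioi (L:ℝ)).indicator (fun y => ENNReal.ofReal (y ^ 2)) with hφ
  have hφm : Measurable φ := Measurable.indicator (by fun_prop) measurableSet_Ioi
  set J : ℕ → Ω → ENNReal := fun k => {ω | SS x (k + 1) ω ≤ t}.indicator 1 with hJ
  have hJm : ∀ k, Measurable (J k) := fun k => measurable_one.indicator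
    (measurableSet_le (h.measSS _) measurable_const)
  have hφx : ∀ k, Measurable (fun ω => φ (x (k + 1) ω)) := fun k => hφm.comp (h.meas _)
  have hprod : ∀ k, Measurable (fun ω => J k ω * φ (x (k + 1) ω)) := fun k => (hJm k).mul (hφx k)
  have hJφ : ∀ k, ∫⁻ ω, J k ω * φ (x (k + 1) ω) ∂P
      = P {ω | SS x (k + 1) ω ≤ t} * ∫⁻ y, φ y ∂ν := by
    intro k
    have hi0 : IndepFun (SS x (k + 1)) (x (k + 1)) P := by
      have : Measurable[FF h k] (SS x (k + 1)) := by
        unfold SS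
        refine Finset.measurable_fun_sum _ fun i hi => FF_meas h ?_
        have := Finset.mem_range.1 hi
        omega
      exact FF_indep h this measurable_id
    have hi : IndepFun (J k) (fun ω => φ (x (k + 1) ω)) P := by
      have := hi0.comp (φ := (Set.Iic t).indicator (1 : ℝ → ENNReal)) (ψ := φ)
        (measurable_one.indicator measurableSet_Iic) hφm
      exact this
    rw [lintegral_mul_eq_lintegral_mul_lintegral_of_indepFun'' (hJm k).aemeasurable
      (hφx k).aemeasurable hi, lintegral_indicator_one
      (measurableSet_le (h.measSS _) measurable_const), ← h.law k, lintegral_map hφm (h.meas _)]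
  have hpt : ∀ᵐ ω ∂P, ENNReal.ofReal (x (NN x t ω) ω ^ 2 + x 0 ω ^ 2)
      ≤ ENNReal.ofReal (x 0 ω ^ 2) + ENNReal.ofReal (x 0 ω ^ 2) + ENNReal.ofReal ((L:ℝ) ^ 2)
        + ∑' k, J k ω * φ (x (k + 1) ω) := by
    filter_upwards [h.tendsto g] with ω hω
    rw [ENNReal.ofReal_add (sq_nonneg _) (sq_nonneg _)]
    rcases hN : NN x t ω with _ | k
    · rw [add_assoc (_ + _)]; exact le_self_add
    · have h1 : SS x (k + 1) ω ≤ t := (lt_NN h.nonneg ω hω t ht (k + 1)).1 (by rw [hN])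
      by_cases hc : x (k + 1) ω ≤ L
      · have : ENNReal.ofReal (x (k + 1) ω ^ 2) ≤ ENNReal.ofReal ((L:ℝ) ^ 2) :=
          ENNReal.ofReal_le_ofReal (pow_le_pow_left₀ (h.nonneg _ _) hc 2)
        calc _ ≤ ENNReal.ofReal ((L:ℝ) ^ 2) + ENNReal.ofReal (x 0 ω ^ 2) := by gcongr
          _ ≤ ENNReal.ofReal ((L:ℝ) ^ 2) + ENNReal.ofReal (x 0 ω ^ 2)
              + (ENNReal.ofReal (x 0 ω ^ 2) + ∑' k, J k ω * φ (x (k + 1) ω)) := le_self_add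
          _ = _ := by ring
      · have h2 : ENNReal.ofReal (x (k + 1) ω ^ 2) = J k ω * φ (x (k + 1) ω) := by
          have e1 : J k ω = 1 := by simp [hJ, h1]
          have e2 : φ (x (k + 1) ω) = ENNReal.ofReal (x (k + 1) ω ^ 2) := by
            rw [hφ, Set.indicator_of_mem]; exact not_le.1 hc
          rw [e1, e2, one_mul]
        have h3 := ENNReal.le_tsum (f := fun k => J k ω * φ (x (k + 1) ω)) k
        calc _ ≤ ∑' k, J k ω * φ (x (k + 1) ω) + ENNReal.ofReal (x 0 ω ^ 2) := by
              rw [h2]; gcongr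
          _ ≤ ∑' k, J k ω * φ (x (k + 1) ω) + ENNReal.ofReal (x 0 ω ^ 2)
              + (ENNReal.ofReal (x 0 ω ^ 2) + ENNReal.ofReal ((L:ℝ) ^ 2)) := le_self_add
          _ = _ := by ring
  have mt : Measurable fun ω => ∑' k, J k ω * φ (x (k + 1) ω) :=
    Measurable.tsum fun k => hprod k
  refine (lintegral_mono_ae hpt).trans ?_
  rw [lintegral_add_left (by fun_prop), lintegral_add_left (by fun_prop), lintegral_add_left (by fun_prop),
    hx0, lintegral_tsum fun k => (hprod k).aemeasurable]
  simp_rw [hJφ]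
  rw [ENNReal.tsum_mul_right, h.tsum g t ht]
  have hμ := g.pos
  calc _ ≤ ENNReal.ofReal m + ENNReal.ofReal m + ENNReal.ofReal ((L:ℝ) ^ 2)
        + ENNReal.ofReal (μ * t) * ENNReal.ofReal (ε / μ) := by
          simp only [lintegral_const, measure_univ, mul_one]
          gcongr
    _ = ENNReal.ofReal (m + m + (L:ℝ) ^ 2 + μ * t * (ε / μ)) := by
          rw [← ENNReal.ofReal_mul (by positivity), ← ENNReal.ofReal_add hm0 hm0,
            ← ENNReal.ofReal_add (by positivity) (by positivity),
            ← ENNReal.ofReal_add (by positivity) (by positivity)]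
    _ = _ := by
          congr 1
          field_simp
          ring

/-- error variable -/
noncomputable def DD (μ : ℝ) (x : ℕ → Ω → ℝ) (t : ℝ) (K : ℕ) (ω : Ω) : ℝ :=
  (NN x t ω : ℝ) - μ * t - WW μ x K ω

lemma DD_meas (h : Chain P ν νe x) (t : ℝ) (K : ℕ) : Measurable (DD μ x t K) :=
  ((h.measNNr t).sub measurable_const).sub (h.measWW K)

lemma DD_sq_le (h : Chain P ν νe x) (g : GoodLaw μ ν νe) (t : ℝ) (ht : 0 ≤ t) (K : ℕ) :
    ∀ᵐ ω ∂P, DD μ x t K ω ^ 2 ≤ 2 * (WW μ x (NN x t ω) ω - WW μ x K ω) ^ 2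
      + 2 * μ ^ 2 * (x (NN x t ω) ω ^ 2 + x 0 ω ^ 2) := by
  filter_upwards [h.tendsto g] with ω hω
  set n := NN x t ω with hn
  have h1 : SS x n ω ≤ t := (lt_NN h.nonneg ω hω t ht n).1 le_rfl
  have h2 : ¬ SS x (n + 1) ω ≤ t := fun hc => by
    have := (lt_NN h.nonneg ω hω t ht (n + 1)).2 hc
    omega
  have h3 : SS x (n + 1) ω = SS x n ω + x n ω := by simp [SS, Finset.sum_range_succ]
  have h4 := SS_succ' x n ω
  have h5 := WW_eq μ x n ω
  set R := SS x (n + 1) ω - t with hR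
  have hR0 : 0 ≤ R := by linarith
  have hR1 : R ≤ x n ω := by linarith
  have hx0 := h.nonneg 0 ω
  have e : DD μ x t K ω = (WW μ x n ω - WW μ x K ω) + μ * (R - x 0 ω) := by
    have : TT x n ω = R + t - x 0 ω := by linarith
    simp only [DD, ← hn]
    rw [h5, this]
    ring
  have h6 : (R - x 0 ω) ^ 2 ≤ x n ω ^ 2 + x 0 ω ^ 2 := by nlinarith
  have h7 : μ ^ 2 * (R - x 0 ω) ^ 2 ≤ μ ^ 2 * (x n ω ^ 2 + x 0 ω ^ 2) :=
    mul_le_mul_of_nonneg_left h6 (sq_nonneg _)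
  rw [e]
  nlinarith [sq_nonneg ((WW μ x n ω - WW μ x K ω) - μ * (R - x 0 ω))]

lemma DD_bound1 (h : Chain P ν νe x) (g : GoodLaw μ ν νe) (t : ℝ) (ht : 0 ≤ t) (K : ℕ) {q : ℝ}
    (hq : Integrable (fun ω => x (NN x t ω) ω ^ 2 + x 0 ω ^ 2) P ∧
      ∫ ω, (x (NN x t ω) ω ^ 2 + x 0 ω ^ 2) ∂P ≤ q) :
    Integrable (fun ω => DD μ x t K ω ^ 2) P ∧ ∫ ω, DD μ x t K ω ^ 2 ∂P ≤
      2 * ((μ ^ 2 * (∫ y, y ^ 2 ∂ν) - 1) * ∫ ω, |(NN x t ω : ℝ) - K| ∂P) + 2 * μ ^ 2 * q := by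
  obtain ⟨w1, w2⟩ := WW_diff h g t ht K
  have hi : Integrable (fun ω => 2 * (WW μ x (NN x t ω) ω - WW μ x K ω) ^ 2
      + 2 * μ ^ 2 * (x (NN x t ω) ω ^ 2 + x 0 ω ^ 2)) P := (w1.const_mul 2).add (hq.1.const_mul _)
  have hD : Integrable (fun ω => DD μ x t K ω ^ 2) P := by
    refine hi.mono' ((DD_meas h t K).pow_const 2).aestronglyMeasurable ?_
    filter_upwards [DD_sq_le h g t ht K] with ω hω
    rwa [Real.norm_of_nonneg (sq_nonneg _)]
  refine ⟨hD, (integral_mono_ae hD hi (DD_sq_le h g t ht K)).trans ?_⟩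
  rw [integral_add (w1.const_mul 2) (hq.1.const_mul _), integral_const_mul, integral_const_mul]
  have := mul_le_mul_of_nonneg_left hq.2 (show 0 ≤ 2 * μ ^ 2 by positivity)
  linarith

lemma DD_bound (g : GoodLaw μ ν νe) (hv : 0 ≤ μ ^ 2 * (∫ y, y ^ 2 ∂ν) - 1) {ε : ℝ} (hε : 0 < ε) :
    ∃ C : ℝ, 0 ≤ C ∧ ∀ x : ℕ → Ω → ℝ, Chain P ν νe x → ∀ t, 0 ≤ t →
      MemLp (DD μ x t ⌊μ * t⌋₊) 2 P ∧ ∫ ω, DD μ x t ⌊μ * t⌋₊ ω ∂P = 0 ∧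
      ∫ ω, DD μ x t ⌊μ * t⌋₊ ω ^ 2 ∂P ≤ ε * t + C := by
  have hμ := g.pos
  set v := μ ^ 2 * (∫ y, y ^ 2 ∂ν) - 1 with hvd
  obtain ⟨C1, hC1, H1⟩ := overshoot (P := P) g one_pos
  obtain ⟨C2, hC2, H2⟩ := overshoot (P := P) g (show 0 < ε / (4 * μ ^ 2) by positivity)
  set A := 2 * v * μ + 2 * μ ^ 2 with hA
  set B := 2 * μ ^ 2 * C1 with hB
  have hA0 : 0 ≤ A := by positivity
  have hB0 : 0 ≤ B := by positivity
  set η := ε / (4 * (v * A + 1)) with hη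
  have hη0 : 0 < η := by positivity
  refine ⟨2 * v * (η * B + 1 / η + 1) + 2 * μ ^ 2 * C2, by positivity, fun x h t ht => ?_⟩
  set K := ⌊μ * t⌋₊ with hK
  have hN := h.intNN g t ht
  have b1 := DD_bound1 h g t ht 0 (H1 x h t ht)
  have b2 := DD_bound1 h g t ht K (H2 x h t ht)
  have e0 : ∀ ω, DD μ x t 0 ω = NN x t ω - μ * t := fun ω => by simp [DD, WW]
  simp_rw [e0] at b1
  have eabs : ∫ ω, |(NN x t ω : ℝ) - (0:ℕ)| ∂P = μ * t := by
    rw [← hN.2]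
    refine integral_congr_ae (ae_of_all _ fun ω => ?_)
    simp
  rw [eabs, ← hvd] at b1
  have hKi : Integrable (fun ω => |(NN x t ω : ℝ) - K|) P := (hN.1.sub (integrable_const _)).abs
  have hb : ∫ ω, |(NN x t ω : ℝ) - K| ∂P ≤ η * (A * t + B) + 1 / η + 1 := by
    have hpt : ∀ ω, |(NN x t ω : ℝ) - K| ≤ η * ((NN x t ω : ℝ) - μ * t) ^ 2 + (1 / η + 1) := by
      intro ω
      set y := (NN x t ω : ℝ) - μ * t with hy
      have k1 : (K:ℝ) ≤ μ * t := Nat.floor_le (by positivity)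
      have k2 : μ * t < K + 1 := Nat.lt_floor_add_one _
      have e1 : |(NN x t ω : ℝ) - K| ≤ |y| + 1 := by
        have : (NN x t ω : ℝ) - K = y + (μ * t - K) := by rw [hy]; ring
        rw [this]
        refine (abs_add_le _ _).trans ?_
        rw [abs_of_nonneg (show 0 ≤ μ * t - K by linarith)]
        linarith
      have e2 : |y| ≤ η * y ^ 2 + 1 / η := by
        rw [← sq_abs y]
        have : 0 ≤ (η * |y| - 1) ^ 2 / η + |y| := by positivity
        have e3 : (η * |y| - 1) ^ 2 / η + |y| = η * |y| ^ 2 + 1 / η - |y| := by field_simp; ring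
        linarith
      linarith
    have hi : Integrable (fun ω => η * ((NN x t ω : ℝ) - μ * t) ^ 2 + (1 / η + 1)) P :=
      (b1.1.const_mul η).add (integrable_const _)
    refine (integral_mono hKi hi hpt).trans ?_
    rw [integral_add (b1.1.const_mul η) (integrable_const _), integral_const_mul]
    simp only [integral_const, probReal_univ, one_smul]
    have : η * ∫ ω, ((NN x t ω : ℝ) - μ * t) ^ 2 ∂P ≤ η * (A * t + B) := by
      refine mul_le_mul_of_nonneg_left (b1.2.trans (le_of_eq ?_)) hη0.le
      rw [hA, hB]; ring
    linarith
  refine ⟨(memLp_two_iff_integrable_sq (DD_meas h t K).aestronglyMeasurable).2 b2.1, ?_, ?_⟩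
  · have hz : ∀ i ∈ Finset.range K, Integrable (fun ω => 1 - μ * x (i + 1) ω) P :=
      fun i _ => (h.zeta_L2 g i).integrable (by norm_num)
    have hWi : Integrable (fun ω => WW μ x K ω) P := integrable_finsetSum _ hz
    have hW0 : ∫ ω, WW μ x K ω ∂P = 0 := by
      unfold WW
      rw [integral_finsetSum _ hz]
      exact Finset.sum_eq_zero fun i _ => h.zeta_mean g i
    unfold DD
    have hs : Integrable (fun ω => (NN x t ω : ℝ) - μ * t) P := hN.1.sub (integrable_const _)
    rw [integral_sub hs hWi, hW0, integral_sub hN.1 (integrable_const _), hN.2]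
    simp
  · refine b2.2.trans ?_
    rw [← hvd]
    have k1 := mul_le_mul_of_nonneg_left hb hv
    have k2 : 2 * μ ^ 2 * (ε / (4 * μ ^ 2) * t + C2) = ε / 2 * t + 2 * μ ^ 2 * C2 := by
      field_simp; ring
    have k3 : 2 * (v * (η * (A * t))) ≤ ε / 2 * t := by
      have : 2 * (v * (η * A)) ≤ ε / 2 := by
        rw [hη]
        have : 2 * (v * (ε / (4 * (v * A + 1)) * A)) = ε / 2 * (v * A / (v * A + 1)) := by
          field_simp; ring
        rw [this]
        have h1 : v * A / (v * A + 1) ≤ 1 := by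
          rw [div_le_one (by positivity)]; linarith
        nlinarith
      have := mul_le_mul_of_nonneg_right this ht
      linarith
    rw [k2]
    nlinarith

end
end RenewalFDD

namespace RenewalFDD
section
variable {Ω : Type*} [MeasurableSpace Ω] {P : Measure Ω} [IsProbabilityMeasure P]
  {μ : ℝ} {ν νe : Measure ℝ} {X : ℕ → ℕ → Ω → ℝ}

lemma indepDD (hind : iIndepFun (fun p : ℕ × ℕ => X p.1 p.2) P) (hX : ∀ j, Chain P ν νe (X j))
    (t : ℝ) (K : ℕ) {j j' : ℕ} (hj : j ≠ j') :
    IndepFun (DD μ (X j) t K) (DD μ (X j') t K) P := by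
  have hle : ∀ p : ℕ × ℕ, MeasurableSpace.comap (X p.1 p.2) inferInstance ≤ (inferInstance : MeasurableSpace Ω) :=
    fun p => ((hX p.1).meas p.2).comap_le
  have hi := indep_iSup_of_disjoint hle hind.iIndep
    (S := {p : ℕ × ℕ | p.1 = j}) (T := {p : ℕ × ℕ | p.1 = j'}) (by
      rw [Set.disjoint_left]; rintro p hp hp'; exact hj (hp.symm.trans hp'))
  have hm : ∀ j, Measurable[⨆ p ∈ {p : ℕ × ℕ | p.1 = j}, MeasurableSpace.comap (X p.1 p.2) inferInstance]
      (DD μ (X j) t K) := by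
    intro j
    set m : MeasurableSpace Ω :=
      ⨆ p ∈ {p : ℕ × ℕ | p.1 = j}, MeasurableSpace.comap (X p.1 p.2) inferInstance with hmdef
    have hx : ∀ k, Measurable[m] (X j k) := fun k => by
      refine Measurable.mono (comap_measurable (X j k)) ?_ le_rfl
      exact le_iSup₂_of_le (f := fun (p : ℕ × ℕ) (_ : p ∈ {p : ℕ × ℕ | p.1 = j}) =>
        MeasurableSpace.comap (X p.1 p.2) inferInstance) (j, k) rfl le_rfl
    have h1 : Measurable[m] (fun ω i => X j i ω) := @measurable_pi_lambda _ _ _ m _ _ fun i => hx i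
    have h2 : Measurable (fun y : ℕ → ℝ => ((sSup {k : ℕ | ∑ i ∈ Finset.range k, y i ≤ t} : ℕ) : ℝ)
        - μ * t - ∑ i ∈ Finset.range K, (1 - μ * y (i + 1))) := by
      refine ((measurable_from_top.comp (NN_fun_meas t)).sub measurable_const).sub ?_
      fun_prop
    exact @Measurable.comp _ _ _ m _ _ _ _ h2 h1
  exact Indep.symm (indep_of_indep_of_le_left (Indep.symm (indep_of_indep_of_le_left hi (hm j).comap_le)) (hm j').comap_le)

lemma sumDD_sq (hind : iIndepFun (fun p : ℕ × ℕ => X p.1 p.2) P) (hX : ∀ j, Chain P ν νe (X j))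
    (t : ℝ) (K : ℕ) (hL : ∀ j, MemLp (DD μ (X j) t K) 2 P) (h0 : ∀ j, ∫ ω, DD μ (X j) t K ω ∂P = 0)
    (B : ℝ) (hB : ∀ j, ∫ ω, DD μ (X j) t K ω ^ 2 ∂P ≤ B) (n : ℕ) :
    ∫ ω, (∑ j ∈ Finset.range n, DD μ (X j) t K ω) ^ 2 ∂P ≤ n * B := by
  have h1 := IndepFun.variance_sum (X := fun j => DD μ (X j) t K) (s := Finset.range n) (μ := P)
    (fun i _ => hL i) (fun i _ j _ hij => indepDD hind hX t K hij)
  have hmz : ∫ ω, (∑ j ∈ Finset.range n, DD μ (X j) t K) ω ∂P = 0 := by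
    simp only [Finset.sum_apply]
    rw [integral_finsetSum _ fun i _ => (hL i).integrable (by norm_num)]
    simp [h0]
  rw [variance_of_integral_eq_zero (Finset.aemeasurable_sum _ fun i _ => (hL i).aemeasurable) hmz] at h1
  have h2 : ∫ ω, (∑ j ∈ Finset.range n, DD μ (X j) t K ω) ^ 2 ∂P
      = ∑ j ∈ Finset.range n, ∫ ω, DD μ (X j) t K ω ^ 2 ∂P := by
    rw [← Finset.sum_congr rfl fun j _ => variance_of_integral_eq_zero (hL j).aemeasurable (h0 j), ← h1]
    simp [Finset.sum_apply]
  rw [h2]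
  calc _ ≤ ∑ j ∈ Finset.range n, B := Finset.sum_le_sum fun j _ => hB j
    _ = _ := by simp

lemma rem_tendsto (g : GoodLaw μ ν νe) (hind : iIndepFun (fun p : ℕ × ℕ => X p.1 p.2) P)
    (hX : ∀ j, Chain P ν νe (X j)) (γ : ℕ → ℝ) (hγpos : ∀ n, 0 < γ n) (hγ : Tendsto γ atTop atTop)
    (T : ℝ) (hT : 0 ≤ T) :
    Tendsto (fun n : ℕ => (Real.sqrt ((n:ℝ) * γ n))⁻¹ *
      ∫ ω, |∑ j ∈ Finset.range n, DD μ (X j) (γ n * T) ⌊μ * (γ n * T)⌋₊ ω| ∂P) atTop (nhds 0) := by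
  have hv : 0 ≤ μ ^ 2 * (∫ y, y ^ 2 ∂ν) - 1 := by
    rw [← (hX 0).zeta_var g 0]; exact integral_nonneg fun ω => sq_nonneg _
  rw [Metric.tendsto_atTop']
  intro δ' hδ'
  set δ := δ' / 2 with hδd
  have hδ : 0 < δ := by positivity
  set ε := δ ^ 2 / (T + 1) with hε
  have hε0 : 0 < ε := by positivity
  obtain ⟨C, hC, H⟩ := DD_bound (P := P) g hv hε0
  obtain ⟨n0, hn0⟩ := eventually_atTop.1 (hγ.eventually_ge_atTop (C / ε))
  refine ⟨n0, fun n hn => ?_⟩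
  have hγn := hn0 n hn.le
  have hg := hγpos n
  have hnpos : (0:ℝ) < n := by exact_mod_cast (Nat.zero_le _).trans_lt hn
  set s := Real.sqrt ((n:ℝ) * γ n) with hs
  have hspos : 0 < s := Real.sqrt_pos.2 (by positivity)
  have hs2 : s ^ 2 = n * γ n := Real.sq_sqrt (by positivity)
  have hTn : 0 ≤ γ n * T := by positivity
  have H' := fun j => H (X j) (hX j) (γ n * T) hTn
  have hsq := sumDD_sq hind hX (γ n * T) ⌊μ * (γ n * T)⌋₊ (fun j => (H' j).1) (fun j => (H' j).2.1) _
    (fun j => (H' j).2.2) n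
  set Y : Ω → ℝ := fun ω => ∑ j ∈ Finset.range n, DD μ (X j) (γ n * T) ⌊μ * (γ n * T)⌋₊ ω with hY
  have hYL : MemLp Y 2 P := by
    have := memLp_finsetSum (Finset.range n) (fun j _ => (H' j).1)
    simpa [hY] using this
  have hE : ∫ ω, Y ω ^ 2 ∂P ≤ δ ^ 2 * s ^ 2 := by
    refine hsq.trans ?_
    rw [hs2]
    have h1 : C ≤ ε * γ n := by rw [div_le_iff₀ hε0] at hγn; linarith
    have h2 : ε * (T + 1) = δ ^ 2 := by rw [hε]; field_simp
    rw [← h2]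
    calc (n:ℝ) * (ε * (γ n * T) + C) ≤ n * (ε * (γ n * T) + ε * γ n) := by gcongr
      _ = _ := by ring
  have hA : ∫ ω, |Y ω| ∂P ≤ ∫ ω, ((2 * δ * s)⁻¹ * Y ω ^ 2 + δ * s / 2) ∂P := by
    refine integral_mono (hYL.integrable (by norm_num)).abs ((hYL.integrable_sq.const_mul _).add (integrable_const _)) fun ω => ?_
    have : 0 ≤ (2 * δ * s)⁻¹ * (|Y ω| - δ * s) ^ 2 := by positivity
    have e : (2 * δ * s)⁻¹ * (|Y ω| - δ * s) ^ 2 = (2 * δ * s)⁻¹ * Y ω ^ 2 + δ * s / 2 - |Y ω| := by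
      rw [← sq_abs (Y ω)]; field_simp; ring
    simp only
    linarith
  rw [integral_add (hYL.integrable_sq.const_mul _) (integrable_const _), integral_const_mul] at hA
  have hA2 : ∫ ω, |Y ω| ∂P ≤ δ * s := by
    refine hA.trans ?_
    simp only [integral_const, probReal_univ, one_smul]
    calc _ ≤ (2 * δ * s)⁻¹ * (δ ^ 2 * s ^ 2) + δ * s / 2 := by gcongr
      _ = _ := by field_simp; ring
  have hn0 : 0 ≤ ∫ ω, |Y ω| ∂P := integral_nonneg fun _ => abs_nonneg _
  rw [Real.dist_eq, sub_zero, abs_of_nonneg (by positivity)]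
  calc s⁻¹ * ∫ ω, |Y ω| ∂P ≤ s⁻¹ * (δ * s) := by gcongr
    _ = δ := by field_simp
    _ < δ' := by rw [hδd]; linarith

lemma charFun_sub_le (Z M : Ω → ℝ) (hZ : Measurable Z) (hM : Measurable M)
    (hi : Integrable (fun ω => Z ω - M ω) P) (r : ℝ) :
    ‖charFun (P.map Z) r - charFun (P.map M) r‖ ≤ |r| * ∫ ω, |Z ω - M ω| ∂P := by
  have hb : ∀ Z : Ω → ℝ, Measurable Z →
      Integrable (fun ω => Complex.exp (((r * Z ω : ℝ) : ℂ) * Complex.I)) P := by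
    intro Z hZ
    refine Integrable.of_bound (by fun_prop) 1 (ae_of_all _ fun ω => ?_)
    rw [Complex.norm_exp_ofReal_mul_I]
  have hc : ∀ Z : Ω → ℝ, Measurable Z → charFun (P.map Z) r =
      ∫ ω, Complex.exp (((r * Z ω : ℝ) : ℂ) * Complex.I) ∂P := by
    intro Z hZ
    rw [charFun_apply_real, integral_map hZ.aemeasurable (by fun_prop)]
    push_cast
    rfl
  rw [hc Z hZ, hc M hM, ← integral_sub (hb Z hZ) (hb M hM), ← integral_const_mul]
  refine norm_integral_le_of_norm_le (hi.abs.const_mul _) (ae_of_all _ fun ω => ?_)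
  have e : Complex.exp (((r * Z ω : ℝ) : ℂ) * Complex.I) - Complex.exp (((r * M ω : ℝ) : ℂ) * Complex.I)
      = Complex.exp (((r * M ω : ℝ) : ℂ) * Complex.I) *
        (Complex.exp (Complex.I * ((r * (Z ω - M ω) : ℝ) : ℂ)) - 1) := by
    rw [mul_sub, ← Complex.exp_add, mul_one]
    congr 2
    push_cast; ring
  rw [e, norm_mul, Complex.norm_exp_ofReal_mul_I, one_mul, ← abs_mul]
  exact Real.norm_exp_I_mul_ofReal_sub_one_le

lemma coef_tendsto (hμ : 0 < μ) (γ : ℕ → ℝ) (hγ : Tendsto γ atTop atTop)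
    (T T' : ℝ) (hT : 0 ≤ T) (hT' : 0 ≤ T') :
    Tendsto (fun n => ((min ⌊μ * (γ n * T)⌋₊ ⌊μ * (γ n * T')⌋₊ : ℕ) : ℝ) / γ n) atTop
      (nhds (μ * min T T')) := by
  have key : ∀ T : ℝ, 0 ≤ T → Tendsto (fun n => ((⌊μ * (γ n * T)⌋₊ : ℕ) : ℝ) / γ n) atTop (nhds (μ * T)) := by
    intro T hT
    have := (tendsto_nat_floor_mul_div_atTop (R := ℝ) (a := μ * T) (by positivity)).comp hγ
    refine this.congr fun n => ?_
    simp only [Function.comp]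
    congr 3; ring_nf
  have h := (key T hT).min (key T' hT')
  rw [mul_min_of_nonneg _ _ hμ.le]
  refine h.congr' ?_
  filter_upwards [hγ.eventually_gt_atTop 0] with n hn
  rw [Nat.cast_min, min_div_div_right hn.le]

end
end RenewalFDD

namespace RenewalFDD
lemma sum_trunc {m M : ℕ} (h : m ≤ M) (f : ℕ → ℝ) :
    ∑ k ∈ Finset.range M, (if k < m then f k else 0) = ∑ k ∈ Finset.range m, f k := by
  rw [← Finset.sum_filter]
  congr 1
  ext k; simp; omega

/-- truncation level -/
noncomputable def KK (μ : ℝ) (γ : ℕ → ℝ) {ℓ : ℕ} (t : Fin ℓ → ℝ) (n : ℕ) (i : Fin ℓ) : ℕ :=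
  ⌊μ * (γ n * t i)⌋₊

/-- largest truncation level -/
noncomputable def KM (μ : ℝ) (γ : ℕ → ℝ) {ℓ : ℕ} (t : Fin ℓ → ℝ) (n : ℕ) : ℕ :=
  Finset.univ.sup (KK μ γ t n)

lemma KK_le (μ : ℝ) (γ : ℕ → ℝ) {ℓ : ℕ} (t : Fin ℓ → ℝ) (n : ℕ) (i : Fin ℓ) :
    KK μ γ t n i ≤ KM μ γ t n := Finset.le_sup (f := KK μ γ t n) (Finset.mem_univ i)

/-- coefficients -/
noncomputable def cc (μ : ℝ) (γ : ℕ → ℝ) {ℓ : ℕ} (t a : Fin ℓ → ℝ) (n : ℕ) (p : ℕ × ℕ) : ℝ :=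
  (Real.sqrt ((n:ℝ) * γ n))⁻¹ * ∑ i, a i * (if p.2 < KK μ γ t n i then 1 else 0)

lemma cc_bound (μ : ℝ) (γ : ℕ → ℝ) {ℓ : ℕ} (t a : Fin ℓ → ℝ) (n : ℕ) (p : ℕ × ℕ) :
    |cc μ γ t a n p| ≤ (Real.sqrt ((n:ℝ) * γ n))⁻¹ * ∑ i, |a i| := by
  unfold cc
  rw [abs_mul, abs_of_nonneg (inv_nonneg.2 (Real.sqrt_nonneg _))]
  refine mul_le_mul_of_nonneg_left ?_ (inv_nonneg.2 (Real.sqrt_nonneg _))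
  refine (Finset.abs_sum_le_sum_abs _ _).trans (Finset.sum_le_sum fun i _ => ?_)
  split_ifs <;> simp

lemma cc_sq (μ : ℝ) (γ : ℕ → ℝ) (hγpos : ∀ n, 0 < γ n) {ℓ : ℕ} (t a : Fin ℓ → ℝ) (n : ℕ) (hn : 0 < n) :
    ∑ p ∈ Finset.range n ×ˢ Finset.range (KM μ γ t n), cc μ γ t a n p ^ 2
      = ∑ i, ∑ j, a i * a j * (((min (KK μ γ t n i) (KK μ γ t n j) : ℕ) : ℝ) / γ n) := by
  have hg := hγpos n
  have hn' : (0:ℝ) < n := by exact_mod_cast hn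
  have hq : (Real.sqrt ((n:ℝ) * γ n))⁻¹ ^ 2 = ((n:ℝ) * γ n)⁻¹ := by
    rw [inv_pow, Real.sq_sqrt (by positivity)]
  have h1 : ∀ k : ℕ, (∑ i, a i * (if k < KK μ γ t n i then (1:ℝ) else 0)) ^ 2
      = ∑ i, ∑ j, a i * a j * (if k < min (KK μ γ t n i) (KK μ γ t n j) then 1 else 0) := by
    intro k
    rw [sq, Finset.sum_mul_sum]
    refine Finset.sum_congr rfl fun i _ => Finset.sum_congr rfl fun j _ => ?_
    by_cases h1 : k < KK μ γ t n i <;> by_cases h2 : k < KK μ γ t n j <;> simp [h1, h2]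
  rw [Finset.sum_product]
  simp only [cc, mul_pow, hq, h1]
  rw [Finset.sum_const, Finset.card_range, nsmul_eq_mul, ← Finset.mul_sum, Finset.sum_comm, ← mul_assoc,
    Finset.mul_sum]
  refine Finset.sum_congr rfl fun i _ => ?_
  rw [Finset.sum_comm, Finset.mul_sum]
  refine Finset.sum_congr rfl fun j _ => ?_
  rw [← Finset.mul_sum, sum_trunc ((min_le_left _ _).trans (KK_le μ γ t n i)) (fun _ => 1)]
  simp only [Finset.sum_const, Finset.card_range, nsmul_eq_mul, mul_one]
  field_simp

lemma cc_sum {Ω : Type*} (μ : ℝ) (γ : ℕ → ℝ) {ℓ : ℕ} (t a : Fin ℓ → ℝ) (n : ℕ) (X : ℕ → ℕ → Ω → ℝ) (ω : Ω) :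
    ∑ p ∈ Finset.range n ×ˢ Finset.range (KM μ γ t n), cc μ γ t a n p * (1 - μ * X p.1 (p.2 + 1) ω)
      = ∑ i, a i * ((Real.sqrt ((n:ℝ) * γ n))⁻¹ * ∑ j ∈ Finset.range n, WW μ (X j) (KK μ γ t n i) ω) := by
  rw [Finset.sum_product]
  have : ∀ j : ℕ, ∑ k ∈ Finset.range (KM μ γ t n), cc μ γ t a n (j, k) * (1 - μ * X j (k + 1) ω)
      = ∑ i, a i * ((Real.sqrt ((n:ℝ) * γ n))⁻¹ * WW μ (X j) (KK μ γ t n i) ω) := by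
    intro j
    simp only [cc, WW]
    simp_rw [Finset.mul_sum, Finset.sum_mul]
    rw [Finset.sum_comm]
    refine Finset.sum_congr rfl fun i _ => ?_
    rw [← sum_trunc (KK_le μ γ t n i)]
    refine Finset.sum_congr rfl fun k _ => ?_
    split_ifs <;> ring
  simp_rw [this]
  rw [Finset.sum_comm]
  simp_rw [Finset.mul_sum]

lemma main {Ω : Type*} [MeasurableSpace Ω] {P : Measure Ω} [IsProbabilityMeasure P]
    {μ : ℝ} {ν νe : Measure ℝ} {X : ℕ → ℕ → Ω → ℝ} (g : GoodLaw μ ν νe)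
    (hind : iIndepFun (fun p : ℕ × ℕ => X p.1 p.2) P)
    (hX : ∀ j, Chain P ν νe (X j)) (γ : ℕ → ℝ) (hγpos : ∀ n, 0 < γ n) (hγ : Tendsto γ atTop atTop)
    {ℓ : ℕ} (t a : Fin ℓ → ℝ) (ht : ∀ i, 0 ≤ t i) (Z : ℕ → Ω → ℝ)
    (hZ : ∀ n ω, Z n ω = ∑ i, a i * ((Real.sqrt ((n:ℝ) * γ n))⁻¹ *
      ∑ j ∈ Finset.range n, ((NN (X j) (γ n * t i) ω : ℝ) - μ * (γ n * t i))))
    (f : BoundedContinuousFunction ℝ ℝ) :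
    Tendsto (fun n : ℕ => ∫ ω, f (Z n ω) ∂P) atTop
      (nhds (∫ x, f x ∂(gaussianReal 0 (Real.toNNReal
        ((μ ^ 2 * (∫ y, y ^ 2 ∂ν) - 1) * (μ * ∑ i, ∑ j, a i * a j * min (t i) (t j))))))) := by
  have hμ := g.pos
  have hv : 0 ≤ μ ^ 2 * (∫ y, y ^ 2 ∂ν) - 1 := by
    rw [← (hX 0).zeta_var g 0]; exact integral_nonneg fun ω => sq_nonneg _
  have hs0 : Tendsto (fun n : ℕ => (Real.sqrt ((n:ℝ) * γ n))⁻¹) atTop (nhds 0) :=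
    (Real.tendsto_sqrt_atTop.comp (tendsto_natCast_atTop_atTop.atTop_mul_atTop₀ hγ)).inv_tendsto_atTop
  -- main term
  set M : ℕ → Ω → ℝ := fun n ω => ∑ p ∈ Finset.range n ×ˢ Finset.range (KM μ γ t n),
    cc μ γ t a n p * (1 - μ * X p.1 (p.2 + 1) ω) with hM
  have hzm : ∀ p : ℕ × ℕ, Measurable (fun ω => 1 - μ * X p.1 (p.2 + 1) ω) := fun p => by
    have := (hX p.1).meas (p.2 + 1)
    fun_prop
  have hMm : ∀ n, Measurable (M n) := fun n =>
    Finset.measurable_fun_sum _ fun p _ => (hzm p).const_mul _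
  set ρ : Measure ℝ := P.map (fun ω => 1 - μ * X 0 1 ω) with hρ
  have hρp : IsProbabilityMeasure ρ := Measure.isProbabilityMeasure_map (hzm (0, 0)).aemeasurable
  have hlaw : ∀ p : ℕ × ℕ, P.map (fun ω => 1 - μ * X p.1 (p.2 + 1) ω) = ρ := by
    have : ∀ p : ℕ × ℕ, P.map (fun ω => 1 - μ * X p.1 (p.2 + 1) ω) = ν.map (fun y => 1 - μ * y) := by
      intro p
      rw [← (hX p.1).law p.2, Measure.map_map (by fun_prop) ((hX p.1).meas _)]
      rfl
    intro p
    rw [this p, hρ, ← this (0, 0)]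
  have hzind : iIndepFun (fun (p : ℕ × ℕ) ω => 1 - μ * X p.1 (p.2 + 1) ω) P := by
    have h1 := hind.precomp (g := fun p : ℕ × ℕ => (p.1, p.2 + 1)) (by
      rintro ⟨a, b⟩ ⟨c, d⟩ h; simpa using h)
    exact h1.comp (fun _ y => 1 - μ * y) (fun _ => by fun_prop)
  have hclt : ∀ r, Tendsto (fun n => charFun (P.map (M n)) r) atTop
      (nhds (charFun (gaussianReal 0 (Real.toNNReal
        ((μ ^ 2 * (∫ y, y ^ 2 ∂ν) - 1) * (μ * ∑ i, ∑ j, a i * a j * min (t i) (t j))))) r)) := by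
    intro r
    refine weighted_clt P ρ ?_ ?_ _ ?_ (fun (p : ℕ × ℕ) ω => 1 - μ * X p.1 (p.2 + 1) ω) hzm hzind hlaw
      _ (cc μ γ t a) (fun n => (Real.sqrt ((n:ℝ) * γ n))⁻¹ * ∑ i, |a i|) ?_ (cc_bound μ γ t a) _ ?_ r
    · rw [hρ, memLp_map_measure_iff (by fun_prop) (hzm (0, 0)).aemeasurable]
      exact (hX 0).zeta_L2 g 0
    · rw [hρ, integral_map (hzm (0, 0)).aemeasurable (by fun_prop)]
      exact (hX 0).zeta_mean g 0
    · rw [hρ, integral_map (hzm (0, 0)).aemeasurable (by fun_prop)]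
      exact (hX 0).zeta_var g 0
    · simpa using hs0.mul_const (∑ i, |a i|)
    · have h1 : Tendsto (fun n => ∑ i, ∑ j, a i * a j * (((min (KK μ γ t n i) (KK μ γ t n j) : ℕ) : ℝ) / γ n))
          atTop (nhds (∑ i, ∑ j, a i * a j * (μ * min (t i) (t j)))) :=
        tendsto_finsetSum _ fun i _ => tendsto_finsetSum _ fun j _ =>
          (coef_tendsto hμ γ hγ (t i) (t j) (ht i) (ht j)).const_mul _
      have e : μ * ∑ i, ∑ j, a i * a j * min (t i) (t j) = ∑ i, ∑ j, a i * a j * (μ * min (t i) (t j)) := by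
        simp_rw [Finset.mul_sum]
        refine Finset.sum_congr rfl fun i _ => Finset.sum_congr rfl fun j _ => by ring
      rw [e]
      refine h1.congr' ?_
      filter_upwards [eventually_gt_atTop 0] with n hn
      rw [cc_sq μ γ hγpos t a n hn]
  -- remainder
  set R : ℕ → Fin ℓ → Ω → ℝ := fun n i ω =>
    ∑ j ∈ Finset.range n, DD μ (X j) (γ n * t i) ⌊μ * (γ n * t i)⌋₊ ω with hR
  have hRi : ∀ n i, Integrable (R n i) P := by
    intro n i
    obtain ⟨C, hC, H⟩ := DD_bound (P := P) g hv one_pos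
    exact integrable_finsetSum _ fun j _ =>
      (H (X j) (hX j) (γ n * t i) (mul_nonneg (hγpos n).le (ht i))).1.integrable (by norm_num)
  have hdiff : ∀ n ω, Z n ω - M n ω = ∑ i, a i * ((Real.sqrt ((n:ℝ) * γ n))⁻¹ * R n i ω) := by
    intro n ω
    simp only [hM, cc_sum]
    rw [hZ, ← Finset.sum_sub_distrib]
    refine Finset.sum_congr rfl fun i _ => ?_
    rw [← mul_sub, ← mul_sub, ← Finset.sum_sub_distrib]
    rfl
  have hZm : ∀ n, Measurable (Z n) := by
    intro n
    have : Z n = fun ω => ∑ i, a i * ((Real.sqrt ((n:ℝ) * γ n))⁻¹ *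
      ∑ j ∈ Finset.range n, ((NN (X j) (γ n * t i) ω : ℝ) - μ * (γ n * t i))) := funext (hZ n)
    rw [this]
    refine Finset.measurable_fun_sum _ fun i _ => Measurable.const_mul (Measurable.const_mul ?_ _) _
    exact Finset.measurable_fun_sum _ fun j _ => ((hX j).measNNr _).sub measurable_const
  have hdi : ∀ n, Integrable (fun ω => Z n ω - M n ω) P := by
    intro n
    simp_rw [hdiff]
    exact integrable_finsetSum _ fun i _ => ((hRi n i).const_mul _).const_mul _
  have hrem : Tendsto (fun n => ∫ ω, |Z n ω - M n ω| ∂P) atTop (nhds 0) := by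
    have h1 : Tendsto (fun n : ℕ => ∑ i, |a i| * ((Real.sqrt ((n:ℝ) * γ n))⁻¹ * ∫ ω, |R n i ω| ∂P)) atTop
        (nhds (∑ i : Fin ℓ, |a i| * 0)) :=
      tendsto_finsetSum _ fun i _ => (rem_tendsto g hind hX γ hγpos hγ (t i) (ht i)).const_mul _
    simp only [mul_zero, Finset.sum_const_zero] at h1
    refine squeeze_zero (fun n => integral_nonneg fun _ => abs_nonneg _) (fun n => ?_) h1
    have h2 : ∑ i, |a i| * ((Real.sqrt ((n:ℝ) * γ n))⁻¹ * ∫ ω, |R n i ω| ∂P)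
        = ∫ ω, ∑ i, |a i| * ((Real.sqrt ((n:ℝ) * γ n))⁻¹ * |R n i ω|) ∂P := by
      rw [integral_finsetSum _ fun i _ => ((hRi n i).abs.const_mul _).const_mul _]
      simp_rw [integral_const_mul]
    rw [h2]
    refine integral_mono (hdi n).abs
      (integrable_finsetSum _ fun i _ => ((hRi n i).abs.const_mul _).const_mul _) fun ω => ?_
    simp only [hdiff]
    refine (Finset.abs_sum_le_sum_abs _ _).trans (Finset.sum_le_sum fun i _ => ?_)
    rw [abs_mul, abs_mul, abs_of_nonneg (inv_nonneg.2 (Real.sqrt_nonneg _))]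
  have hfin : ∀ r, Tendsto (fun n => charFun (P.map (Z n)) r) atTop
      (nhds (charFun (gaussianReal 0 (Real.toNNReal
        ((μ ^ 2 * (∫ y, y ^ 2 ∂ν) - 1) * (μ * ∑ i, ∑ j, a i * a j * min (t i) (t j))))) r)) := by
    intro r
    have h1 : Tendsto (fun n => charFun (P.map (Z n)) r - charFun (P.map (M n)) r) atTop (nhds 0) := by
      refine squeeze_zero_norm (fun n => charFun_sub_le _ _ (hZm n) (hMm n) (hdi n) r) ?_
      simpa using hrem.const_mul |r|
    have := (hclt r).add h1
    simpa using this
  have hprob : ∀ n, IsProbabilityMeasure (P.map (Z n)) := fun n =>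
    Measure.isProbabilityMeasure_map (hZm n).aemeasurable
  have hw := ProbabilityMeasure.tendsto_of_tendsto_charFun
    (μ := fun n => (⟨P.map (Z n), hprob n⟩ : ProbabilityMeasure ℝ))
    (μ₀ := ⟨gaussianReal 0 (Real.toNNReal
        ((μ ^ 2 * (∫ y, y ^ 2 ∂ν) - 1) * (μ * ∑ i, ∑ j, a i * a j * min (t i) (t j)))), inferInstance⟩) hfin
  have hw2 := (ProbabilityMeasure.tendsto_iff_forall_integral_tendsto.1 hw) f
  refine hw2.congr fun n => ?_
  exact integral_map (hZm n).aemeasurable f.continuous.aestronglyMeasurable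

end RenewalFDD

/-- Convergence of finite-dimensional distributions of the diffusion-scaled
superposition `B̃ₙ(t) = (n γₙ)^{-1/2} (Bₙ(γₙ t) - n μ γₙ t)` to those of a driftless
Brownian motion with variance parameter `μ c_S²` started at `0`: every linear
combination `Σᵢ aᵢ B̃ₙ(tᵢ)` converges in distribution to a centered Gaussian with
variance `μ c_S² Σᵢ Σⱼ aᵢ aⱼ min(tᵢ, tⱼ)`. -/
theorem fdd_convergence_superposition_renewal
    {Ω : Type*} [MeasurableSpace Ω] (P : Measure Ω) [IsProbabilityMeasure P]
    (μ : ℝ) (hμ : 0 < μ)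
    (ν : Measure ℝ) [IsProbabilityMeasure ν] (hsupp : ν (Set.Iio 0) = 0)
    (hmean : ∫ x, x ∂ν = 1 / μ) (hsq : Integrable (fun x => x ^ 2) ν)
    (cS2 : ℝ) (hcS2 : cS2 = μ ^ 2 * (∫ x, x ^ 2 ∂ν) - 1)
    (F : ℝ → ℝ) (hF : ∀ t, F t = (ν (Set.Iic t)).toReal)
    -- condition (C1): `limsup_{t ↓ 0} t⁻¹ (F t - F 0) < ∞`
    (hC1 : ∃ C : ℝ, ∀ᶠ t in nhdsWithin (0:ℝ) (Set.Ioi 0), (F t - F 0) / t ≤ C)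
    -- condition (C2): finite third moment
    (hC2 : Integrable (fun x => x ^ 3) ν)
    (νe : Measure ℝ)
    (hνe : νe = MeasureTheory.volume.withDensity fun t =>
      ENNReal.ofReal (Set.indicator (Set.Ici 0) (fun u => μ * (1 - F u)) t))
    (ξ : ℕ → ℕ → Ω → ℝ)
    (hmeas : ∀ j k, Measurable (ξ j k))
    (hnonneg : ∀ j k ω, 0 ≤ ξ j k ω)
    (hindep : iIndepFun (m := fun _ : ℕ × ℕ => (inferInstance : MeasurableSpace ℝ))
      (fun p : ℕ × ℕ => ξ p.1 (p.2 + 1)) P)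
    (hdist1 : ∀ j, Measure.map (ξ j 1) P = νe)
    (hdist : ∀ j k, 2 ≤ k → Measure.map (ξ j k) P = ν)
    (S : ℕ → ℕ → Ω → ℝ)
    (hS : ∀ j k ω, S j k ω = ∑ i ∈ Finset.range k, ξ j (i + 1) ω)
    (N : ℕ → ℝ → Ω → ℕ)
    (hN : ∀ j t ω, N j t ω = sSup {k : ℕ | S j k ω ≤ t})
    (γ : ℕ → ℝ) (hγpos : ∀ n, 0 < γ n) (hγ : Tendsto γ atTop atTop)
    (Bt : ℕ → ℝ → Ω → ℝ)
    (hBt : ∀ n t ω, Bt n t ω = (Real.sqrt ((n : ℝ) * γ n))⁻¹ *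
      ((∑ j ∈ Finset.range n, (N j (γ n * t) ω : ℝ)) - (n : ℝ) * μ * γ n * t)) :
    ∀ (ℓ : ℕ) (t : Fin ℓ → ℝ) (a : Fin ℓ → ℝ),
      (∀ i, 0 ≤ t i) → StrictMono t →
      ∀ g : BoundedContinuousFunction ℝ ℝ,
        Tendsto (fun n : ℕ => ∫ ω, g (∑ i, a i * Bt n (t i) ω) ∂P) atTop
          (nhds (∫ x, g x ∂(gaussianReal 0 (Real.toNNReal
            (μ * cS2 * ∑ i, ∑ j, a i * a j * min (t i) (t j)))))) := by
  intro ℓ t a ht _ f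
  have g := RenewalFDD.goodLaw_of μ hμ ν hsupp hmean hsq F hF hC2 νe hνe
  have hX : ∀ j, RenewalFDD.Chain P ν νe (fun k => ξ j (k + 1)) := fun j =>
    { meas := fun k => hmeas _ _
      nonneg := fun k ω => hnonneg _ _ _
      indep := hindep.precomp (g := fun k : ℕ => (j, k)) (by
        intro a b h; simpa using h)
      law0 := hdist1 j
      law := fun k => hdist j _ (by omega) }
  have key := RenewalFDD.main (X := fun j k => ξ j (k + 1)) g hindep hX γ hγpos hγ t a ht
    (fun n ω => ∑ i, a i * Bt n (t i) ω) (fun n ω => by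
      refine Finset.sum_congr rfl fun i _ => ?_
      rw [hBt, Finset.sum_sub_distrib]
      congr 3
      · refine Finset.sum_congr rfl fun j _ => ?_
        rw [hN]
        simp only [hS]
        rfl
      · simp only [Finset.sum_const, Finset.card_range, nsmul_eq_mul]; ring) f
  have e : μ * cS2 * ∑ i, ∑ j, a i * a j * min (t i) (t j)
      = (μ ^ 2 * (∫ y, y ^ 2 ∂ν) - 1) * (μ * ∑ i, ∑ j, a i * a j * min (t i) (t j)) := by
    rw [hcS2]; ring
  rw [e]
  exact key
end

section
/- Fix μ > 0, ρ > 1, and s ≥ 0, and define y^s : [0,∞) → ℝ by y^s(t) = (ρ − 1)μ for 0 ≤ t < s, y^s(t) = (ρ e^{s−t} − 1)μ for s ≤ t < s + log ρ, and y^s(t) = −μ(t − s − log ρ) for t ≥ s + log ρ. Then y^s is the unique càdlàg solution of the integral equation y^s(t) = μ( ρ·min(s, t) − t + (ρ − 1) ) − ∫₀ᵗ y^s(u)⁺ du for all t ≥ 0. -/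
open MeasureTheory Set Filter

/-- A real function is càdlàg on `[0, ∞)` if it is right-continuous at every `t ≥ 0`
and has a finite left limit (within `[0, t)`) at every `t > 0`. -/
def IsCadlag (f : ℝ → ℝ) : Prop :=
  (∀ t : ℝ, 0 ≤ t → ContinuousWithinAt f (Set.Ici t) t) ∧
  (∀ t : ℝ, 0 < t → ∃ l : ℝ, Filter.Tendsto f (nhdsWithin t (Set.Ico 0 t)) (nhds l))

lemma fl_cont (a : ℝ → ℝ) (ha : Continuous a) (Z : ℝ → ℝ)
    (hZ : ∀ t, Z t = a (max t 0) - ∫ u in (0:ℝ)..(max t 0), max (Z u) 0) : Continuous Z := by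
  set K : ℝ → ℝ := fun t => ∫ u in (0:ℝ)..(max t 0), max (Z u) 0 with hK
  have hK0 : ∀ t, 0 ≤ K t := fun t =>
    intervalIntegral.integral_nonneg (le_max_right _ _) (fun u _ => le_max_right _ _)
  set J : Set ℝ := {t | IntervalIntegrable (fun u => max (Z u) 0) volume 0 (max t 0)} with hJ
  have hJlow : ∀ x y, x ≤ y → y ∈ J → x ∈ J := by
    intro x y hxy hy
    have hy' : IntervalIntegrable (fun u => max (Z u) 0) volume 0 (max y 0) := hy
    refine hy'.mono_set ?_
    rw [uIcc_of_le (le_max_right _ _), uIcc_of_le (le_max_right _ _)]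
    exact Icc_subset_Icc le_rfl (max_le_max hxy le_rfl)
  have hJm : MeasurableSet J := by
    have : J.OrdConnected := ⟨fun x _ y hy w hw => hJlow w y hw.2 hy⟩
    exact this.measurableSet
  have hmono : MonotoneOn K J := by
    intro x hx y hy hxy
    refine intervalIntegral.integral_mono_interval le_rfl (le_max_right _ _)
      (max_le_max hxy le_rfl) (Eventually.of_forall fun u => le_max_right _ _) hy
  have hKm : AEMeasurable K volume := by
    have h1 := aemeasurable_restrict_of_monotoneOn (μ := volume) hJm hmono
    have h2 : J.indicator K = K := by
      rw [indicator_eq_self]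
      intro t ht
      by_contra hn
      exact ht (intervalIntegral.integral_undef hn)
    rw [← h2]
    exact (aemeasurable_indicator_iff hJm).2 h1
  have hZK : Z = fun t => a (max t 0) - K t := funext hZ
  have hac : Continuous fun t => a (max t 0) := by fun_prop
  have hZm : AEMeasurable Z volume := by
    rw [hZK]; exact hac.measurable.aemeasurable.sub hKm
  have hgm : AEStronglyMeasurable (fun u => max (Z u) 0) volume :=
    (hZm.max aemeasurable_const).aestronglyMeasurable
  have hgi : ∀ x y, IntervalIntegrable (fun u => max (Z u) 0) volume x y := by
    intro x y
    have hb : IntervalIntegrable (fun t => max (a (max t 0)) 0) volume x y :=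
      (by fun_prop : Continuous fun t => max (a (max t 0)) 0).intervalIntegrable x y
    refine hb.mono_fun hgm.restrict (Eventually.of_forall fun t => ?_)
    simp only [Real.norm_eq_abs]
    rw [abs_of_nonneg (le_max_right _ _), abs_of_nonneg (le_max_right _ _)]
    refine max_le_max ?_ le_rfl
    have := hZ t
    have := hK0 t
    simp only [hK] at this
    linarith
  have hp := intervalIntegral.continuous_primitive hgi 0
  rw [hZK]
  exact hac.sub (hp.comp (by fun_prop : Continuous fun t : ℝ => max t 0))

lemma fl_ext (a : ℝ → ℝ) (z : ℝ → ℝ)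
    (hz : ∀ t, 0 ≤ t → z t = a t - ∫ u in (0:ℝ)..t, max (z u) 0) :
    ∀ t, z (max t 0) = a (max t 0) - ∫ u in (0:ℝ)..(max t 0), max (z (max u 0)) 0 := by
  intro t
  rw [hz _ (le_max_right _ _)]
  congr 1
  refine intervalIntegral.integral_congr fun u hu => ?_
  rw [uIcc_of_le (le_max_right _ _)] at hu
  simp only [max_eq_left hu.1]

lemma fl_unique (a : ℝ → ℝ) (ha : Continuous a) (z y : ℝ → ℝ)
    (hz : ∀ t, 0 ≤ t → z t = a t - ∫ u in (0:ℝ)..t, max (z u) 0)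
    (hy : ∀ t, 0 ≤ t → y t = a t - ∫ u in (0:ℝ)..t, max (y u) 0) :
    ∀ t, 0 ≤ t → z t = y t := by
  have key : ∀ w : ℝ → ℝ, (∀ t, 0 ≤ t → w t = a t - ∫ u in (0:ℝ)..t, max (w u) 0) →
      ∃ P : ℝ → ℝ, P 0 = 0 ∧ (∀ t, 0 ≤ t → w t = a t - P t) ∧ 
        ∀ t, 0 ≤ t → HasDerivAt P (max (a t - P t) 0) t := by
    intro w hw
    have he := fl_ext a w hw
    have hc := fl_cont a ha (fun t => w (max t 0)) he
    have hg : Continuous fun u => max (w (max u 0)) 0 := hc.max continuous_const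
    have hwP : ∀ t, 0 ≤ t → w t = a t - ∫ u in (0:ℝ)..t, max (w (max u 0)) 0 := by
      intro t ht
      have := he t
      rwa [max_eq_left ht] at this
    refine ⟨fun t => ∫ u in (0:ℝ)..t, max (w (max u 0)) 0, by simp, hwP, ?_⟩
    intro t ht
    have h := intervalIntegral.integral_hasDerivAt_right (hg.intervalIntegrable 0 t)
      (hg.stronglyMeasurableAtFilter _ _) hg.continuousAt
    simp only [← hwP t ht]
    simpa only [max_eq_left ht] using h
  obtain ⟨P, hP0, hPz, hPd⟩ := key z hz
  obtain ⟨Q, hQ0, hQy, hQd⟩ := key y hy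
  intro T hT
  have hv : ∀ t, LipschitzWith 1 (fun x : ℝ => max (a t - x) 0) := by
    intro t
    refine LipschitzWith.of_dist_le_mul fun p q => ?_
    simp only [Real.dist_eq, NNReal.coe_one, one_mul]
    refine (abs_max_sub_max_le_abs _ _ _).trans ?_
    rw [show a t - p - (a t - q) = -(p - q) by ring, abs_neg]
  have := ODE_solution_unique (v := fun t x => max (a t - x) 0) (K := 1) (a := 0) (b := T) hv
    (fun t ht => (hPd t ht.1).continuousAt.continuousWithinAt)
    (fun t ht => (hPd t ht.1).hasDerivWithinAt)
    (fun t ht => (hQd t ht.1).continuousAt.continuousWithinAt)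
    (fun t ht => (hQd t ht.1).hasDerivWithinAt) (hP0.trans hQ0.symm)
  rw [hPz T hT, hQy T hT, this ⟨hT, le_rfl⟩]

/-- The explicit piecewise function `y^s` is the unique càdlàg solution of
`y(t) = μ(ρ·min(s,t) - t + (ρ - 1)) - ∫₀ᵗ y(u)⁺ du`. -/
theorem fluid_solution_stopped_arrivals
    (μ ρ s : ℝ) (hμ : 0 < μ) (hρ : 1 < ρ) (hs : 0 ≤ s)
    (ys : ℝ → ℝ)
    (hys : ∀ t : ℝ, ys t =
      if t < s then (ρ - 1) * μ
      else if t < s + Real.log ρ then (ρ * Real.exp (s - t) - 1) * μ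
      else -μ * (t - s - Real.log ρ)) :
    (IsCadlag ys ∧
      ∀ t : ℝ, 0 ≤ t →
        ys t = μ * (ρ * min s t - t + (ρ - 1)) - ∫ u in (0:ℝ)..t, max (ys u) 0) ∧
    ∀ z : ℝ → ℝ, IsCadlag z →
      (∀ t : ℝ, 0 ≤ t →
        z t = μ * (ρ * min s t - t + (ρ - 1)) - ∫ u in (0:ℝ)..t, max (z u) 0) →
      ∀ t : ℝ, 0 ≤ t → z t = ys t := by
  have hl : 0 < Real.log ρ := Real.log_pos hρ
  have hρ0 : 0 < ρ := by linarith
  have hexp : ρ * Real.exp (s - (s + Real.log ρ)) = 1 := by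
    rw [show s - (s + Real.log ρ) = -Real.log ρ by ring, Real.exp_neg, Real.exp_log hρ0]
    field_simp
  have hA : ∀ t, t < s → ys t = (ρ - 1) * μ := fun t h => by rw [hys, if_pos h]
  have hB : ∀ t, s ≤ t → t < s + Real.log ρ → ys t = (ρ * Real.exp (s - t) - 1) * μ :=
    fun t h h' => by rw [hys, if_neg h.not_gt, if_pos h']
  have hC : ∀ t, s + Real.log ρ ≤ t → ys t = -μ * (t - s - Real.log ρ) :=
    fun t h => by rw [hys, if_neg (by linarith), if_neg h.not_gt]
  have hcont : Continuous ys := by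
    have : ys = fun t => if s ≤ t then (if s + Real.log ρ ≤ t then -μ * (t - s - Real.log ρ)
        else (ρ * Real.exp (s - t) - 1) * μ) else (ρ - 1) * μ := by
      funext t
      split_ifs with h1 h2
      · exact hC t h2
      · exact hB t h1 (not_le.1 h2)
      · exact hA t (not_le.1 h1)
    rw [this]
    refine Continuous.if_le (Continuous.if_le (by fun_prop) (by fun_prop) (by fun_prop)
      (by fun_prop) ?_) (by fun_prop) (by fun_prop) (by fun_prop) ?_
    · rintro x rfl
      rw [hexp]; ring
    · rintro x rfl
      rw [if_neg (by linarith)]; simp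
  have hac : Continuous fun t => μ * (ρ * min s t - t + (ρ - 1)) := by fun_prop
  have heq : ∀ t : ℝ, 0 ≤ t →
        ys t = μ * (ρ * min s t - t + (ρ - 1)) - ∫ u in (0:ℝ)..t, max (ys u) 0 := by
    intro t ht
    have hg : Continuous fun u => max (ys u) 0 := hcont.max continuous_const
    have h0 : ys 0 = (ρ - 1) * μ := by
      rcases hs.lt_or_eq with h | h
      · exact hA 0 h
      · rw [hB 0 h.ge (by linarith), ← h]; simp
    have h := intervalIntegral.integral_eq_sub_of_hasDeriv_right
      (f := fun t => μ * (ρ * min s t - t + (ρ - 1)) - ys t) (f' := fun u => max (ys u) 0)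
      (a := 0) (b := t) (hac.sub hcont).continuousOn ?_ (hg.intervalIntegrable 0 t)
    · rw [h]; simp only [min_eq_right hs, h0]; ring
    intro x _
    rcases lt_or_ge x s with h1 | h1
    · -- constant regime
      have hd : HasDerivAt (fun t => μ * (ρ * t - t + (ρ - 1)) - (ρ - 1) * μ)
          (max (ys x) 0) x := by
        rw [hA x h1, max_eq_left (by nlinarith)]
        have := (((((hasDerivAt_id x).const_mul ρ).sub (hasDerivAt_id x)).add_const
          (ρ - 1)).const_mul μ).sub_const ((ρ - 1) * μ)
        refine HasDerivAt.congr_deriv (f := _) this ?_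
        ring
      refine (hd.congr_of_eventuallyEq ?_).hasDerivWithinAt
      filter_upwards [Iio_mem_nhds h1] with u hu
      rw [hA u hu, min_eq_right (le_of_lt hu)]
    rcases lt_or_ge x (s + Real.log ρ) with h2 | h2
    · have hd : HasDerivAt (fun t => μ * (ρ * s - t + (ρ - 1)) - (ρ * Real.exp (s - t) - 1) * μ)
          (max (ys x) 0) x := by
        have hpos : 1 ≤ ρ * Real.exp (s - x) := by
          rw [← hexp]; gcongr
        rw [hB x h1 h2, max_eq_left (mul_nonneg (by linarith) hμ.le)]
        have := (((((hasDerivAt_id x).const_sub (ρ * s)).add_const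
          (ρ - 1)).const_mul μ)).sub
          (((((hasDerivAt_id x).const_sub s).exp.const_mul ρ).sub_const 1).mul_const μ)
        refine HasDerivAt.congr_deriv (f := _) this ?_
        simp only [id]
        ring
      have hw : HasDerivWithinAt (fun t => μ * (ρ * min s t - t + (ρ - 1)) - ys t)
          (max (ys x) 0) (Ici x) x := by
        refine hd.hasDerivWithinAt.congr_of_eventuallyEq ?_ ?_
        · filter_upwards [self_mem_nhdsWithin,
            mem_nhdsWithin_of_mem_nhds (Iio_mem_nhds h2)] with u hu hu2
          have hu' : s ≤ u := h1.trans hu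
          rw [hB u hu' hu2, min_eq_left hu']
        · simp only [hB x h1 h2, min_eq_left h1]
      exact hw.mono Ioi_subset_Ici_self
    · have hd : HasDerivAt (fun t => μ * (ρ * s - t + (ρ - 1)) - -μ * (t - s - Real.log ρ))
          (max (ys x) 0) x := by
        rw [hC x h2, max_eq_right (by nlinarith)]
        have := (((((hasDerivAt_id x).const_sub (ρ * s)).add_const
          (ρ - 1)).const_mul μ)).sub
          ((((hasDerivAt_id x).sub_const s).sub_const (Real.log ρ)).const_mul (-μ))
        refine HasDerivAt.congr_deriv (f := _) this ?_
        ring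
      refine hd.hasDerivWithinAt.congr (fun u hu => ?_) ?_
      · have hu' : s + Real.log ρ ≤ u := h2.trans (le_of_lt hu)
        rw [hC u hu', min_eq_left (by linarith)]
      · rw [hC x h2, min_eq_left h1]
  refine ⟨⟨⟨fun t _ => hcont.continuousWithinAt, fun t _ => ⟨ys t, hcont.continuousWithinAt⟩⟩,
    heq⟩, fun z _ hz => fl_unique _ hac z ys hz heq⟩
end

section
/- For each fixed t > 0, almost surely the following hold as n → ∞: Σ_{j=1}^{n} N_j(γₙ t) → ∞, and both ratio limits Σ_{j=1}^{n} S_{j, N_j(γₙ t)+1} / Σ_{j=1}^{n} N_j(γₙ t) → 1/μ and Σ_{j=1}^{n} S_{j, N_j(γₙ t)} / Σ_{j=1}^{n} N_j(γₙ t) → 1/μ. -/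
open MeasureTheory ProbabilityTheory Set Filter

theorem aux_unif_slln {Ω E : Type*} [MeasurableSpace Ω] [MeasurableSpace E]
    (P : Measure Ω) [IsProbabilityMeasure P] (Q : Measure E) [IsProbabilityMeasure Q]
    (X : ℕ → Ω → E) (hXm : ∀ j, Measurable (X j)) (hXQ : ∀ j, Measure.map (X j) P = Q)
    (hXi : ∀ i j, i ≠ j → IndepFun (X i) (X j) P)
    (g : ℕ → E → ℝ) (hg : ∀ n, Measurable (g n)) (c : ℝ) (H : E → ℝ) (hH : Integrable H Q)
    (hbd : ∀ᵐ x ∂Q, ∀ n, |g n x| ≤ H x)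
    (hlim : ∀ᵐ x ∂Q, Tendsto (fun n => g n x) atTop (nhds c)) :
    ∀ᵐ ω ∂P, Tendsto (fun n : ℕ => (∑ j ∈ Finset.range n, g n (X j ω)) / n) atTop (nhds c) := by
  let D : ℕ → E → ℝ := fun m x => ⨆ n, |g (n + m) x - c|
  have hDm : ∀ m, Measurable (D m) := fun m =>
    Measurable.iSup fun n => ((hg (n + m)).sub_const c).abs
  have hb1 : ∀ᵐ x ∂Q, ∀ n, |g n x - c| ≤ H x + |c| := by
    filter_upwards [hbd] with x hx n
    exact (abs_sub _ _).trans (by linarith [hx n])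
  have hDb : ∀ m, ∀ᵐ x ∂Q, ‖D m x‖ ≤ H x + |c| := by
    intro m
    filter_upwards [hb1] with x hx
    rw [Real.norm_of_nonneg (Real.iSup_nonneg fun n => abs_nonneg _)]
    exact ciSup_le fun n => hx _
  have hHc : Integrable (fun x => H x + |c|) Q := hH.add (integrable_const _)
  have hDi : ∀ m, Integrable (D m) Q := fun m =>
    hHc.mono' (hDm m).aestronglyMeasurable (hDb m)
  have hDlim : ∀ᵐ x ∂Q, Tendsto (fun m => D m x) atTop (nhds 0) := by
    filter_upwards [hlim] with x hx
    rw [Metric.tendsto_atTop] at hx ⊢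
    intro ε hε
    obtain ⟨n0, h0⟩ := hx (ε / 2) (by linarith)
    refine ⟨n0, fun m hm => ?_⟩
    rw [Real.dist_eq, sub_zero, abs_of_nonneg (Real.iSup_nonneg fun n => abs_nonneg _)]
    refine lt_of_le_of_lt (ciSup_le (c := ε / 2) fun n => ?_) (by linarith)
    exact (h0 (n + m) (by omega)).le
  have hElim : Tendsto (fun m => ∫ x, D m x ∂Q) atTop (nhds 0) := by
    have := tendsto_integral_of_dominated_convergence (μ := Q) (F := D) (f := fun _ => 0)
      (fun x => H x + |c|) (fun m => (hDm m).aestronglyMeasurable) hHc hDb hDlim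
    simpa using this
  have hslln : ∀ m, ∀ᵐ ω ∂P, Tendsto (fun n : ℕ => (∑ j ∈ Finset.range n, D m (X j ω)) / n) atTop
      (nhds (∫ x, D m x ∂Q)) := by
    intro m
    have h := strong_law_ae_real (μ := P) (fun j ω => D m (X j ω)) ?_ ?_ ?_
    · have e : ∫ ω, D m (X 0 ω) ∂P = ∫ x, D m x ∂Q := by
        rw [← hXQ 0, integral_map (hXm 0).aemeasurable]
        exact (hDm m).aestronglyMeasurable
      rw [e] at h
      exact h
    · have := hDi m
      rw [← hXQ 0] at this
      exact this.comp_measurable (hXm 0)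
    · intro i j hij
      exact (hXi i j hij).comp (hDm m) (hDm m)
    · intro i
      have : IdentDistrib (X i) (X 0) P P :=
        ⟨(hXm i).aemeasurable, (hXm 0).aemeasurable, by rw [hXQ, hXQ]⟩
      exact this.comp (hDm m)
  have hball : ∀ᵐ ω ∂P, ∀ j, ∀ n, |g n (X j ω) - c| ≤ H (X j ω) + |c| := by
    rw [ae_all_iff]
    intro j
    have := hb1
    rw [← hXQ j] at this
    exact ae_of_ae_map (hXm j).aemeasurable this
  filter_upwards [ae_all_iff.2 hslln, hball] with ω h1 h2
  rw [Metric.tendsto_atTop]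
  intro ε hε
  obtain ⟨m, hm⟩ := (hElim.eventually (gt_mem_nhds hε)).exists
  obtain ⟨n0, hn0⟩ := eventually_atTop.1 ((h1 m).eventually (gt_mem_nhds hm))
  refine ⟨max (max n0 m) 1, fun n hn => ?_⟩
  have hn1 : n0 ≤ n := by omega
  have hn2 : m ≤ n := by omega
  have hn3 : 1 ≤ n := by omega
  have hnpos : (0 : ℝ) < n := by exact_mod_cast hn3
  rw [Real.dist_eq]
  refine lt_of_le_of_lt ?_ (hn0 n hn1)
  have : (∑ j ∈ Finset.range n, g n (X j ω)) / n - c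
      = (∑ j ∈ Finset.range n, (g n (X j ω) - c)) / n := by
    rw [Finset.sum_sub_distrib]; simp; field_simp
  rw [this, abs_div, abs_of_pos hnpos]
  gcongr
  refine (Finset.abs_sum_le_sum_abs _ _).trans (Finset.sum_le_sum fun j _ => ?_)
  have hB : BddAbove (range fun k => |g (k + m) (X j ω) - c|) :=
    ⟨H (X j ω) + |c|, by rintro _ ⟨k, rfl⟩; exact h2 j _⟩
  have := le_ciSup hB (n - m)
  simpa [Nat.sub_add_cancel hn2] using this

theorem aux_dom {E : Type*} [MeasurableSpace E] (Q : Measure E)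
    (f : ℕ → E → ℝ) (hf : ∀ n, Measurable (f n)) (hf0 : ∀ n, ∀ᵐ x ∂Q, 0 ≤ f n x)
    (b : ℕ → ℝ) (hb : Summable b) (hi : ∀ n, Integrable (f n) Q) (hfb : ∀ n, ∫ x, f n x ∂Q ≤ b n) :
    ∃ H : E → ℝ, Integrable H Q ∧ ∀ᵐ x ∂Q, ∀ n, f n x ≤ H x := by
  have hfin : ∫⁻ x, ∑' n, ENNReal.ofReal (f n x) ∂Q ≠ ⊤ := by
    rw [lintegral_tsum fun n => (hf n).ennreal_ofReal.aemeasurable]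
    have : ∀ n, ∫⁻ x, ENNReal.ofReal (f n x) ∂Q ≤ ENNReal.ofReal (b n) := fun n => by
      rw [← ofReal_integral_eq_lintegral_ofReal (hi n) (hf0 n)]
      exact ENNReal.ofReal_le_ofReal (hfb n)
    refine ne_top_of_le_ne_top ?_ (ENNReal.tsum_le_tsum this)
    exact hb.tsum_ofReal_ne_top
  have hM : Measurable fun x => ∑' n, ENNReal.ofReal (f n x) :=
    Measurable.tsum fun n => (hf n).ennreal_ofReal
  refine ⟨fun x => (∑' n, ENNReal.ofReal (f n x)).toReal,
    integrable_toReal_of_lintegral_ne_top hM.aemeasurable hfin, ?_⟩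
  filter_upwards [ae_lt_top hM hfin] with x hx n
  exact (ENNReal.ofReal_le_iff_le_toReal hx.ne).1 (ENNReal.le_tsum n)

noncomputable def auxS (k : ℕ) (x : ℕ → ℝ) : ℝ := ∑ i ∈ Finset.range k, x i

noncomputable def auxN (T : ℝ) (x : ℕ → ℝ) : ℕ := sSup {k : ℕ | auxS k x ≤ T}

theorem auxS_meas (k : ℕ) : Measurable (auxS k) := by
  unfold auxS; fun_prop

theorem auxN_meas (T : ℝ) (hT : 0 ≤ T) : Measurable (auxN T) := by
  have : auxN T = fun x => ⨆ k, (if auxS k x ≤ T then k else 0) := by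
    funext x
    unfold auxN iSup
    congr 1
    ext k
    constructor
    · intro h
      exact ⟨k, if_pos h⟩
    · rintro ⟨i, rfl⟩
      by_cases h : auxS i x ≤ T
      · simp [h]
      · simp only [h, if_false]
        simp [auxS, hT]
  rw [this]
  exact Measurable.iSup fun k => Measurable.ite (measurableSet_le (auxS_meas k) measurable_const)
    measurable_const measurable_const

theorem auxSN_meas (T : ℝ) (hT : 0 ≤ T) (i : ℕ) : Measurable fun x => auxS (auxN T x + i) x := by
  have h : Measurable fun p : ℕ × (ℕ → ℝ) => auxS (p.1 + i) p.2 :=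
    measurable_from_prod_countable_right fun k => auxS_meas (k + i)
  exact h.comp ((auxN_meas T hT).prodMk measurable_id)

structure AuxGood (μ : ℝ) (x : ℕ → ℝ) : Prop where
  nn : ∀ k, 0 ≤ x k
  lim : Tendsto (fun k : ℕ => auxS k x / k) atTop (nhds (1 / μ))

theorem AuxGood.mono {μ : ℝ} {x : ℕ → ℝ} (h : AuxGood μ x) : Monotone fun k => auxS k x := by
  refine monotone_nat_of_le_succ fun k => ?_
  simp only [auxS, Finset.sum_range_succ]
  linarith [h.nn k]

theorem AuxGood.top {μ : ℝ} {x : ℕ → ℝ} (hμ : 0 < μ) (h : AuxGood μ x) :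
    Tendsto (fun k => auxS k x) atTop atTop := by
  have := Tendsto.pos_mul_atTop (by positivity : 0 < 1 / μ) h.lim tendsto_natCast_atTop_atTop
  refine this.congr' ?_
  filter_upwards [eventually_gt_atTop 0] with k hk
  have : (k : ℝ) ≠ 0 := by positivity
  field_simp

theorem AuxGood.spec {μ : ℝ} {x : ℕ → ℝ} (hμ : 0 < μ) (h : AuxGood μ x) {T : ℝ} (hT : 0 ≤ T) :
    auxS (auxN T x) x ≤ T ∧ ∀ k, auxS k x ≤ T → k ≤ auxN T x := by
  have hb : BddAbove {k : ℕ | auxS k x ≤ T} := by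
    obtain ⟨n, hn⟩ := eventually_atTop.1 ((h.top hμ).eventually_gt_atTop T)
    refine ⟨n, fun k hk => ?_⟩
    by_contra hc
    exact absurd (hn k (by omega)) (not_lt.2 hk)
  have hne : {k : ℕ | auxS k x ≤ T}.Nonempty := ⟨0, by simp [auxS, hT]⟩
  exact ⟨Nat.sSup_mem hne hb, fun k hk => le_csSup hb hk⟩

theorem AuxGood.lims {μ : ℝ} {x : ℕ → ℝ} (hμ : 0 < μ) (h : AuxGood μ x) {T : ℕ → ℝ}
    (hT1 : ∀ n, 1 ≤ T n) (hT : Tendsto T atTop atTop) :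
    Tendsto (fun n => (auxN (T n) x : ℝ) / T n) atTop (nhds μ) ∧
    Tendsto (fun n => auxS (auxN (T n) x + 1) x / T n) atTop (nhds 1) ∧
    Tendsto (fun n => auxS (auxN (T n) x + 0) x / T n) atTop (nhds 1) := by
  have sp := fun n => h.spec hμ (by linarith [hT1 n] : 0 ≤ T n)
  have hNt : Tendsto (fun n => auxN (T n) x) atTop atTop := by
    rw [tendsto_atTop]
    intro k
    filter_upwards [hT.eventually_ge_atTop (auxS k x)] with n hn
    exact (sp n).2 k hn
  have hNr : Tendsto (fun n => (auxN (T n) x : ℝ)) atTop atTop :=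
    tendsto_natCast_atTop_atTop.comp hNt
  have hNpos : ∀ᶠ n in atTop, (0 : ℝ) < auxN (T n) x := hNr.eventually_gt_atTop 0
  have l0 : Tendsto (fun n => auxS (auxN (T n) x) x / (auxN (T n) x : ℝ)) atTop (nhds (1 / μ)) :=
    h.lim.comp hNt
  have l1 : Tendsto (fun n => auxS (auxN (T n) x + 1) x / (auxN (T n) x : ℝ)) atTop
      (nhds (1 / μ)) := by
    have a : Tendsto (fun n => auxS (auxN (T n) x + 1) x / ((auxN (T n) x + 1 : ℕ) : ℝ)) atTop
      (nhds (1 / μ)) := h.lim.comp (tendsto_add_atTop_nat 1 |>.comp hNt)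
    have b : Tendsto (fun n => 1 + ((auxN (T n) x : ℝ))⁻¹) atTop (nhds (1 + 0)) :=
      tendsto_const_nhds.add (tendsto_inv_atTop_zero.comp hNr)
    have c := a.mul b
    simp only [add_zero, mul_one] at c
    refine c.congr' ?_
    filter_upwards [hNpos] with n hn
    push_cast
    field_simp
  have l2 : Tendsto (fun n => T n / (auxN (T n) x : ℝ)) atTop (nhds (1 / μ)) := by
    refine tendsto_of_tendsto_of_tendsto_of_le_of_le l0 l1 (fun n => ?_) (fun n => ?_)
    · exact div_le_div_of_nonneg_right (sp n).1 (by positivity)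
    · refine div_le_div_of_nonneg_right ?_ (by positivity)
      by_contra hc
      have := (sp n).2 _ (not_le.1 hc).le
      omega
  have l3 : Tendsto (fun n => (auxN (T n) x : ℝ) / T n) atTop (nhds μ) := by
    have := l2.inv₀ (by positivity)
    simpa using this
  have e : 1 / μ * μ = 1 := by field_simp
  refine ⟨l3, ?_, ?_⟩
  · have := l1.mul l3
    rw [e] at this
    refine this.congr' ?_
    filter_upwards [hNpos] with n hn
    field_simp
  · have := l0.mul l3
    rw [e] at this
    refine this.congr' ?_
    filter_upwards [hNpos] with n hn
    simp only [add_zero]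
    field_simp

theorem AuxGood.bounds {μ : ℝ} {x : ℕ → ℝ} (hμ : 0 < μ) (h : AuxGood μ x) {T : ℝ} (hT : 1 ≤ T)
    {r W V : ℝ} (hr : 1 < r) (hW : ∀ k, r ^ k * Real.exp (-auxS k x) ≤ W)
    (hV : ∀ k : ℕ, x (k + 1) ^ 2 / ((k : ℝ) + 1) ^ 2 ≤ V) :
    |(auxN T x : ℝ) / T| ≤ 1 + x 0 + V + 4 / (Real.log r) ^ 2 * W ∧
    |auxS (auxN T x + 1) x / T| ≤ 1 + x 0 + V + 4 / (Real.log r) ^ 2 * W ∧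
    |auxS (auxN T x + 0) x / T| ≤ 1 + x 0 + V + 4 / (Real.log r) ^ 2 * W := by
  have hTp : 0 < T := by linarith
  obtain ⟨h1, -⟩ := h.spec hμ hTp.le
  have hnn : ∀ k, 0 ≤ auxS k x := fun k => Finset.sum_nonneg fun i _ => h.nn i
  set N := auxN T x with hNdef
  have hlr : 0 < Real.log r := Real.log_pos hr
  have hW1 : 1 ≤ W := by simpa [auxS] using hW 0
  have hV0 : 0 ≤ V := le_trans (by positivity) (hV 0)
  have hx0 := h.nn 0
  have hq0 : (0 : ℝ) ≤ N / T := by positivity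
  have hlog : (N : ℝ) * Real.log r ≤ T + Real.log W := by
    have := Real.log_le_log (by positivity) (hW N)
    rw [Real.log_mul (by positivity) (by positivity), Real.log_pow, Real.log_exp] at this
    linarith
  have hs : 1 + Real.log W ≤ 2 * √W := by
    have h2 := Real.log_le_sub_one_of_pos (Real.sqrt_pos.2 (by linarith : 0 < W))
    rw [Real.log_sqrt (by linarith)] at h2
    linarith
  have hlW : 0 ≤ Real.log W := Real.log_nonneg hW1
  have hq : (N : ℝ) / T ≤ 2 * √W / Real.log r := by
    rw [div_le_div_iff₀ hTp hlr]
    nlinarith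
  have hq2 : ((N : ℝ) / T) ^ 2 ≤ 4 / (Real.log r) ^ 2 * W := by
    refine (pow_le_pow_left₀ hq0 hq 2).trans (le_of_eq ?_)
    rw [div_pow, mul_pow, Real.sq_sqrt (by linarith)]
    ring
  have hS0 : auxS N x / T ≤ 1 := by rw [div_le_one hTp]; exact h1
  refine ⟨?_, ?_, ?_⟩
  · rw [abs_of_nonneg hq0]
    nlinarith [sq_nonneg ((N : ℝ) / T - 1)]
  · rw [abs_of_nonneg (div_nonneg (hnn _) hTp.le)]
    have e : auxS (N + 1) x / T = auxS N x / T + x N / T := by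
      simp only [auxS, Finset.sum_range_succ]; ring
    rw [e]
    have hxn : x N / T ≤ x 0 + V + 4 / (Real.log r) ^ 2 * W := by
      rcases Nat.eq_zero_or_pos N with h0 | hp
      · rw [h0]
        have : x 0 / T ≤ x 0 := div_le_self hx0 hT
        have : 0 ≤ 4 / (Real.log r) ^ 2 * W := by positivity
        linarith
      · obtain ⟨k, hk⟩ := Nat.exists_eq_add_of_lt hp
        have hk' : N = k + 1 := by omega
        have hv := hV k
        have hNp : (0 : ℝ) < N := by exact_mod_cast hp
        have hc : (k : ℝ) + 1 = N := by rw [hk']; push_cast; ring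
        rw [← hk', hc, ← div_pow] at hv
        have : x N / T = (x N / N) * (N / T) := by field_simp
        rw [this]
        nlinarith [sq_nonneg (x N / N - N / T), sq_nonneg (x N / N), sq_nonneg ((N : ℝ) / T)]
    linarith
  · simp only [add_zero]
    rw [abs_of_nonneg (div_nonneg (hnn _) hTp.le)]
    have : 0 ≤ 4 / (Real.log r) ^ 2 * W := by positivity
    linarith

theorem aux_int_e (μ : ℝ) (hμ : 0 < μ)
    (ν : Measure ℝ) [IsProbabilityMeasure ν] (hsupp : ν (Set.Iio 0) = 0)
    (hsq : Integrable (fun x => x ^ 2) ν)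
    (F : ℝ → ℝ) (hF : ∀ t, F t = (ν (Set.Iic t)).toReal)
    (νe : Measure ℝ)
    (hνe : νe = MeasureTheory.volume.withDensity fun t =>
      ENNReal.ofReal (Set.indicator (Set.Ici 0) (fun u => μ * (1 - F u)) t)) :
    Integrable (fun x => x) νe ∧ ∀ᵐ x ∂νe, 0 ≤ x := by
  have hFmono : Monotone F := by
    intro a b hab
    rw [hF, hF]
    exact ENNReal.toReal_mono (measure_ne_top _ _) (measure_mono (Iic_subset_Iic.2 hab))
  have hFm : Measurable F := hFmono.measurable
  have hdm : Measurable fun t =>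
      ENNReal.ofReal (Set.indicator (Set.Ici 0) (fun u => μ * (1 - F u)) t) :=
    ((measurable_const.mul (measurable_const.sub hFm)).indicator measurableSet_Ici).ennreal_ofReal
  have hnn : ∀ᵐ x ∂νe, 0 ≤ x := by
    rw [hνe, ae_withDensity_iff hdm]
    refine Eventually.of_forall fun x hx => ?_
    by_contra hc
    exact hx (by simp [hc])
  refine ⟨⟨measurable_id.aestronglyMeasurable, ?_⟩, hnn⟩
  rw [hasFiniteIntegral_iff_ofReal hnn, hνe,
    lintegral_withDensity_eq_lintegral_mul _ hdm (by fun_prop)]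
  have hnn' : 0 ≤ᵐ[ν] fun x : ℝ => x := by
    rw [EventuallyLE, ae_iff]
    simpa [Set.Iio] using hsupp
  have key := lintegral_rpow_eq_lintegral_meas_lt_mul ν hnn' (by fun_prop) (p := 2) (by norm_num)
  have hfin : ∫⁻ x, ENNReal.ofReal (x ^ (2 : ℝ)) ∂ν < ⊤ := by
    have := hsq.lintegral_lt_top
    simpa using this
  rw [key] at hfin
  have hfin2 : ∫⁻ t in Ioi (0 : ℝ), ν {a | t < a} * ENNReal.ofReal (t ^ ((2 : ℝ) - 1)) < ⊤ := by
    by_contra hc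
    rw [not_lt_top_iff] at hc
    rw [hc] at hfin
    simp at hfin
  have : ∀ x : ℝ, ((fun t => ENNReal.ofReal (Set.indicator (Set.Ici 0) (fun u => μ * (1 - F u)) t)) *
      fun a => ENNReal.ofReal a) x = ENNReal.ofReal μ *
        (Ioi (0 : ℝ)).indicator (fun t => ν {a | t < a} * ENNReal.ofReal (t ^ ((2 : ℝ) - 1))) x := by
    intro x
    simp only [Pi.mul_apply]
    by_cases hx : 0 < x
    · rw [indicator_of_mem (mem_Ici.2 hx.le), indicator_of_mem (mem_Ioi.2 hx),
        ENNReal.ofReal_mul hμ.le, mul_assoc]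
      have h1 : ENNReal.ofReal (1 - F x) = ν {a | x < a} := by
        have : {a | x < a} = (Iic x)ᶜ := by ext; simp
        rw [this, prob_compl_eq_one_sub measurableSet_Iic, hF,
          ENNReal.ofReal_sub _ ENNReal.toReal_nonneg, ENNReal.ofReal_toReal (measure_ne_top _ _),
          ENNReal.ofReal_one]
      have h2 : x ^ ((2 : ℝ) - 1) = x := by norm_num
      rw [h1, h2]
    · rw [indicator_of_notMem (s := Ioi (0 : ℝ)) (by simpa using hx),
        ENNReal.ofReal_of_nonpos (not_lt.1 hx)]
      simp
  rw [lintegral_congr this, lintegral_const_mul' _ _ (by simp), lintegral_indicator measurableSet_Ioi]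
  exact ENNReal.mul_lt_top (by simp) hfin2

theorem aux_phi (μ : ℝ) (hμ : 0 < μ)
    (ν : Measure ℝ) [IsProbabilityMeasure ν] (hnn : ∀ᵐ x ∂ν, 0 ≤ x)
    (hmean : ∫ x, x ∂ν = 1 / μ) : ∫ x, Real.exp (-x) ∂ν < 1 := by
  have hi : Integrable (fun x : ℝ => Real.exp (-x)) ν := by
    refine (integrable_const (1 : ℝ)).mono' (by fun_prop) ?_
    filter_upwards [hnn] with x hx
    rw [Real.norm_of_nonneg (Real.exp_pos _).le]
    simpa using hx
  have hi1 : Integrable (fun x : ℝ => 1 - Real.exp (-x)) ν := (integrable_const _).sub hi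
  have h0 : 0 ≤ᵐ[ν] fun x : ℝ => 1 - Real.exp (-x) := by
    filter_upwards [hnn] with x hx
    simpa using hx
  have e : ∫ x, (1 - Real.exp (-x)) ∂ν = 1 - ∫ x, Real.exp (-x) ∂ν := by
    rw [integral_sub (integrable_const _) hi]; simp
  have hge := integral_nonneg_of_ae h0
  rcases hge.eq_or_lt with hz | hp
  · exfalso
    have := (integral_eq_zero_iff_of_nonneg_ae h0 hi1).1 hz.symm
    have h2 : (fun x : ℝ => x) =ᵐ[ν] fun _ => 0 := by
      filter_upwards [this] with x hx
      simp only [Pi.zero_apply, sub_eq_zero] at hx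
      have := (Real.exp_eq_one_iff (-x)).1 hx.symm
      linarith
    rw [integral_congr_ae h2] at hmean
    simp at hmean
    linarith
  · linarith

theorem aux_good (μ : ℝ) (hμ : 0 < μ)
    (ν νe : Measure ℝ) [IsProbabilityMeasure ν] (hnn : ∀ᵐ x ∂ν, 0 ≤ x)
    (hmean : ∫ x, x ∂ν = 1 / μ) (hsq : Integrable (fun x => x ^ 2) ν)
    (hei : Integrable (fun x => x) νe) (hnne : ∀ᵐ x ∂νe, 0 ≤ x)
    (Q : Measure (ℕ → ℝ)) [IsProbabilityMeasure Q]
    (hQi : iIndepFun (fun (k : ℕ) (x : ℕ → ℝ) => x k) Q)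
    (hQ0 : Measure.map (fun x : ℕ → ℝ => x 0) Q = νe)
    (hQ1 : ∀ k : ℕ, Measure.map (fun x : ℕ → ℝ => x (k + 1)) Q = ν) :
    (∀ᵐ x ∂Q, AuxGood μ x) ∧ ∃ r : ℝ, 1 < r ∧ ∃ W V : (ℕ → ℝ) → ℝ, Integrable W Q ∧
      Integrable V Q ∧ Integrable (fun x : ℕ → ℝ => x 0) Q ∧
      (∀ᵐ x ∂Q, ∀ k, r ^ k * Real.exp (-auxS k x) ≤ W x) ∧
      (∀ᵐ x ∂Q, ∀ k : ℕ, x (k + 1) ^ 2 / ((k : ℝ) + 1) ^ 2 ≤ V x) := by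
  have hm : ∀ k : ℕ, Measurable fun x : ℕ → ℝ => x k := fun k => by fun_prop
  have hpos : ∀ᵐ x ∂Q, ∀ k, 0 ≤ x k := by
    rw [ae_all_iff]
    intro k
    rcases k with _ | k
    · rw [← hQ0] at hnne
      exact ae_of_ae_map (hm 0).aemeasurable hnne
    · rw [← hQ1 k] at hnn
      exact ae_of_ae_map (hm _).aemeasurable hnn
  have hintk : ∀ (k : ℕ) (f : ℝ → ℝ), Measurable f → Integrable f ν →
      Integrable (fun x : ℕ → ℝ => f (x (k + 1))) Q := by
    intro k f _ hf
    rw [← hQ1 k] at hf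
    exact hf.comp_measurable (hm _)
  have hvalk : ∀ (k : ℕ) (f : ℝ → ℝ), Measurable f →
      ∫ x, f (x (k + 1)) ∂Q = ∫ y, f y ∂ν := by
    intro k f hf
    rw [← hQ1 k, integral_map (hm _).aemeasurable hf.aestronglyMeasurable]
  have hi1 : Integrable (fun x : ℝ => x) ν := by
    refine ((integrable_const (1 : ℝ)).add hsq).mono' (by fun_prop) ?_
    filter_upwards with x
    simp only [Pi.add_apply, Real.norm_eq_abs]
    rw [← sq_abs]
    nlinarith [sq_nonneg (|x| - 1), abs_nonneg x]
  have hx0 : Integrable (fun x : ℕ → ℝ => x 0) Q := by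
    rw [← hQ0] at hei
    exact hei.comp_measurable (hm 0)
  refine ⟨?_, ?_⟩
  · have h := strong_law_ae_real (μ := Q) (fun (k : ℕ) (x : ℕ → ℝ) => x (k + 1))
      (hintk 0 (fun x => x) measurable_id hi1) ?_ ?_
    · filter_upwards [hpos, h] with x h1 h2
      refine ⟨h1, ?_⟩
      rw [hvalk 0 (fun x => x) measurable_id, hmean] at h2
      rw [← tendsto_add_atTop_iff_nat 1]
      have hn : Tendsto (fun k : ℕ => (k : ℝ)) atTop atTop := tendsto_natCast_atTop_atTop
      have a := h2.add ((tendsto_inv_atTop_zero.comp hn).const_mul (x 0))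
      have b : Tendsto (fun k : ℕ => (k : ℝ) / ((k : ℝ) + 1)) atTop (nhds 1) :=
        tendsto_natCast_div_add_atTop (1 : ℝ)
      have c := a.mul b
      simp only [mul_zero, add_zero, mul_one] at c
      refine c.congr' ?_
      filter_upwards [eventually_gt_atTop 0] with k hk
      have : (k : ℝ) ≠ 0 := by positivity
      simp only [auxS, Finset.sum_range_succ', Function.comp]
      push_cast
      field_simp
    · intro i j hij
      exact hQi.indepFun (by simpa using hij)
    · intro i
      exact ⟨(hm _).aemeasurable, (hm _).aemeasurable, by rw [hQ1, hQ1]⟩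
  · set φ := ∫ x, Real.exp (-x) ∂ν with hφ
    have hφ1 : φ < 1 := aux_phi μ hμ ν hnn hmean
    have hφ0 : 0 ≤ φ := integral_nonneg fun x => (Real.exp_pos _).le
    set r := 2 / (1 + φ) with hr
    have hr1 : 1 < r := by rw [hr, lt_div_iff₀ (by linarith)]; linarith
    have hrφ : r * φ < 1 := by
      rw [hr, div_mul_eq_mul_div, div_lt_one (by linarith)]; linarith
    have hSi : ∀ k, Integrable (fun x => Real.exp (-auxS k x)) Q := by
      intro k
      refine (integrable_const (1 : ℝ)).mono'
        ((auxS_meas k).neg.exp).aestronglyMeasurable ?_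
      filter_upwards [hpos] with x hx
      rw [Real.norm_of_nonneg (Real.exp_pos _).le]
      have : 0 ≤ auxS k x := Finset.sum_nonneg fun i _ => hx i
      simpa using this
    have hSv : ∀ k, ∫ x, Real.exp (-auxS (k + 1) x) ∂Q ≤ φ ^ k := by
      intro k
      have h1 := hQi.mgf_sum (t := -1) hm (Finset.range (k + 1))
      have e1 : mgf (∑ i ∈ Finset.range (k + 1), fun x : ℕ → ℝ => x i) Q (-1)
          = ∫ x, Real.exp (-auxS (k + 1) x) ∂Q := by
        simp [mgf, auxS]
      have e2 : ∀ i : ℕ, mgf (fun x : ℕ → ℝ => x (i + 1)) Q (-1) = φ := by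
        intro i
        have := hvalk i (fun y => Real.exp (-y)) (by fun_prop)
        simpa [mgf] using this
      have e3 : mgf (fun x : ℕ → ℝ => x 0) Q (-1) ≤ 1 := by
        have : mgf (fun x : ℕ → ℝ => x 0) Q (-1) ≤ ∫ _, (1 : ℝ) ∂Q := by
          have h2 := hSi 1
          simp only [auxS, Finset.sum_range_one] at h2
          simp only [mgf, neg_mul, one_mul]
          refine integral_mono_ae h2 (integrable_const _) ?_
          filter_upwards [hpos] with x hx
          simpa using hx 0
        simpa using this
      rw [e1, Finset.prod_range_succ'] at h1
      rw [h1]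
      simp only [e2, Finset.prod_const, Finset.card_range]
      exact mul_le_of_le_one_right (pow_nonneg hφ0 k) e3
    obtain ⟨W, hWi, hW⟩ := aux_dom Q (fun k x => r ^ k * Real.exp (-auxS k x))
      (fun k => ((auxS_meas k).neg.exp).const_mul _)
      (fun k => Eventually.of_forall fun x => by positivity)
      (fun k => if k = 0 then 1 else r * (r * φ) ^ (k - 1))
      (by
        rw [← summable_nat_add_iff 1]
        simpa using (summable_geometric_of_lt_one (by positivity) hrφ).mul_left r)
      (fun k => (hSi k).const_mul _)
      (by
        intro k
        rw [integral_const_mul]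
        rcases k with _ | k
        · simp [auxS]
        · simp only [Nat.add_eq_zero_iff, one_ne_zero, and_false, if_false, Nat.add_sub_cancel]
          calc r ^ (k + 1) * _ ≤ r ^ (k + 1) * φ ^ k := by
                gcongr
                exact hSv k
            _ = r * (r * φ) ^ k := by ring)
    obtain ⟨V, hVi, hV⟩ := aux_dom Q (fun k x => x (k + 1) ^ 2 / ((k : ℝ) + 1) ^ 2)
      (fun k => by fun_prop)
      (fun k => Eventually.of_forall fun x => by positivity)
      (fun k => (∫ y, y ^ 2 ∂ν) / ((k : ℝ) + 1) ^ 2)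
      (by
        have : Summable fun k : ℕ => 1 / ((k : ℝ)) ^ 2 := Real.summable_one_div_nat_pow.2 (by norm_num)
        rw [← summable_nat_add_iff 1] at this
        have := this.mul_left (∫ y, y ^ 2 ∂ν)
        simpa [div_eq_mul_inv] using this)
      (fun k => (hintk k (fun y => y ^ 2) (by fun_prop) hsq).div_const _)
      (fun k => by
        rw [integral_div]
        have := hvalk k (fun y => y ^ 2) (by fun_prop)
        exact (congrArg (· / ((k : ℝ) + 1) ^ 2) this).le)
    exact ⟨r, hr1, W, V, hWi, hVi, hx0, hW, hV⟩

/-- Strong-law ratio limits for the superposed stationary renewal processes: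
for each fixed `t > 0`, almost surely `Σ_{j<n} N_j(γₙ t) → ∞` and both ratios
`Σ_j S_{j, N_j(γₙ t)+1} / Σ_j N_j(γₙ t)` and `Σ_j S_{j, N_j(γₙ t)} / Σ_j N_j(γₙ t)`
converge to `1/μ` as `n → ∞`. -/
theorem renewal_ratio_strong_laws
    {Ω : Type*} [MeasurableSpace Ω] (P : Measure Ω) [IsProbabilityMeasure P]
    (μ : ℝ) (hμ : 0 < μ)
    (ν : Measure ℝ) [IsProbabilityMeasure ν] (hsupp : ν (Set.Iio 0) = 0)
    (hmean : ∫ x, x ∂ν = 1 / μ) (hsq : Integrable (fun x => x ^ 2) ν)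
    (F : ℝ → ℝ) (hF : ∀ t, F t = (ν (Set.Iic t)).toReal)
    (νe : Measure ℝ)
    (hνe : νe = MeasureTheory.volume.withDensity fun t =>
      ENNReal.ofReal (Set.indicator (Set.Ici 0) (fun u => μ * (1 - F u)) t))
    (ξ : ℕ → ℕ → Ω → ℝ)
    (hmeas : ∀ j k, Measurable (ξ j k))
    (hnonneg : ∀ j k ω, 0 ≤ ξ j k ω)
    (hindep : iIndepFun
      (fun p : ℕ × ℕ => ξ p.1 (p.2 + 1)) P)
    (hdist1 : ∀ j, Measure.map (ξ j 1) P = νe)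
    (hdist : ∀ j k, 2 ≤ k → Measure.map (ξ j k) P = ν)
    (S : ℕ → ℕ → Ω → ℝ)
    (hS : ∀ j k ω, S j k ω = ∑ i ∈ Finset.range k, ξ j (i + 1) ω)
    (N : ℕ → ℝ → Ω → ℕ)
    (hN : ∀ j t ω, N j t ω = sSup {k : ℕ | S j k ω ≤ t})
    (γ : ℕ → ℝ) (hγpos : ∀ n, 0 < γ n) (hγ : Tendsto γ atTop atTop) :
    ∀ t : ℝ, 0 < t → ∀ᵐ ω ∂P,
      Tendsto (fun n : ℕ => ∑ j ∈ Finset.range n, N j (γ n * t) ω) atTop atTop ∧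
      Tendsto (fun n : ℕ =>
          (∑ j ∈ Finset.range n, S j (N j (γ n * t) ω + 1) ω) /
            (∑ j ∈ Finset.range n, (N j (γ n * t) ω : ℝ)))
        atTop (nhds (1 / μ)) ∧
      Tendsto (fun n : ℕ =>
          (∑ j ∈ Finset.range n, S j (N j (γ n * t) ω) ω) /
            (∑ j ∈ Finset.range n, (N j (γ n * t) ω : ℝ)))
        atTop (nhds (1 / μ)) := by
  intro t ht
  have hνnn : ∀ᵐ x ∂ν, (0 : ℝ) ≤ x := by
    rw [ae_iff]
    simpa [Set.Iio] using hsupp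
  obtain ⟨hei, hnne⟩ := aux_int_e μ hμ ν hsupp hsq F hF νe hνe
  let X : ℕ → Ω → (ℕ → ℝ) := fun j ω k => ξ j (k + 1) ω
  have hXm : ∀ j, Measurable (X j) := fun j => measurable_pi_iff.2 fun k => hmeas j (k + 1)
  have hrow : ∀ j, iIndepFun (fun k => ξ j (k + 1)) P := fun j =>
    hindep.precomp (g := fun k : ℕ => (j, k)) (fun a b h => by simpa using h)
  have hmarg : ∀ j k, Measure.map (ξ j (k + 1)) P = Measure.map (ξ 0 (k + 1)) P := by
    intro j k
    rcases k with _ | k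
    · rw [hdist1, hdist1]
    · rw [hdist _ _ (by omega), hdist _ _ (by omega)]
  have hXQ : ∀ j, Measure.map (X j) P = Measure.map (X 0) P := by
    intro j
    have h1 := (hrow j).map_fun_eq_infinitePi_map (fun k => hmeas j (k + 1))
    have h2 := (hrow 0).map_fun_eq_infinitePi_map (fun k => hmeas 0 (k + 1))
    simp only [X]
    rw [h1, h2]
    simp only [hmarg j]
  have hXi : ∀ i j, i ≠ j → IndepFun (X i) (X j) P := by
    intro i j hij
    have h := indep_iSup_of_disjoint
      (m := fun p : ℕ × ℕ => MeasurableSpace.comap (ξ p.1 (p.2 + 1)) inferInstance)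
      (fun p => (hmeas _ _).comap_le) hindep.iIndep
      (S := {p | p.1 = i}) (T := {p | p.1 = j}) (by
        rw [Set.disjoint_left]
        intro p hp hq
        exact hij (hp.symm.trans hq))
    have hc : ∀ a : ℕ, MeasurableSpace.comap (X a) inferInstance ≤
        ⨆ p ∈ {p : ℕ × ℕ | p.1 = a}, MeasurableSpace.comap (ξ p.1 (p.2 + 1)) inferInstance := by
      intro a
      change MeasurableSpace.comap (X a) MeasurableSpace.pi ≤ _
      rw [MeasurableSpace.pi, MeasurableSpace.comap_iSup]
      refine iSup_le fun k => ?_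
      rw [MeasurableSpace.comap_comp]
      exact le_iSup₂_of_le (f := fun (p : ℕ × ℕ) (_ : p ∈ {p : ℕ × ℕ | p.1 = a}) =>
        MeasurableSpace.comap (ξ p.1 (p.2 + 1)) inferInstance) (a, k) rfl le_rfl
    rw [IndepFun_iff_Indep]
    exact indep_of_indep_of_le_left (indep_of_indep_of_le_right h (hc j)) (hc i)
  set Q := Measure.map (X 0) P with hQ
  have : IsProbabilityMeasure Q := Measure.isProbabilityMeasure_map (hXm 0).aemeasurable
  have hQev : ∀ k : ℕ, Measure.map (fun x : ℕ → ℝ => x k) Q = Measure.map (ξ 0 (k + 1)) P := by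
    intro k
    rw [hQ, Measure.map_map (by fun_prop) (hXm 0)]
    rfl
  have hQi : iIndepFun (fun (k : ℕ) (x : ℕ → ℝ) => x k) Q := by
    rw [iIndepFun_iff_map_fun_eq_infinitePi_map (fun k => by fun_prop)]
    simp only [hQev]
    rw [← (hrow 0).map_fun_eq_infinitePi_map (fun k => hmeas 0 (k + 1))]
    exact Measure.map_id
  obtain ⟨hgood, r, hr, W, V, hWi, hVi, hx0, hW, hV⟩ := aux_good μ hμ ν νe hνnn hmean hsq hei hnne Q hQi
    (by rw [hQev, hdist1]) (fun k => by rw [hQev, hdist _ _ (by omega)])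
  let T : ℕ → ℝ := fun n => max (γ n * t) 1
  have hT1 : ∀ n, 1 ≤ T n := fun n => le_max_right _ _
  have hγt : Tendsto (fun n => γ n * t) atTop atTop := hγ.atTop_mul_const ht
  have hTt : Tendsto T atTop atTop := tendsto_atTop_mono (fun n => le_max_left _ _) hγt
  have hTe : ∀ᶠ n in atTop, T n = γ n * t := by
    filter_upwards [hγt.eventually_ge_atTop 1] with n hn
    exact max_eq_left hn
  let H : (ℕ → ℝ) → ℝ := fun x => 1 + x 0 + V x + 4 / (Real.log r) ^ 2 * W x
  have hH : Integrable H Q :=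
    (((integrable_const _).add hx0).add hVi).add (hWi.const_mul _)
  have hT0 : ∀ n, 0 ≤ T n := fun n => by linarith [hT1 n]
  have hb : ∀ᵐ x ∂Q, ∀ n, |(auxN (T n) x : ℝ) / T n| ≤ H x ∧
      |auxS (auxN (T n) x + 1) x / T n| ≤ H x ∧ |auxS (auxN (T n) x + 0) x / T n| ≤ H x := by
    filter_upwards [hgood, hW, hV] with x h1 h2 h3 n
    exact h1.bounds hμ (hT1 n) hr h2 h3
  have hl := hgood.mono fun x hx => hx.lims hμ hT1 hTt
  have A := aux_unif_slln P Q X hXm hXQ hXi (fun n x => (auxN (T n) x : ℝ) / T n)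
    (fun n => ((measurable_from_top (f := fun k : ℕ => (k : ℝ))).comp
      (auxN_meas (T n) (hT0 n))).div_const _) μ H hH
    (hb.mono fun x hx n => (hx n).1) (hl.mono fun x hx => hx.1)
  have B := aux_unif_slln P Q X hXm hXQ hXi (fun n x => auxS (auxN (T n) x + 1) x / T n)
    (fun n => (auxSN_meas (T n) (hT0 n) 1).div_const _) 1 H hH
    (hb.mono fun x hx n => (hx n).2.1) (hl.mono fun x hx => hx.2.1)
  have C := aux_unif_slln P Q X hXm hXQ hXi (fun n x => auxS (auxN (T n) x + 0) x / T n)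
    (fun n => (auxSN_meas (T n) (hT0 n) 0).div_const _) 1 H hH
    (hb.mono fun x hx n => (hx n).2.2) (hl.mono fun x hx => hx.2.2)
  have eS : ∀ j k ω, S j k ω = auxS k (X j ω) := fun j k ω => hS j k ω
  have eN : ∀ j s ω, N j s ω = auxN s (X j ω) := fun j s ω => by
    rw [hN]; simp only [eS]; rfl
  filter_upwards [A, B, C] with ω a b c
  simp only [eS, eN]
  simp only [add_zero, ← Finset.sum_div] at a b c
  have hnT : Tendsto (fun n : ℕ => (n : ℝ) * T n) atTop atTop :=
    tendsto_natCast_atTop_atTop.atTop_mul_atTop₀ hTt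
  have hq : ∀ f : ℕ → ℝ, Tendsto (fun n => f n / T n / n) atTop (nhds 1) →
      Tendsto (fun n : ℕ => f n / ∑ j ∈ Finset.range n, (auxN (T n) (X j ω) : ℝ)) atTop
        (nhds (1 / μ)) := by
    intro f hf
    refine (hf.div a hμ.ne').congr' ?_
    filter_upwards [eventually_gt_atTop 0] with n hn
    have h1 : (n : ℝ) ≠ 0 := by positivity
    have h2 : T n ≠ 0 := by linarith [hT1 n]
    simp only [Pi.div_apply]
    rw [div_div_div_cancel_right₀ h1, div_div_div_cancel_right₀ h2]
  refine ⟨?_, ?_, ?_⟩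
  · rw [← tendsto_natCast_atTop_iff (R := ℝ)]
    refine (Tendsto.pos_mul_atTop hμ a hnT).congr' ?_
    filter_upwards [eventually_gt_atTop 0, hTe] with n hn hTn
    have h1 : (n : ℝ) ≠ 0 := by positivity
    have h2 : T n ≠ 0 := by linarith [hT1 n]
    rw [← hTn]
    push_cast
    field_simp
  · refine (hq _ b).congr' ?_
    filter_upwards [hTe] with n hTn
    rw [hTn]
  · refine (hq _ c).congr' ?_
    filter_upwards [hTe] with n hTn
    rw [hTn]
end
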